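/- For every h ∈ C(J̃,ℝ), the sequence (G^m h)_{m≥1} converges uniformly on J̃ to a constant function with value L_h. The map h ↦ L_h is linear, positive, satisfies L_{1} = 1 and |L_h − L_{h′}| ≤ ‖h − h′‖ for all h, h′ ∈ C(J̃,ℝ); consequently there is a unique Borel probability measure μ* on J̃ with L_h = ∫_{J̃} h dμ* for all h ∈ C(J̃,ℝ). -/

import Mathlib

open MeasureTheory Filter Topology Polynomial
open scoped OnePoint Classical ENNReal

noncomputable section

namespace SkewRational

/-- The Riemann sphere, modelled as the one-point compactification of `ℂ`. -/
abbrev Sphere : Type := OnePoint ℂ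

/-- The product space `X = Σ_N⁺ × ℂ̂`. -/
abbrev SymX (N : ℕ) : Type := (ℕ → Fin N) × Sphere

variable {N : ℕ}

/-- The left shift on `Σ_N⁺`. -/
def shiftW (w : ℕ → Fin N) : ℕ → Fin N := fun n => w (n + 1)

/-- Prepending a letter to an infinite word. -/
def consW (v : Fin N) (w : ℕ → Fin N) : ℕ → Fin N := fun n => if n = 0 then v else w (n - 1)

/-- Evaluation of the rational map `P/Q` (in irreducible form) on the Riemann sphere. -/
def ratEval (P Q : ℂ[X]) : Sphere → Sphere := fun z =>
  OnePoint.elim z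
    (if Q.natDegree < P.natDegree then (OnePoint.infty : Sphere)
     else if P.natDegree < Q.natDegree then ((0 : ℂ) : Sphere)
     else ((P.leadingCoeff / Q.leadingCoeff : ℂ) : Sphere))
    (fun a => if Q.eval a = 0 then (OnePoint.infty : Sphere) else ((P.eval a / Q.eval a : ℂ) : Sphere))

/-- The multiset of preimages (with multiplicity) of a point of the sphere under `P/Q`. -/
def fiber (P Q : ℂ[X]) (a : Sphere) : Multiset Sphere :=
  OnePoint.elim a
    ((Q.roots.map fun z => (z : Sphere)) +
      Multiset.replicate (max P.natDegree Q.natDegree - Q.natDegree) (OnePoint.infty : Sphere))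
    (fun b =>
      (((P - Polynomial.C b * Q).roots.map fun z => (z : Sphere)) +
        Multiset.replicate
          (max P.natDegree Q.natDegree - (P - Polynomial.C b * Q).natDegree) (OnePoint.infty : Sphere)))

variable (p q : Fin N → ℂ[X])

/-- The degree `d_i` of the rational map `R_i = p i / q i`. -/
def degR (i : Fin N) : ℕ := max (p i).natDegree (q i).natDegree

/-- `D = d₁ + ⋯ + d_N`. -/
def Dtot : ℕ := ∑ i, degR p q i

/-- Standing assumptions: `N ≥ 1`, each `R_i = p i / q i` in irreducible form, all degrees
at least `1`, and at least one degree at least `2`. -/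
def Good : Prop :=
  1 ≤ N ∧ (∀ i, IsCoprime (p i) (q i)) ∧ (∀ i, 1 ≤ degR p q i) ∧ (∃ i, 2 ≤ degR p q i)

/-- The skew-product map `T(w, z) = (σ w, R_{w 0} z)`. -/
def Tmap : SymX N → SymX N := fun x => (shiftW x.1, ratEval (p (x.1 0)) (q (x.1 0)) x.2)

/-- The multiset of preimages of a point under `T`, counted with multiplicity. -/
def preimT (x : SymX N) : Multiset (SymX N) :=
  ∑ v : Fin N, (fiber (p v) (q v) x.2).map fun z => (consW v x.1, z)

/-- The multiset of `n`-th order preimages under `T^n`, counted with multiplicity. -/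
def preimTn : ℕ → SymX N → Multiset (SymX N)
  | 0, x => {x}
  | n + 1, x => (preimT p q x).bind fun y => preimTn n y

/-- The chordal (spherical) metric on the Riemann sphere. -/
def sphDist : Sphere → Sphere → ℝ := fun z w =>
  OnePoint.elim z
    (OnePoint.elim w 0 fun b => 2 / Real.sqrt (1 + ‖b‖ ^ 2))
    (fun a =>
      OnePoint.elim w (2 / Real.sqrt (1 + ‖a‖ ^ 2))
        (fun b => 2 * dist a b / (Real.sqrt (1 + ‖a‖ ^ 2) * Real.sqrt (1 + ‖b‖ ^ 2))))

/-- The metric `d(w, w') = 2^{-n(w,w')}` on `Σ_N⁺`. -/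
def shiftDist (w w' : ℕ → Fin N) : ℝ :=
  if h : ∃ n, w n ≠ w' n then (2 : ℝ)⁻¹ ^ (Nat.find h + 1) else 0

/-- The metric on `X`: maximum of the two coordinate metrics. -/
def dX : SymX N → SymX N → ℝ := fun x y => max (shiftDist x.1 y.1) (sphDist x.2 y.2)

/-- Montel normality of a family of self-maps of the sphere on a set `U`. -/
def NormalOn (F : Set (Sphere → Sphere)) (U : Set Sphere) : Prop :=
  ∀ s : ℕ → Sphere → Sphere, (∀ n, s n ∈ F) →
    ∃ φ : ℕ → ℕ, StrictMono φ ∧ ∃ g : Sphere → Sphere,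
      ∀ K : Set Sphere, K ⊆ U → IsCompact K → ∀ ε : ℝ, 0 < ε →
        ∀ᶠ n in atTop, ∀ z ∈ K, sphDist (s (φ n) z) (g z) < ε

/-- The compositions `R_{w (n-1)} ∘ ⋯ ∘ R_{w 0}`. -/
def itComp (w : ℕ → Fin N) : ℕ → Sphere → Sphere
  | 0 => id
  | n + 1 => ratEval (p (w n)) (q (w n)) ∘ itComp w n

/-- The fibrewise Fatou set `F_w`. -/
def fatouW (w : ℕ → Fin N) : Set Sphere :=
  {z | ∃ U : Set Sphere, IsOpen U ∧ z ∈ U ∧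
    NormalOn {g | ∃ n, 1 ≤ n ∧ g = itComp p q w n} U}

/-- The fibrewise Julia set `J_w`. -/
def juliaW (w : ℕ → Fin N) : Set Sphere := (fatouW p q w)ᶜ

/-- The Julia set `J̃` of the skew-product map `T`. -/
def juliaSet : Set (SymX N) :=
  closure (⋃ w : ℕ → Fin N, {w} ×ˢ juliaW p q w)

/-- The critical points of `T`: `(w, z)` with `z` a critical point of `R_{w 0}`. -/
def critSet : Set (SymX N) :=
  {x | 2 ≤ (fiber (p (x.1 0)) (q (x.1 0))
        (ratEval (p (x.1 0)) (q (x.1 0)) x.2)).count x.2}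

/-- Assumption (A1): no super-attracting periodic point of `T` lies in the Julia set
(a periodic point is super-attracting exactly when its orbit meets the critical set,
i.e. the derivative of the return composition vanishes). -/
def NoSuperAttract : Prop :=
  ∀ x ∈ juliaSet p q, ∀ m : ℕ, 1 ≤ m → (Tmap p q)^[m] x = x →
    ∀ k < m, (Tmap p q)^[k] x ∉ critSet p q

instance : MeasurableSpace (SymX N) := borel _
instance : BorelSpace (SymX N) := ⟨rfl⟩

instance : MeasurableSpace ↥(juliaSet p q) := borel _
instance : BorelSpace ↥(juliaSet p q) := ⟨rfl⟩

/-! ### Fixed points counted with multiplicity -/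

/-- Formal composition of rational maps as pairs of polynomials: `compPair a b = a ∘ b`. -/
def compPair (a b : ℂ[X] × ℂ[X]) : ℂ[X] × ℂ[X] :=
  (∑ i ∈ Finset.range (max a.1.natDegree a.2.natDegree + 1),
      Polynomial.C (a.1.coeff i) * b.1 ^ i * b.2 ^ (max a.1.natDegree a.2.natDegree - i),
   ∑ i ∈ Finset.range (max a.1.natDegree a.2.natDegree + 1),
      Polynomial.C (a.2.coeff i) * b.1 ^ i * b.2 ^ (max a.1.natDegree a.2.natDegree - i))

/-- For a word `[v₁, …, v_m]`, the composite `R_{v_m} ∘ ⋯ ∘ R_{v₁}` as a pair of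
polynomials. -/
def wordPair : List (Fin N) → ℂ[X] × ℂ[X]
  | [] => (Polynomial.X, 1)
  | v :: t => compPair (wordPair t) (p v, q v)

/-- The multiset of fixed points (with multiplicity) on the sphere of the rational map given
by a pair of polynomials; a degree-`k` map has `k + 1` fixed points with multiplicity. -/
def fixMul (a : ℂ[X] × ℂ[X]) : Multiset Sphere :=
  ((a.1 - Polynomial.X * a.2).roots.map fun z => (z : Sphere)) +
    Multiset.replicate
      (max a.1.natDegree a.2.natDegree + 1 - (a.1 - Polynomial.X * a.2).natDegree) (OnePoint.infty : Sphere)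

/-- The periodic word `(v₁ ⋯ v_m v₁ ⋯ v_m ⋯)`. -/
def perW {m : ℕ} (hm : 0 < m) (v : Fin m → Fin N) : ℕ → Fin N :=
  fun n => v ⟨n % m, Nat.mod_lt n hm⟩

/-- The multiset `Fix_m(T)` of fixed points of `T^m`, counted with multiplicity. -/
def fixMultiset (m : ℕ) : Multiset (SymX N) :=
  if hm : 0 < m then
    ∑ v : Fin m → Fin N, (fixMul (wordPair p q (List.ofFn v))).map fun z => (perW hm v, z)
  else 0

/-! ### Thermodynamic formalism -/

/-- The ergodic (Birkhoff) sum `f^n`. -/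
def birk (f : SymX N → ℝ) (n : ℕ) (y : SymX N) : ℝ :=
  ∑ k ∈ Finset.range n, f ((Tmap p q)^[k] y)

/-- `(L_f^n 1)(x) = Σ_{T^n y = x} e^{f^n(y)}`. -/
def LSum (f : SymX N → ℝ) (n : ℕ) (x : SymX N) : ℝ :=
  ((preimTn p q n x).map fun y => Real.exp (birk p q f n y)).sum

/-- The pressure `P(f) = sup_{x ∈ J̃} limsup (1/n) log (L_f^n 1)(x)`. -/
def pressure (f : SymX N → ℝ) : ℝ :=
  ⨆ x : ↥(juliaSet p q), limsup (fun n : ℕ => (n : ℝ)⁻¹ * Real.log (LSum p q f n ↑x)) atTop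

/-- Extension by zero of a function on `J̃` to all of `X`; since `T⁻¹ J̃ = J̃`, the values
outside `J̃` are irrelevant in all expressions below. -/
def jextend (f : ↥(juliaSet p q) → ℝ) : SymX N → ℝ :=
  fun x => if hx : x ∈ juliaSet p q then f ⟨x, hx⟩ else 0

/-- Hölder continuity on `J̃` with respect to the metric `d_X`. -/
def HolderOnJ (f : ↥(juliaSet p q) → ℝ) : Prop :=
  ∃ C : ℝ, 0 < C ∧ ∃ α : ℝ, α ∈ Set.Ioc (0 : ℝ) 1 ∧
    ∀ x y : ↥(juliaSet p q), |f x - f y| ≤ C * dX (x : SymX N) (y : SymX N) ^ α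

/-- `Q(g) = P(f + g) − P(f)`. -/
def Qfun (f g : ↥(juliaSet p q) → ℝ) : ℝ :=
  pressure p q (jextend p q fun x => f x + g x) - pressure p q (jextend p q f)

/-- The Legendre transform `L(m) = sup_g (∫ g dm − Q(g)) ∈ [0, (OnePoint.infty : Sphere)]`. -/
def LLfun (f : ↥(juliaSet p q) → ℝ) (m : ProbabilityMeasure ↥(juliaSet p q)) : EReal :=
  ⨆ g : C(↥(juliaSet p q), ℝ),
    (((∫ x, g x ∂(m : Measure ↥(juliaSet p q))) - Qfun p q f g : ℝ) : EReal)

/-- `ρ(K) = inf_{m ∈ K} L(m)`. -/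
def rho (f : ↥(juliaSet p q) → ℝ) (K : Set (ProbabilityMeasure ↥(juliaSet p q))) : EReal :=
  ⨅ m ∈ K, LLfun p q f m

/-- Membership in `M_T`: `T`-invariance of a probability measure on `J̃`. -/
def MTinv (m : ProbabilityMeasure ↥(juliaSet p q)) : Prop :=
  ∀ A : Set (SymX N), MeasurableSet A →
    ((m : Measure ↥(juliaSet p q)).map Subtype.val) (Tmap p q ⁻¹' A) =
      ((m : Measure ↥(juliaSet p q)).map Subtype.val) A

/-- The orbital measure `μ_{y,n} = (1/n)(δ_y + δ_{Ty} + ⋯ + δ_{T^{n-1}y})`, viewed as a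
measure on `J̃`. -/
def orbMeas (y : SymX N) (n : ℕ) : Measure ↥(juliaSet p q) :=
  Measure.comap Subtype.val
    ((n : ℝ≥0∞)⁻¹ • ∑ k ∈ Finset.range n, Measure.dirac ((Tmap p q)^[k] y))

/-- The (unique, if it exists) probability-measure avatar of `μ` lies in `K`. -/
def inK (μ : Measure ↥(juliaSet p q)) (K : Set (ProbabilityMeasure ↥(juliaSet p q))) : Prop :=
  ∃ ν : ProbabilityMeasure ↥(juliaSet p q), (ν : Measure ↥(juliaSet p q)) = μ ∧ ν ∈ K

/-- The sequence `(1/n) log [Σ_{T^n y = x, μ_{y,n} ∈ K} e^{f^n(y)} / Σ_{T^n y = x} e^{f^n(y)}]`,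
valued in `EReal` with the convention `log 0 = ⊥`. -/
def preimLDSeq (f : ↥(juliaSet p q) → ℝ) (x : SymX N)
    (K : Set (ProbabilityMeasure ↥(juliaSet p q))) : ℕ → EReal := fun n =>
  if (((preimTn p q n x).filter fun y => inK p q (orbMeas p q y n) K).map
        fun y => Real.exp (birk p q (jextend p q f) n y)).sum = 0 then ⊥
  else
    (((n : ℝ)⁻¹ * Real.log
      (((((preimTn p q n x).filter fun y => inK p q (orbMeas p q y n) K).map
          fun y => Real.exp (birk p q (jextend p q f) n y)).sum) /
        LSum p q (jextend p q f) n x) : ℝ) : EReal)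

/-- `Fix_m(T) ∩ J̃` as a multiset. -/
def fixJ (m : ℕ) : Multiset (SymX N) := (fixMultiset p q m).filter fun y => y ∈ juliaSet p q

/-- `Σ_{(ω,ζ) ∈ Fix_m(T) ∩ J̃} e^{f^m(ω,ζ)}`. -/
def fixSum (f : SymX N → ℝ) (m : ℕ) : ℝ :=
  ((fixJ p q m).map fun y => Real.exp (birk p q f m y)).sum

/-- The periodic-point analogue of `preimLDSeq`, with the convention `log 0 = ⊥`. -/
def fixLDSeq (f : ↥(juliaSet p q) → ℝ)
    (K : Set (ProbabilityMeasure ↥(juliaSet p q))) : ℕ → EReal := fun m =>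
  if (((fixJ p q m).filter fun y => inK p q (orbMeas p q y m) K).map
        fun y => Real.exp (birk p q (jextend p q f) m y)).sum = 0 then ⊥
  else
    (((m : ℝ)⁻¹ * Real.log
      (((((fixJ p q m).filter fun y => inK p q (orbMeas p q y m) K).map
          fun y => Real.exp (birk p q (jextend p q f) m y)).sum) /
        fixSum p q (jextend p q f) m) : ℝ) : EReal)

/-! ### Inverse branches -/

/-- Projection of a subset of `X` to the sphere coordinate. -/
def projC (E : Set (SymX N)) : Set Sphere := Prod.snd '' E

/-- For a word `[v₁, …, v_m]`, the composite map `R_{v₁} ∘ R_{v₂} ∘ ⋯ ∘ R_{v_m}`. -/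
def mapWord (l : List (Fin N)) : Sphere → Sphere :=
  l.foldr (fun i f => ratEval (p i) (q i) ∘ f) id

/-- `γ_m(U)`: the total number of analytic inverse branches of `T^m` on `U`, counted over
all `m`-strings.  (A continuous section of a rational map off its critical values is
automatically holomorphic.) -/
def gammaCount (U : Set (SymX N)) (m : ℕ) : ℕ :=
  Nat.card ((v : Fin m → Fin N) ×
    { s : C(↥(projC U), Sphere) // ∀ z : ↥(projC U), mapWord p q (List.ofFn v) (s z) = ↑z })

/-- `C_n = ⋃_{k=1}^n T^k(C)`, the critical values of `T` of order up to `n`. -/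
def critValSet (n : ℕ) : Set (SymX N) :=
  ⋃ k ∈ Finset.Icc 1 n, (Tmap p q)^[k] '' critSet p q

/-- `τ`: the number of distinct critical values of `T` in `U` (projected to the sphere). -/
def tauCount (U : Set (SymX N)) : ℕ := (Prod.snd '' (Tmap p q '' critSet p q ∩ U)).ncard

/-! ### The averaging operator `G` -/

/-- `(G^m h)(x) = D^{-m} Σ_{T^m y = x} h(y)`. -/
def GmFun (h : SymX N → ℝ) (m : ℕ) (x : SymX N) : ℝ :=
  ((Dtot p q : ℝ) ^ m)⁻¹ * ((preimTn p q m x).map h).sum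

/-- The supremum norm on functions on `J̃`. -/
def supJ (f : ↥(juliaSet p q) → ℝ) : ℝ := ⨆ x, |f x|

section

/-! ### Homogeneous coordinates -/

def wedge (u v : ℂ × ℂ) : ℂ := u.1 * v.2 - u.2 * v.1

def pr (u : ℂ × ℂ) : Sphere :=
  if u.2 = 0 then (OnePoint.infty : Sphere) else ((u.1 / u.2 : ℂ) : Sphere)

def lf (z : Sphere) : ℂ × ℂ := OnePoint.elim z ((1 : ℂ), (0 : ℂ)) (fun a => (a, 1))

lemma lf_infty : lf (OnePoint.infty : Sphere) = (1, 0) := rfl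
lemma lf_coe (a : ℂ) : lf (a : Sphere) = (a, 1) := rfl

lemma lf_ne_zero (z : Sphere) : lf z ≠ 0 := by
  induction z using OnePoint.rec <;> simp [lf_infty, lf_coe, Prod.ext_iff]

lemma pr_lf (z : Sphere) : pr (lf z) = z := by
  induction z using OnePoint.rec <;> simp [lf_infty, lf_coe, pr]

lemma wedge_smul_left (c : ℂ) (u v : ℂ × ℂ) : wedge (c • u) v = c * wedge u v := by
  simp [wedge]; ring

lemma wedge_smul_right (c : ℂ) (u v : ℂ × ℂ) : wedge u (c • v) = c * wedge u v := by
  simp [wedge]; ring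

lemma wedge_self (u : ℂ × ℂ) : wedge u u = 0 := by simp [wedge]; ring

lemma norm_wedge_le (u v : ℂ × ℂ) : ‖wedge u v‖ ≤ 2 * ‖u‖ * ‖v‖ := by
  have h1 : ‖u.1 * v.2‖ ≤ ‖u‖ * ‖v‖ := by
    rw [norm_mul]; gcongr
    · exact norm_fst_le u
    · exact norm_snd_le v
  have h2 : ‖u.2 * v.1‖ ≤ ‖u‖ * ‖v‖ := by
    rw [norm_mul]; gcongr
    · exact norm_snd_le u
    · exact norm_fst_le v
  have := norm_sub_le (u.1 * v.2) (u.2 * v.1)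
  unfold wedge; linarith

lemma wedge_eq_zero_iff {u v : ℂ × ℂ} (hu : u ≠ 0) (hv : v ≠ 0) :
    wedge u v = 0 ↔ pr u = pr v := by
  obtain ⟨a, b⟩ := u
  obtain ⟨c, d⟩ := v
  simp only [wedge, pr, ne_eq, Prod.mk_eq_zero, not_and] at *
  by_cases hb : b = 0 <;> by_cases hd : d = 0
  · simp [hb, hd]
  · simp only [hb, hd, if_true, if_false]
    simp only [OnePoint.infty_ne_coe, iff_false]
    simp only [hb] at hu
    have : a ≠ 0 := fun h => hu h trivial
    simp [this, hd]
  · simp only [hb, hd, if_true, if_false]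
    simp only [OnePoint.coe_ne_infty, iff_false]
    have : c ≠ 0 := fun h => hv h hd
    simp [this, hb]
  · simp only [hb, hd, if_false, OnePoint.coe_eq_coe]
    rw [div_eq_div_iff hb hd, sub_eq_zero]
    constructor <;> intro h <;> linear_combination h

lemma pr_smul {c : ℂ} (hc : c ≠ 0) (u : ℂ × ℂ) : pr (c • u) = pr u := by
  by_cases h : u.2 = 0
  · simp [pr, h]
  · simp [pr, h, hc, mul_div_mul_left]

lemma exists_smul_lf {u : ℂ × ℂ} (hu : u ≠ 0) : ∃ c : ℂ, c ≠ 0 ∧ u = c • lf (pr u) := by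
  by_cases h : u.2 = 0
  · refine ⟨u.1, fun h1 => hu (Prod.ext h1 h), ?_⟩
    simp [pr, h, lf_infty]
    exact Prod.ext rfl h
  · refine ⟨u.2, h, ?_⟩
    simp [pr, h, lf_coe]
    refine Prod.ext ?_ ?_ <;> simp; field_simp

def hom (d : ℕ) (H : ℂ[X]) (u : ℂ × ℂ) : ℂ :=
  ∑ i ∈ Finset.range (d + 1), H.coeff i * u.1 ^ i * u.2 ^ (d - i)

def Fl (P Q : ℂ[X]) (u : ℂ × ℂ) : ℂ × ℂ :=
  (hom (max P.natDegree Q.natDegree) P u, hom (max P.natDegree Q.natDegree) Q u)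

lemma hom_continuous (d : ℕ) (H : ℂ[X]) : Continuous (hom d H) := by
  unfold hom; fun_prop

lemma Fl_continuous (P Q : ℂ[X]) : Continuous (Fl P Q) :=
  (hom_continuous _ _).prodMk (hom_continuous _ _)

lemma hom_smul (d : ℕ) (H : ℂ[X]) (c : ℂ) (u : ℂ × ℂ) : hom d H (c • u) = c ^ d * hom d H u := by
  unfold hom
  rw [Finset.mul_sum]
  refine Finset.sum_congr rfl fun i hi => ?_
  have hi : i ≤ d := by simpa [Nat.lt_succ_iff] using hi
  have : c ^ d = c ^ i * c ^ (d - i) := by rw [← pow_add]; congr 1; omega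
  simp only [Prod.smul_fst, Prod.smul_snd, smul_eq_mul, mul_pow, this]; ring

lemma Fl_smul (P Q : ℂ[X]) (c : ℂ) (u : ℂ × ℂ) :
    Fl P Q (c • u) = c ^ (max P.natDegree Q.natDegree) • Fl P Q u := by
  simp [Fl, hom_smul]

lemma hom_of_ne {d : ℕ} {H : ℂ[X]} (hd : H.natDegree ≤ d) {u : ℂ × ℂ} (hu : u.2 ≠ 0) :
    hom d H u = u.2 ^ d * H.eval (u.1 / u.2) := by
  rw [Polynomial.eval_eq_sum_range' (Nat.lt_succ_of_le hd), Finset.mul_sum]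
  refine Finset.sum_congr rfl fun i hi => ?_
  have hi : i ≤ d := by simpa [Nat.lt_succ_iff] using hi
  have : u.2 ^ d = u.2 ^ i * u.2 ^ (d - i) := by rw [← pow_add]; congr 1; omega
  rw [this, div_pow]; field_simp

lemma hom_of_eq (d : ℕ) (H : ℂ[X]) {u : ℂ × ℂ} (hu : u.2 = 0) :
    hom d H u = H.coeff d * u.1 ^ d := by
  unfold hom
  rw [Finset.sum_range_succ, Finset.sum_eq_zero]
  · simp
  · intro i hi
    have : d - i ≠ 0 := by have := Finset.mem_range.1 hi; omega
    simp [hu, this]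

lemma hom_sub_C_mul (d : ℕ) (P Q : ℂ[X]) (b : ℂ) (u : ℂ × ℂ) :
    hom d (P - C b * Q) u = hom d P u - b * hom d Q u := by
  unfold hom
  rw [Finset.mul_sum, ← Finset.sum_sub_distrib]
  refine Finset.sum_congr rfl fun i hi => ?_
  simp; ring

lemma hom_factor {d : ℕ} {H : ℂ[X]} (hd : H.natDegree ≤ d) (u : ℂ × ℂ) :
    hom d H u = H.leadingCoeff * (-1) ^ (d - H.natDegree) *
      (((H.roots.map (OnePoint.some : ℂ → Sphere)) +
        Multiset.replicate (d - H.natDegree) (OnePoint.infty : Sphere)).map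
          fun ζ => wedge u (lf ζ)).prod := by
  have hs : H.Splits := IsAlgClosed.splits H
  have hcard : H.roots.card = H.natDegree := hs.natDegree_eq_card_roots.symm
  have hw : ∀ z : ℂ, wedge u (lf (z : Sphere)) = u.1 - u.2 * z := by
    intro z; simp [wedge, lf_coe]
  rw [Multiset.map_add, Multiset.prod_add, Multiset.map_replicate, Multiset.prod_replicate,
    Multiset.map_map]
  simp only [Function.comp_def, hw]
  have hi : wedge u (lf (OnePoint.infty : Sphere)) = - u.2 := by simp [wedge, lf_infty]
  rw [hi]
  have h1 : ((-1 : ℂ)) ^ (d - H.natDegree) * (-u.2) ^ (d - H.natDegree) = u.2 ^ (d - H.natDegree) := by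
    rw [← mul_pow]; simp
  by_cases hu : u.2 = 0
  · rw [hom_of_eq d H hu]
    simp only [hu, zero_mul, sub_zero, Multiset.map_const', Multiset.prod_replicate, hcard]
    rcases hd.lt_or_eq with h | h
    · have : d - H.natDegree ≠ 0 := by omega
      simp [Polynomial.coeff_eq_zero_of_natDegree_lt h, this]
    · subst h; simp
  · rw [hom_of_ne hd hu]
    have h2 : H.eval (u.1 / u.2) = H.leadingCoeff * (H.roots.map fun z => u.1 / u.2 - z).prod := by
      conv_lhs => rw [hs.eq_prod_roots]
      simp [Polynomial.eval_multiset_prod, Multiset.map_map, Function.comp_def]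
    have h3 : (H.roots.map fun z => u.1 - u.2 * z).prod =
        u.2 ^ H.natDegree * (H.roots.map fun z => u.1 / u.2 - z).prod := by
      rw [← hcard, ← Multiset.prod_replicate, ← Multiset.map_const', ← Multiset.prod_map_mul]
      congr 1
      refine Multiset.map_congr rfl fun z _ => ?_
      field_simp
    rw [h2, h3]
    have h4 : u.2 ^ d = u.2 ^ (d - H.natDegree) * u.2 ^ H.natDegree := by
      rw [← pow_add]; congr 1; omega
    rw [h4, ← h1]; ring

lemma fiber_infty (P Q : ℂ[X]) : fiber P Q (OnePoint.infty : Sphere) =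
    (Q.roots.map (OnePoint.some : ℂ → Sphere)) +
      Multiset.replicate (max P.natDegree Q.natDegree - Q.natDegree) (OnePoint.infty : Sphere) := by
  simp only [fiber, OnePoint.elim_infty]
  simp [Multiset.bind_singleton]

lemma fiber_coe (P Q : ℂ[X]) (b : ℂ) : fiber P Q (b : Sphere) =
    ((P - C b * Q).roots.map (OnePoint.some : ℂ → Sphere)) +
      Multiset.replicate (max P.natDegree Q.natDegree - (P - C b * Q).natDegree)
        (OnePoint.infty : Sphere) := by
  simp only [fiber, OnePoint.elim_some]
  simp [Multiset.bind_singleton]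

section oneMap
variable {P Q : ℂ[X]} (hc : IsCoprime P Q) (hd : 1 ≤ max P.natDegree Q.natDegree)
include hc hd

lemma Q_ne_zero : Q ≠ 0 := by
  rintro rfl
  have := isCoprime_zero_right.1 hc
  have := Polynomial.natDegree_eq_zero_of_isUnit this
  simp [this] at hd

lemma P_ne_zero : P ≠ 0 := by
  rintro rfl
  have := isCoprime_zero_left.1 hc
  have := Polynomial.natDegree_eq_zero_of_isUnit this
  simp [this] at hd

lemma sub_ne_zero' (b : ℂ) : P - C b * Q ≠ 0 := by
  intro h
  have h1 : P = C b * Q := sub_eq_zero.1 h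
  have h2 : IsUnit Q := by
    have : IsCoprime (C b * Q) Q := h1 ▸ hc
    have := this.of_mul_left_right
    exact isCoprime_self.1 this
  have h3 := Polynomial.natDegree_eq_zero_of_isUnit h2
  have h4 : P.natDegree = 0 := by
    rw [h1]
    have := Polynomial.natDegree_C_mul_le b Q
    omega
  omega

lemma coeff_max : P.coeff (max P.natDegree Q.natDegree) ≠ 0 ∨
    Q.coeff (max P.natDegree Q.natDegree) ≠ 0 := by
  rcases le_total P.natDegree Q.natDegree with h | h
  · right; rw [max_eq_right h]
    exact Polynomial.leadingCoeff_ne_zero.2 (Q_ne_zero hc hd)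
  · left; rw [max_eq_left h]
    exact Polynomial.leadingCoeff_ne_zero.2 (P_ne_zero hc hd)

lemma Fl_ne_zero {u : ℂ × ℂ} (hu : u ≠ 0) : Fl P Q u ≠ 0 := by
  intro h
  have h1 := congrArg Prod.fst h
  have h2 := congrArg Prod.snd h
  simp only [Fl, Prod.fst_zero, Prod.snd_zero] at h1 h2
  by_cases h0 : u.2 = 0
  · have : u.1 ≠ 0 := fun h1 => hu (Prod.ext h1 h0)
    rw [hom_of_eq _ _ h0] at h1 h2
    rcases coeff_max hc hd with h | h
    · simp [h, this] at h1
    · simp [h, this] at h2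
  · rw [hom_of_ne (le_max_left _ _) h0] at h1
    rw [hom_of_ne (le_max_right _ _) h0] at h2
    simp [h0] at h1 h2
    obtain ⟨a, b, hab⟩ := hc
    have := congrArg (Polynomial.eval (u.1 / u.2)) hab
    simp [h1, h2] at this

lemma pr_Fl {u : ℂ × ℂ} (hu : u ≠ 0) : pr (Fl P Q u) = ratEval P Q (pr u) := by
  by_cases h0 : u.2 = 0
  · have : u.1 ≠ 0 := fun h1 => hu (Prod.ext h1 h0)
    have e : pr u = OnePoint.infty := by simp [pr, h0]
    rw [e]
    simp only [pr, Fl, hom_of_eq _ _ h0, ratEval, OnePoint.elim_infty]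
    rcases lt_trichotomy Q.natDegree P.natDegree with h | h | h
    · rw [if_pos h, max_eq_left h.le, Polynomial.coeff_eq_zero_of_natDegree_lt h]; simp
    · have hQ : Q.coeff (Q.natDegree) ≠ 0 :=
        Polynomial.leadingCoeff_ne_zero.2 (Q_ne_zero hc hd)
      rw [if_neg h.not_lt, if_neg h.not_gt, h, max_self, ← h]
      simp only [mul_eq_zero, hQ, pow_eq_zero_iff', this, false_and, or_self, if_false]
      rw [mul_div_mul_right _ _ (pow_ne_zero _ this), Polynomial.leadingCoeff,
        Polynomial.leadingCoeff, h]
    · have hQ : Q.coeff (Q.natDegree) ≠ 0 :=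
        Polynomial.leadingCoeff_ne_zero.2 (Q_ne_zero hc hd)
      rw [if_neg h.le.not_gt, if_pos h, max_eq_right h.le,
        Polynomial.coeff_eq_zero_of_natDegree_lt h]
      simp only [mul_eq_zero, hQ, pow_eq_zero_iff', this, false_and, or_self, if_false]
      simp
  · have e : pr u = ((u.1 / u.2 : ℂ) : Sphere) := by simp [pr, h0]
    rw [e]
    simp only [pr, Fl, hom_of_ne (le_max_left _ _) h0, hom_of_ne (le_max_right _ _) h0, ratEval,
      OnePoint.elim_some]
    by_cases hq : Polynomial.eval (u.1 / u.2) Q = 0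
    · simp [hq]
    · have : u.2 ^ (max P.natDegree Q.natDegree) ≠ 0 := pow_ne_zero _ h0
      simp only [mul_eq_zero, this, hq, or_self, if_false]
      rw [mul_div_mul_left _ _ this]

lemma wedge_Fl (b : Sphere) : ∃ c : ℂ, c ≠ 0 ∧ ∀ u, wedge (Fl P Q u) (lf b) =
    c * ((fiber P Q b).map fun ζ => wedge u (lf ζ)).prod := by
  induction b using OnePoint.rec with
  | infty =>
    refine ⟨- (Q.leadingCoeff * (-1) ^ (max P.natDegree Q.natDegree - Q.natDegree)), ?_, ?_⟩
    · have := Polynomial.leadingCoeff_ne_zero.2 (Q_ne_zero hc hd)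
      simp [this]
    · intro u
      have h := hom_factor (le_max_right P.natDegree Q.natDegree) u
      simp only [wedge, Fl, lf_infty, mul_zero, mul_one, zero_sub] at h ⊢
      rw [h]
      rw [fiber_infty]
      ring
  | coe b =>
    have hle : (P - C b * Q).natDegree ≤ max P.natDegree Q.natDegree := by
      refine (Polynomial.natDegree_sub_le _ _).trans (max_le_max le_rfl ?_)
      exact Polynomial.natDegree_C_mul_le b Q
    refine ⟨(P - C b * Q).leadingCoeff *
      (-1) ^ (max P.natDegree Q.natDegree - (P - C b * Q).natDegree), ?_, ?_⟩
    · have := Polynomial.leadingCoeff_ne_zero.2 (sub_ne_zero' hc hd b)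
      rw [mul_ne_zero_iff]
      exact ⟨this, by simp⟩
    · intro u
      have h := hom_factor hle u
      rw [hom_sub_C_mul] at h
      rw [fiber_coe]
      rw [← h]
      simp [wedge, Fl, lf_coe]; ring

lemma card_fiber (b : Sphere) : (fiber P Q b).card = max P.natDegree Q.natDegree := by
  induction b using OnePoint.rec with
  | infty =>
    simp only [fiber_infty, Multiset.card_add, Multiset.card_map,
      Multiset.card_replicate]
    rw [← (IsAlgClosed.splits Q).natDegree_eq_card_roots]
    have := le_max_right P.natDegree Q.natDegree
    omega
  | coe b =>
    simp only [fiber_coe, Multiset.card_add, Multiset.card_map,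
      Multiset.card_replicate]
    rw [← (IsAlgClosed.splits _).natDegree_eq_card_roots]
    have hle : (P - C b * Q).natDegree ≤ max P.natDegree Q.natDegree := by
      refine (Polynomial.natDegree_sub_le _ _).trans (max_le_max le_rfl ?_)
      exact Polynomial.natDegree_C_mul_le b Q
    omega

lemma mem_fiber_iff (b z : Sphere) : z ∈ fiber P Q b ↔ ratEval P Q z = b := by
  obtain ⟨c, hc0, h⟩ := wedge_Fl hc hd b
  have h1 := h (lf z)
  have h2 : wedge (Fl P Q (lf z)) (lf b) = 0 ↔ ratEval P Q z = b := by
    rw [wedge_eq_zero_iff (Fl_ne_zero hc hd (lf_ne_zero z)) (lf_ne_zero b),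
      pr_Fl hc hd (lf_ne_zero z), pr_lf, pr_lf]
  rw [← h2, h1, mul_eq_zero, Multiset.prod_eq_zero_iff]
  simp only [hc0, false_or, Multiset.mem_map]
  constructor
  · intro hz; exact ⟨z, hz, wedge_self _⟩
  · rintro ⟨ζ, hζ, h0⟩
    rw [wedge_eq_zero_iff (lf_ne_zero _) (lf_ne_zero _), pr_lf, pr_lf] at h0
    exact h0 ▸ hζ

lemma crit_finite : {z : Sphere | 2 ≤ (fiber P Q (ratEval P Q z)).count z}.Finite := by
  have hW : derivative P * Q - P * derivative Q ≠ 0 := by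
    intro h0
    have h0 : derivative P * Q = P * derivative Q := sub_eq_zero.1 h0
    have h1 : Q ∣ derivative Q := by
      refine hc.symm.dvd_of_dvd_mul_left ?_
      rw [← h0]; exact dvd_mul_left _ _
    have h2 : P ∣ derivative P := by
      refine hc.dvd_of_dvd_mul_right ?_
      rw [h0]; exact dvd_mul_right _ _
    have key : ∀ H : ℂ[X], H ∣ derivative H → H.natDegree = 0 := by
      intro H hH
      by_contra hne
      have h3 : derivative H ≠ 0 := fun h => hne (Polynomial.derivative_eq_zero.1 h)
      have := Polynomial.natDegree_le_of_dvd hH h3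
      have := Polynomial.natDegree_derivative_lt hne
      omega
    have := key P h2
    have := key Q h1
    omega
  have hdouble : ∀ (H : ℂ[X]) (z : ℂ), H ≠ 0 → 2 ≤ H.roots.count z →
      H.eval z = 0 ∧ (derivative H).eval z = 0 := by
    intro H z hH h2
    rw [Polynomial.count_roots] at h2
    have := (Polynomial.one_lt_rootMultiplicity_iff_isRoot hH).1 h2
    exact ⟨this.1, this.2⟩
  have hcount : ∀ (m : Multiset ℂ) (k : ℕ) (z : ℂ),
      ((m.map (OnePoint.some : ℂ → Sphere)) + Multiset.replicate k (OnePoint.infty : Sphere)).count (z : Sphere)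
        = m.count z := by
    intro m k z
    rw [Multiset.count_add, Multiset.count_map_eq_count' _ _ (OnePoint.coe_injective),
      Multiset.count_replicate, if_neg, add_zero]
    exact OnePoint.infty_ne_coe z
  refine Set.Finite.subset (s := insert (OnePoint.infty : Sphere)
    ((fun z : ℂ => (z : Sphere)) '' ((derivative P * Q - P * derivative Q).roots.toFinset : Set ℂ)))
    ((Set.Finite.image _ (Finset.finite_toSet _)).insert _) ?_
  intro z hz
  induction z using OnePoint.rec with
  | infty => exact Set.mem_insert _ _
  | coe z =>
    refine Set.mem_insert_of_mem _ ⟨z, ?_, rfl⟩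
    simp only [Finset.mem_coe, Multiset.mem_toFinset, Polynomial.mem_roots hW, Polynomial.IsRoot]
    simp only [Set.mem_ofPred_eq] at hz
    generalize hb : ratEval P Q (z : Sphere) = b at hz
    induction b using OnePoint.rec with
    | infty =>
      rw [fiber_infty] at hz
      rw [hcount] at hz
      obtain ⟨h1, h2⟩ := hdouble _ _ (Q_ne_zero hc hd) hz
      simp [h1, h2]
    | coe b =>
      rw [fiber_coe] at hz
      rw [hcount] at hz
      obtain ⟨h1, h2⟩ := hdouble _ _ (sub_ne_zero' hc hd b) hz
      simp at h1 h2
      simp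
      linear_combination (Polynomial.eval z Q) * h2 - (Polynomial.eval z (derivative Q)) * h1

end oneMap

end

section

/-! ### Topology of homogeneous coordinates, continuity of fibres -/

lemma pr_continuousAt {u : ℂ × ℂ} (hu : u ≠ 0) : ContinuousAt pr u := by
  by_cases h0 : u.2 = 0
  · have h1 : u.1 ≠ 0 := fun h1 => hu (Prod.ext h1 h0)
    have e : pr u = OnePoint.infty := by simp [pr, h0]
    rw [ContinuousAt, e]
    intro s hs
    rw [OnePoint.nhds_infty_eq, mem_sup, mem_map, Filter.coclosedCompact_eq_cocompact,
      ← Metric.cobounded_eq_cocompact, ← comap_norm_atTop, mem_comap] at hs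
    obtain ⟨⟨t, ht, hts⟩, hinf⟩ := hs
    obtain ⟨R, hR⟩ := mem_atTop_sets.1 ht
    have hopen : ∀ᶠ v : ℂ × ℂ in 𝓝 u, R * ‖v.2‖ < ‖v.1‖ := by
      have hcont : ContinuousAt (fun v : ℂ × ℂ => ‖v.1‖ - R * ‖v.2‖) u := by fun_prop
      have : 0 < ‖u.1‖ - R * ‖u.2‖ := by simp [h0, h1]
      filter_upwards [hcont.eventually (lt_mem_nhds this)] with v hv
      linarith
    rw [mem_map]
    filter_upwards [hopen] with v hv
    by_cases hv0 : v.2 = 0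
    · simp only [Set.mem_preimage, pr, hv0, if_true]; exact hinf
    · simp only [Set.mem_preimage, pr, hv0, if_false]
      refine hts (hR _ ?_)
      rw [norm_div, le_div_iff₀ (norm_pos_iff.2 hv0)]
      exact hv.le
  · have : pr =ᶠ[𝓝 u] fun v => ((v.1 / v.2 : ℂ) : Sphere) := by
      have : ∀ᶠ v : ℂ × ℂ in 𝓝 u, v.2 ≠ 0 :=
        (continuous_snd.continuousAt (x := u)).eventually_ne h0
      filter_upwards [this] with v hv
      simp [pr, hv]
    refine ContinuousAt.congr ?_ this.symm
    have h2 : ContinuousAt (fun v : ℂ × ℂ => v.1 / v.2) u :=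
      continuousAt_fst.div continuousAt_snd h0
    exact OnePoint.continuous_coe.continuousAt.comp h2

def nlf (z : Sphere) : ℂ × ℂ := ((‖lf z‖⁻¹ : ℝ) : ℂ) • lf z

lemma norm_nlf (z : Sphere) : ‖nlf z‖ = 1 := by
  have := norm_ne_zero_iff.2 (lf_ne_zero z)
  rw [nlf, norm_smul]
  simp [this]

lemma nlf_ne_zero (z : Sphere) : nlf z ≠ 0 := by
  intro h; have := norm_nlf z; simp [h] at this

lemma pr_nlf (z : Sphere) : pr (nlf z) = z := by
  rw [nlf, pr_smul, pr_lf]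
  have := norm_ne_zero_iff.2 (lf_ne_zero z)
  simpa using this

def linP (ζ : Sphere) : ℂ[X] := OnePoint.elim ζ (C (-1)) (fun a => X - C a)

lemma eval_linP (z : ℂ) (ζ : Sphere) : (linP ζ).eval z = wedge (z, 1) (lf ζ) := by
  induction ζ using OnePoint.rec with
  | infty => simp [linP, wedge, lf_infty]
  | coe a => simp [linP, wedge, lf_coe]

lemma linP_ne_zero (ζ : Sphere) : linP ζ ≠ 0 := by
  induction ζ using OnePoint.rec with
  | infty => simp [linP]
  | coe a => simpa [linP] using Polynomial.X_sub_C_ne_zero a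

lemma count_roots_linP (A : Multiset Sphere) (z : ℂ) :
    (A.map linP).prod.roots.count z = A.count (z : Sphere) := by
  induction A using Multiset.induction with
  | empty => simp
  | cons a A ih =>
    rw [Multiset.map_cons, Multiset.prod_cons, Polynomial.roots_mul, Multiset.count_add, ih,
      Multiset.count_cons, add_comm]
    · congr 1
      induction a using OnePoint.rec with
      | infty => simp [linP]
      | coe a =>
        simp only [linP, OnePoint.elim_some, Polynomial.roots_X_sub_C, Multiset.count_singleton,
          OnePoint.coe_eq_coe]
    · refine mul_ne_zero (linP_ne_zero a) ?_
      refine Multiset.prod_ne_zero ?_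
      intro h
      obtain ⟨b, -, hb⟩ := Multiset.mem_map.1 h
      exact linP_ne_zero b hb

lemma multiset_unique {A B : Multiset Sphere} (hcard : A.card = B.card) {c c' : ℂ} (hc : c ≠ 0)
    (hc' : c' ≠ 0) (h : ∀ u, c * (A.map fun ζ => wedge u (lf ζ)).prod =
      c' * (B.map fun ζ => wedge u (lf ζ)).prod) : A = B := by
  have hp : C c * (A.map linP).prod = C c' * (B.map linP).prod := by
    refine Polynomial.funext fun z => ?_
    have := h (z, 1)
    simp only [← eval_linP] at this
    simpa [Polynomial.eval_multiset_prod, Multiset.map_map, Function.comp_def] using this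
  have hfin : ∀ z : ℂ, A.count (z : Sphere) = B.count (z : Sphere) := by
    intro z
    rw [← count_roots_linP, ← count_roots_linP, ← Polynomial.roots_C_mul _ hc, hp,
      Polynomial.roots_C_mul _ hc']
  have hfil : A.filter (fun z => ¬ z = OnePoint.infty) = B.filter (fun z => ¬ z = OnePoint.infty) := by
    ext z
    rw [Multiset.count_filter, Multiset.count_filter]
    induction z using OnePoint.rec with
    | infty => simp
    | coe z => simp [hfin]
  have hA := congrArg Multiset.card (Multiset.filter_add_not (fun z => z = OnePoint.infty) A)
  have hB := congrArg Multiset.card (Multiset.filter_add_not (fun z => z = OnePoint.infty) B)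
  ext z
  induction z using OnePoint.rec with
  | infty =>
    rw [Multiset.card_add] at hA hB
    have e : ∀ M : Multiset Sphere, (Multiset.filter (fun z => z = OnePoint.infty) M).card =
        M.count OnePoint.infty := by
      intro M
      rw [Multiset.count_eq_card_filter_eq]
      congr 2; funext z; exact propext eq_comm
    rw [e] at hA hB
    rw [hfil] at hA
    omega
  | coe z => exact hfin z

lemma exists_tuple {α : Type*} (m : Multiset α) (d : ℕ) (h : m.card = d) :
    ∃ t : Fin d → α, Multiset.map t Finset.univ.val = m := by
  subst h
  obtain ⟨l, rfl⟩ : ∃ l : List α, (l : Multiset α) = m := ⟨m.toList, m.coe_toList⟩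
  refine ⟨fun i => l.get i, ?_⟩
  have := Fin.univ_val_map (fun i => l.get i)
  exact this.trans (by simp)

/-- push-forward of a function under a rational map -/
def push (P Q : ℂ[X]) (f : Sphere → ℝ) (b : Sphere) : ℝ := ((fiber P Q b).map f).sum

lemma push_continuous {P Q : ℂ[X]} (hc : IsCoprime P Q) (hd : 1 ≤ max P.natDegree Q.natDegree)
    {f : Sphere → ℝ} (hf : Continuous f) : Continuous (push P Q f) := by
  rw [continuous_iff_ultrafilter]
  intro b0 𝒰 h𝒰
  obtain ⟨t, ht⟩ : ∃ t : Sphere → Fin (max P.natDegree Q.natDegree) → Sphere,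
      ∀ b, Multiset.map (t b) Finset.univ.val = fiber P Q b := by
    choose t ht using fun b => exists_tuple (fiber P Q b) _ (card_fiber hc hd b)
    exact ⟨t, ht⟩
  have prod_eq : ∀ (s : Fin (max P.natDegree Q.natDegree) → Sphere) (g : Sphere → ℂ),
      ((Multiset.map s Finset.univ.val).map g).prod = ∏ i, g (s i) := by
    intro s g; rw [Multiset.map_map]; rfl
  set E : Sphere → (Fin (max P.natDegree Q.natDegree) → ℂ × ℂ) × (ℂ × ℂ) :=
    fun b => (fun i => nlf (t b i), nlf b) with hE
  have hK : IsCompact ((Set.univ.pi fun _ : Fin (max P.natDegree Q.natDegree) =>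
      Metric.sphere (0 : ℂ × ℂ) 1) ×ˢ Metric.sphere (0 : ℂ × ℂ) 1) :=
    (isCompact_univ_pi fun _ => isCompact_sphere _ _).prod (isCompact_sphere _ _)
  obtain ⟨⟨η, β⟩, hmem, hle⟩ := hK.ultrafilter_le_nhds (𝒰.map E) (by
    rw [le_principal_iff]
    refine Ultrafilter.mem_map.2 (univ_mem' fun b => ?_)
    simp [E, Set.mem_prod, norm_nlf])
  have hlim : Tendsto E 𝒰 (𝓝 (η, β)) := hle
  obtain ⟨hη, hβ⟩ := hmem
  have hβ1 : ‖β‖ = 1 := by simpa using hβ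
  have hη1 : ∀ i, ‖η i‖ = 1 := fun i => by simpa using hη i (Set.mem_univ i)
  have hβ0 : β ≠ 0 := by rintro rfl; simp at hβ1
  have hη0 : ∀ i, η i ≠ 0 := fun i h => by have := hη1 i; simp [h] at this
  have hlimβ : Tendsto (fun b => nlf b) 𝒰 (𝓝 β) := (continuous_snd.tendsto _).comp hlim
  have hlimη : ∀ i, Tendsto (fun b => nlf (t b i)) 𝒰 (𝓝 (η i)) := fun i =>
    (((continuous_apply i).comp continuous_fst).tendsto (η, β)).comp hlim
  have hprβ : pr β = b0 := by
    have h1 : Tendsto (fun b => pr (nlf b)) 𝒰 (𝓝 (pr β)) :=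
      (pr_continuousAt hβ0).tendsto.comp hlimβ
    simp only [pr_nlf] at h1
    exact tendsto_nhds_unique h1 h𝒰
  -- cross relation
  have hcross : ∀ b u u', wedge (Fl P Q u) (nlf b) * ∏ i, wedge u' (nlf (t b i)) =
      wedge (Fl P Q u') (nlf b) * ∏ i, wedge u (nlf (t b i)) := by
    intro b u u'
    obtain ⟨c, -, h⟩ := wedge_Fl hc hd b
    have e : ∀ u, wedge (Fl P Q u) (lf b) = c * ∏ i, wedge u (lf (t b i)) := by
      intro u; rw [h u, ← ht b, prod_eq]
    simp only [nlf, wedge_smul_right, e, Finset.prod_mul_distrib]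
    ring
  have hwc : ∀ u : ℂ × ℂ, Continuous fun v => wedge u v := by
    intro u; unfold wedge; fun_prop
  have hcross' : ∀ u u', wedge (Fl P Q u) β * ∏ i, wedge u' (η i) =
      wedge (Fl P Q u') β * ∏ i, wedge u (η i) := by
    intro u u'
    have hl : ∀ u u', Tendsto (fun b => wedge (Fl P Q u) (nlf b) * ∏ i, wedge u' (nlf (t b i))) 𝒰
        (𝓝 (wedge (Fl P Q u) β * ∏ i, wedge u' (η i))) := by
      intro u u'
      refine (((hwc _).tendsto _).comp hlimβ).mul ?_
      exact tendsto_finsetProd _ fun i _ => ((hwc _).tendsto _).comp (hlimη i)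
    refine tendsto_nhds_unique (hl u u') ?_
    simp only [hcross _ u u']
    exact hl u' u
  obtain ⟨z, hz⟩ := Infinite.exists_notMem_finset
    (Finset.univ.image (fun i => pr (η i)) ∪ (fiber P Q b0).toFinset)
  simp only [Finset.mem_union, Finset.mem_image, Finset.mem_univ, true_and, Multiset.mem_toFinset,
    not_or, not_exists] at hz
  have hz1 : ∏ i, wedge (lf z) (η i) ≠ 0 := by
    refine Finset.prod_ne_zero_iff.2 fun i _ => ?_
    rw [Ne, wedge_eq_zero_iff (lf_ne_zero z) (hη0 i), pr_lf]
    exact fun h => hz.1 i h.symm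
  have hz2 : wedge (Fl P Q (lf z)) β ≠ 0 := by
    rw [Ne, wedge_eq_zero_iff (Fl_ne_zero hc hd (lf_ne_zero z)) hβ0, pr_Fl hc hd (lf_ne_zero z),
      pr_lf, hprβ, ← mem_fiber_iff hc hd]
    exact hz.2
  choose k hk0 hk using fun i => exists_smul_lf (hη0 i)
  obtain ⟨e, he0, he⟩ := exists_smul_lf hβ0
  obtain ⟨c, hc0, hcc⟩ := wedge_Fl hc hd b0
  have key : Multiset.map (fun i => pr (η i)) Finset.univ.val = fiber P Q b0 := by
    refine multiset_unique (by rw [card_fiber hc hd]; simp)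
      (c := wedge (Fl P Q (lf z)) β * ∏ i, k i) (c' := (∏ i, wedge (lf z) (η i)) * e * c)
      (mul_ne_zero hz2 (Finset.prod_ne_zero_iff.2 fun i _ => hk0 i))
      (mul_ne_zero (mul_ne_zero hz1 he0) hc0) ?_
    intro u
    have h1 := hcross' u (lf z)
    have h2 : ∏ i, wedge u (η i) = (∏ i, k i) * ∏ i, wedge u (lf (pr (η i))) := by
      rw [← Finset.prod_mul_distrib]
      refine Finset.prod_congr rfl fun i _ => ?_
      conv_lhs => rw [hk i, wedge_smul_right]
    have h3 : wedge (Fl P Q u) β = e * wedge (Fl P Q u) (lf b0) := by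
      conv_lhs => rw [he, wedge_smul_right, hprβ]
    rw [h2, h3, hcc u] at h1
    rw [prod_eq]
    linear_combination -h1
  have sum_eq : ∀ (s : Fin (max P.natDegree Q.natDegree) → Sphere),
      ((Multiset.map s Finset.univ.val).map f).sum = ∑ i, f (s i) := by
    intro s; rw [Multiset.map_map]; rfl
  have e1 : push P Q f b0 = ∑ i, f (pr (η i)) := by
    rw [push, ← key, sum_eq]
  have e2 : push P Q f = fun b => ∑ i, f (pr (nlf (t b i))) := by
    funext b; rw [push, ← ht b, sum_eq]; simp only [pr_nlf]
  rw [e1, e2]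
  refine tendsto_finsetSum _ fun i _ => ?_
  exact (hf.tendsto _).comp ((pr_continuousAt (hη0 i)).tendsto.comp (hlimη i))

/-- Rational maps are open, in a concrete form. -/
lemma fiber_open {P Q : ℂ[X]} (hc : IsCoprime P Q) (hd : 1 ≤ max P.natDegree Q.natDegree)
    {U : Set Sphere} (hU : IsOpen U) {z : Sphere} (hz : z ∈ U) :
    ∀ᶠ b in 𝓝 (ratEval P Q z), ∃ y ∈ U, ratEval P Q y = b := by
  obtain ⟨f, hf0, hf1, hf01⟩ := exists_continuous_zero_one_of_isClosed (X := Sphere)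
    (s := Uᶜ) (t := {z}) hU.isClosed_compl isClosed_singleton (by simpa using hz)
  have hcont := push_continuous hc hd f.continuous
  have hpos : 0 < push P Q f (ratEval P Q z) := by
    have h1 : z ∈ fiber P Q (ratEval P Q z) := (mem_fiber_iff hc hd _ _).2 rfl
    have h2 : f z = 1 := hf1 rfl
    have : f z ≤ push P Q f (ratEval P Q z) :=
      Multiset.single_le_sum (by
        intro x hx
        obtain ⟨y, -, rfl⟩ := Multiset.mem_map.1 hx
        exact (hf01 y).1) _ (Multiset.mem_map_of_mem f h1)
    linarith
  filter_upwards [hcont.continuousAt.eventually (lt_mem_nhds hpos)] with b hb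
  by_contra hno
  push Not at hno
  have : push P Q f b = 0 := by
    unfold push
    refine Multiset.sum_eq_zero fun x hx => ?_
    obtain ⟨y, hy, rfl⟩ := Multiset.mem_map.1 hx
    refine hf0 fun hyU => hno y hyU ((mem_fiber_iff hc hd _ _).1 hy)
  linarith

lemma ratEval_isOpenMap {P Q : ℂ[X]} (hc : IsCoprime P Q) (hd : 1 ≤ max P.natDegree Q.natDegree) :
    IsOpenMap (ratEval P Q) := by
  intro U hU
  rw [isOpen_iff_mem_nhds]
  rintro _ ⟨z, hz, rfl⟩
  filter_upwards [fiber_open hc hd hU hz] with b hb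
  exact hb

end

section
/-! ### Julia sets -/

lemma winding {H : ℂ → ℂ} (hH : Continuous H) (h0 : ∀ z, H z ≠ 0) (k : ℤ)
    (hk : ∀ t : ℝ, H (Complex.exp (t * Complex.I)) = Complex.exp (k * t * Complex.I) * H 1) :
    k = 0 := by
  have h1 : H 1 ∈ ({0}ᶜ : Set ℂ) := by simpa using h0 1
  obtain ⟨h, ⟨-, hh⟩, -⟩ := Complex.isCoveringMapOn_exp.existsUnique_continuousMap_lifts
    (A := ℂ) ⟨H, hH⟩ (a₀ := 1) (e₀ := Complex.log (H 1))
    (Complex.exp_log (h0 1)) (fun z => h0 z)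
  have hexp : ∀ z, Complex.exp (h z) = H z := fun z => congrFun hh z
  let g : ℝ → ℂ := fun t => h (Complex.exp (t * Complex.I)) - k * t * Complex.I - h 1
  have hg : Continuous g := by
    have := h.continuous
    fun_prop
  have hg1 : ∀ t, Complex.exp (g t) = 1 := by
    intro t
    simp only [g, Complex.exp_sub, hexp, hk]
    field_simp [h0 1]
  have hgc : ∀ t, ∃ n : ℤ, (g t / (2 * Real.pi * Complex.I)) = n := by
    intro t
    obtain ⟨n, hn⟩ := Complex.exp_eq_one_iff.1 (hg1 t)
    refine ⟨n, ?_⟩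
    rw [hn]; field_simp
  choose n hn using hgc
  have hnc : Continuous n := by
    have : Continuous fun t => ((n t : ℤ) : ℂ) := by
      have := hg.div_const (2 * Real.pi * Complex.I)
      simpa only [hn] using this
    have h2 : Continuous fun t => ((n t : ℤ) : ℝ) := by
      have := Complex.continuous_re.comp this
      simpa [Function.comp_def] using this
    exact Int.isClosedEmbedding_coe_real.isEmbedding.continuous_iff.2 h2
  have hconst : n (2 * Real.pi) = n 0 :=
    (PreconnectedSpace.constant inferInstance hnc)
  have e1 := hn (2 * Real.pi)
  have e0 := hn 0
  rw [hconst, ← e0] at e1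
  have hne : (2 * Real.pi * Complex.I : ℂ) ≠ 0 := by simp [Real.pi_ne_zero]
  have := (div_left_inj' hne).1 e1
  simp only [g, Complex.ofReal_mul, Complex.ofReal_ofNat, Complex.exp_two_pi_mul_I] at this
  simp at this
  exact_mod_cast this

def nn (u : ℂ × ℂ) : ℝ := Complex.normSq u.1 + Complex.normSq u.2

def herm (u v : ℂ × ℂ) : ℂ := u.1 * (starRingEnd ℂ) v.1 + u.2 * (starRingEnd ℂ) v.2

lemma herm_wedge (u v : ℂ × ℂ) :
    Complex.normSq (herm u v) + Complex.normSq (wedge u v) = nn u * nn v := by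
  simp only [herm, wedge, nn, Complex.normSq_apply, Complex.add_re, Complex.add_im, Complex.mul_re,
    Complex.mul_im, Complex.sub_re, Complex.sub_im, Complex.conj_re, Complex.conj_im]
  ring

lemma herm_id (u v g : ℂ × ℂ) : herm u v * herm g g =
    herm u g * herm g v + wedge u g * (starRingEnd ℂ) (wedge v g) := by
  simp only [herm, wedge, map_sub, map_mul]
  ring

lemma nn_pos {u : ℂ × ℂ} (hu : u ≠ 0) : 0 < nn u := by
  have h1 := Complex.normSq_nonneg u.1
  have h2 := Complex.normSq_nonneg u.2
  by_contra h
  have e1 : Complex.normSq u.1 = 0 := by unfold nn at h; linarith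
  have e2 : Complex.normSq u.2 = 0 := by unfold nn at h; linarith
  exact hu (Prod.ext (Complex.normSq_eq_zero.1 e1) (Complex.normSq_eq_zero.1 e2))

lemma sphDist_eq (z w : Sphere) :
    sphDist z w = 2 * ‖wedge (lf z) (lf w)‖ / (Real.sqrt (nn (lf z)) * Real.sqrt (nn (lf w))) := by
  induction z using OnePoint.rec with
  | infty =>
    induction w using OnePoint.rec with
    | infty => simp [sphDist, wedge, lf_infty]
    | coe b => simp [sphDist, wedge, lf_infty, lf_coe, nn, Complex.normSq_eq_norm_sq, add_comm]
  | coe a =>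
    induction w using OnePoint.rec with
    | infty => simp [sphDist, wedge, lf_infty, lf_coe, nn, Complex.normSq_eq_norm_sq, add_comm]
    | coe b => simp [sphDist, wedge, lf_coe, nn, Complex.normSq_eq_norm_sq, add_comm, dist_eq_norm]

lemma sph_lt_one {z w : Sphere} (h : sphDist z w < 1) :
    4 * Complex.normSq (wedge (lf z) (lf w)) < nn (lf z) * nn (lf w) := by
  rw [sphDist_eq, ← Real.sqrt_mul (nn_pos (lf_ne_zero z)).le] at h
  have hp : 0 < nn (lf z) * nn (lf w) := mul_pos (nn_pos (lf_ne_zero z)) (nn_pos (lf_ne_zero w))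
  have hs := Real.sqrt_pos.2 hp
  rw [div_lt_one hs] at h
  have := mul_self_lt_mul_self (by positivity) h
  rw [Real.mul_self_sqrt hp.le] at this
  rw [Complex.normSq_eq_norm_sq]; nlinarith

lemma herm_ne_zero_aux {z w g : Sphere} (h1 : sphDist z g < 1) (h2 : sphDist w g < 1) :
    herm (lf z) (lf w) ≠ 0 := by
  intro h
  have i1 := herm_wedge (lf z) (lf g)
  have i2 := herm_wedge (lf w) (lf g)
  have i3 := herm_id (lf z) (lf w) (lf g)
  have j1 := sph_lt_one h1
  have j2 := sph_lt_one h2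
  rw [h, zero_mul] at i3
  have i4 : Complex.normSq (herm (lf g) (lf w)) = Complex.normSq (herm (lf w) (lf g)) := by
    rw [← Complex.normSq_conj]
    congr 1
    simp [herm]; ring
  have i5 : Complex.normSq (herm (lf z) (lf g)) * Complex.normSq (herm (lf w) (lf g)) =
      Complex.normSq (wedge (lf z) (lf g)) * Complex.normSq (wedge (lf w) (lf g)) := by
    rw [← i4, ← Complex.normSq_mul, ← Complex.normSq_conj (wedge (lf w) (lf g)),
      ← Complex.normSq_mul, eq_neg_of_add_eq_zero_left i3.symm, Complex.normSq_neg]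
  set A := Complex.normSq (herm (lf z) (lf g))
  set B := Complex.normSq (herm (lf w) (lf g))
  set a := Complex.normSq (wedge (lf z) (lf g))
  set b := Complex.normSq (wedge (lf w) (lf g))
  have ha : 0 ≤ a := Complex.normSq_nonneg _
  have hb : 0 ≤ b := Complex.normSq_nonneg _
  have k1 : 3 * a < A := by linarith
  have k2 : 3 * b < B := by linarith
  have := mul_lt_mul'' k1 k2 (by positivity) (by positivity)
  nlinarith [mul_nonneg ha hb]

lemma herm_ne_zero {u v : ℂ × ℂ} (hu : u ≠ 0) (hv : v ≠ 0) {g : Sphere} (h1 : sphDist (pr u) g < 1)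
    (h2 : sphDist (pr v) g < 1) : herm u v ≠ 0 := by
  obtain ⟨c, hc, e⟩ := exists_smul_lf hu
  obtain ⟨c', hc', e'⟩ := exists_smul_lf hv
  have := herm_ne_zero_aux h1 h2
  rw [e, e']
  have : herm (c • lf (pr u)) (c' • lf (pr v)) =
      c * (starRingEnd ℂ) c' * herm (lf (pr u)) (lf (pr v)) := by
    simp [herm]; ring
  rw [this]
  refine mul_ne_zero (mul_ne_zero hc ?_) (herm_ne_zero_aux h1 h2)
  simpa using hc'

section iter
variable {P Q : ℂ[X]} (hc : IsCoprime P Q) (hd : 1 ≤ max P.natDegree Q.natDegree)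
include hc hd

lemma FlI_ne_zero (n : ℕ) {u : ℂ × ℂ} (hu : u ≠ 0) : (Fl P Q)^[n] u ≠ 0 := by
  induction n with
  | zero => simpa
  | succ n ih => rw [Function.iterate_succ_apply']; exact Fl_ne_zero hc hd ih

lemma pr_FlI (n : ℕ) {u : ℂ × ℂ} (hu : u ≠ 0) :
    pr ((Fl P Q)^[n] u) = (ratEval P Q)^[n] (pr u) := by
  induction n with
  | zero => simp
  | succ n ih =>
    rw [Function.iterate_succ_apply', Function.iterate_succ_apply',
      pr_Fl hc hd (FlI_ne_zero hc hd n hu), ih]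

omit hc hd in
lemma FlI_smul (n : ℕ) (c : ℂ) (u : ℂ × ℂ) :
    (Fl P Q)^[n] (c • u) = c ^ ((max P.natDegree Q.natDegree) ^ n) • (Fl P Q)^[n] u := by
  induction n with
  | zero => simp
  | succ n ih =>
    rw [Function.iterate_succ_apply', ih, Fl_smul, Function.iterate_succ_apply', ← pow_mul, pow_succ]

lemma no_close_iterates (hd2 : 2 ≤ max P.natDegree Q.natDegree) {n n' : ℕ} (hnn : n < n')
    (h : ∀ z : Sphere, ∃ g, sphDist ((ratEval P Q)^[n] z) g < 1 ∧
      sphDist ((ratEval P Q)^[n'] z) g < 1) : False := by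
  set d := max P.natDegree Q.natDegree
  let V : ℂ → ℂ × ℂ := fun z => (z, ((max 0 (1 - ‖z‖) : ℝ) : ℂ))
  have hV : Continuous V := by fun_prop
  have hV0 : ∀ z, V z ≠ 0 := by
    intro z hz
    have h1 : z = 0 := congrArg Prod.fst hz
    have h2 := congrArg Prod.snd hz
    simp [V, h1] at h2
  have hFc : ∀ n, Continuous ((Fl P Q)^[n]) := fun n => (Fl_continuous P Q).iterate n
  let H : ℂ → ℂ := fun z => herm ((Fl P Q)^[n] (V z)) ((Fl P Q)^[n'] (V z))
  have hH : Continuous H := by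
    have h1 := (hFc n).comp hV
    have h2 := (hFc n').comp hV
    have h3 : Continuous fun x : (ℂ × ℂ) × (ℂ × ℂ) => herm x.1 x.2 := by
      unfold herm
      have := Complex.continuous_conj
      fun_prop
    exact h3.comp (h1.prodMk h2)
  have hH0 : ∀ z, H z ≠ 0 := by
    intro z
    obtain ⟨g, g1, g2⟩ := h (pr (V z))
    refine herm_ne_zero (FlI_ne_zero hc hd n (hV0 z)) (FlI_ne_zero hc hd n' (hV0 z)) (g := g) ?_ ?_
    · rwa [pr_FlI hc hd n (hV0 z)]
    · rwa [pr_FlI hc hd n' (hV0 z)]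
  have := winding hH hH0 ((d : ℤ) ^ n - (d : ℤ) ^ n') ?_
  · have : d ^ n = d ^ n' := by
      have : (d : ℤ) ^ n = (d : ℤ) ^ n' := by linarith
      exact_mod_cast this
    exact absurd this (Nat.pow_lt_pow_right (by omega) hnn).ne
  · intro t
    have e1 : V (Complex.exp (t * Complex.I)) = Complex.exp (t * Complex.I) • V 1 := by
      simp [V, Complex.norm_exp_ofReal_mul_I]
    have e2 : Complex.exp ((((d : ℤ) ^ n - (d : ℤ) ^ n' : ℤ) : ℂ) * t * Complex.I) =
        Complex.exp (t * Complex.I) ^ (d ^ n) *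
          (starRingEnd ℂ) (Complex.exp (t * Complex.I) ^ (d ^ n')) := by
      rw [← Complex.exp_nat_mul, ← Complex.exp_nat_mul, ← Complex.exp_conj, ← Complex.exp_add]
      congr 1
      simp
      ring
    simp only [H, e1, FlI_smul, e2]
    simp [herm]
    ring
end iter

lemma juliaSet_eq : juliaSet p q = closure {x : SymX N | x.2 ∈ juliaW p q x.1} := by
  unfold juliaSet
  congr 1
  ext ⟨w, z⟩
  simp

lemma isClosed_juliaSet : IsClosed (juliaSet p q) := isClosed_closure

lemma itComp_const (v : Fin N) (n : ℕ) :
    itComp p q (fun _ => v) n = (ratEval (p v) (q v))^[n] := by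
  induction n with
  | zero => rfl
  | succ n ih => rw [itComp, ih, Function.iterate_succ']

lemma itComp_cons (v : Fin N) (w : ℕ → Fin N) (n : ℕ) :
    itComp p q (consW v w) (n + 1) = itComp p q w n ∘ ratEval (p v) (q v) := by
  induction n with
  | zero => rfl
  | succ n ih => rw [itComp, ih, itComp]; rfl

variable {p q}

lemma fatou_forward (hg : Good p q) {v : Fin N} {w : ℕ → Fin N} {z : Sphere}
    (hz : z ∈ fatouW p q (consW v w)) : ratEval (p v) (q v) z ∈ fatouW p q w := by
  obtain ⟨U, hU, hzU, hN⟩ := hz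
  obtain ⟨K, hK, hzK, hKU⟩ := exists_compact_subset hU hzU
  refine ⟨ratEval (p v) (q v) '' interior K,
    ratEval_isOpenMap (hg.2.1 v) (hg.2.2.1 v) _ isOpen_interior, ⟨z, hzK, rfl⟩, ?_⟩
  intro s hs
  choose k hk1 hk using hs
  obtain ⟨φ, hφ, g, hφg⟩ := hN (fun n => itComp p q (consW v w) (k n + 1))
    (fun n => ⟨k n + 1, by omega, rfl⟩)
  refine ⟨φ, hφ, fun y => if h : ∃ x ∈ interior K, ratEval (p v) (q v) x = y then g h.choose else y, ?_⟩
  intro K0 hK0 _ ε hε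
  filter_upwards [hφg K hKU hK ε hε] with n hn y hy
  have h := hK0 hy
  change ∃ x ∈ interior K, ratEval (p v) (q v) x = y at h
  rw [dif_pos h]
  have := hn h.choose (interior_subset h.choose_spec.1)
  rw [itComp_cons, Function.comp_apply, h.choose_spec.2] at this
  rwa [hk]

lemma continuous_consW (v : Fin N) : Continuous (consW v : (ℕ → Fin N) → _) := by
  refine continuous_pi fun n => ?_
  unfold consW
  split_ifs
  · exact continuous_const
  · exact continuous_apply _

lemma julia_back (hg : Good p q) {v : Fin N} {w : ℕ → Fin N} {z : Sphere}
    (hz : (w, ratEval (p v) (q v) z) ∈ juliaSet p q) : (consW v w, z) ∈ juliaSet p q := by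
  rw [juliaSet_eq] at *
  rw [mem_closure_iff_nhds] at *
  intro t ht
  rw [nhds_prod_eq, mem_prod_iff] at ht
  obtain ⟨A, hA, B, hB, hAB⟩ := ht
  obtain ⟨B', hB', hBo, hzB'⟩ := mem_nhds_iff.1 hB
  have h1 : consW v ⁻¹' A ∈ 𝓝 w := (continuous_consW v).continuousAt.preimage_mem_nhds hA
  have h2 := fiber_open (hg.2.1 v) (hg.2.2.1 v) hBo hzB'
  obtain ⟨⟨w', z'⟩, ⟨hw', y, hy, hyz⟩, hJ⟩ := hz _ (prod_mem_nhds h1 h2)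
  refine ⟨(consW v w', y), hAB ⟨hw', hB' hy⟩, ?_⟩
  simp only [Set.mem_ofPred_eq] at hJ ⊢
  intro hF
  apply hJ
  have := fatou_forward hg hF
  rwa [hyz] at this

lemma julia_nonempty (hg : Good p q) : (juliaSet p q).Nonempty := by
  obtain ⟨v, hv⟩ := hg.2.2.2
  have hc := hg.2.1 v
  have hd := hg.2.2.1 v
  by_contra hne
  have hF : ∀ z, z ∈ fatouW p q (fun _ => v) := by
    intro z
    by_contra hz
    refine hne ⟨(fun _ => v, z), ?_⟩
    rw [juliaSet_eq]
    exact subset_closure hz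
  have hloc : ∀ z : Sphere, ∃ U K : Set Sphere, K ∈ 𝓝 z ∧ IsCompact K ∧ K ⊆ U ∧
      NormalOn {g | ∃ n, 1 ≤ n ∧ g = itComp p q (fun _ => v) n} U := by
    intro z
    obtain ⟨U, hU, hzU, hN⟩ := hF z
    obtain ⟨K, hK, hzK, hKU⟩ := exists_compact_subset hU hzU
    exact ⟨U, K, mem_interior_iff_mem_nhds.1 hzK, hK, hKU, hN⟩
  choose U K hKn hKc hKU hN using hloc
  obtain ⟨S, hS⟩ := CompactSpace.elim_nhds_subcover K hKn
  have hext : ∀ S : Finset Sphere, ∃ φ : ℕ → ℕ, StrictMono φ ∧ ∀ i ∈ S, ∃ g : Sphere → Sphere,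
      ∀ᶠ n in atTop, ∀ z ∈ K i, sphDist (itComp p q (fun _ => v) (φ n + 1) z) (g z) < 1 := by
    intro S
    induction S using Finset.induction with
    | empty => exact ⟨id, strictMono_id, by simp⟩
    | insert a S ha ih =>
      obtain ⟨φ, hφ, h⟩ := ih
      obtain ⟨ψ, hψ, g, hg'⟩ := hN a (fun n => itComp p q (fun _ => v) (φ n + 1))
        (fun n => ⟨φ n + 1, by omega, rfl⟩)
      refine ⟨φ ∘ ψ, hφ.comp hψ, ?_⟩
      intro i hi
      rcases Finset.mem_insert.1 hi with rfl | hi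
      · exact ⟨g, hg' _ (hKU _) (hKc _) 1 one_pos⟩
      · obtain ⟨g, hg⟩ := h i hi
        exact ⟨g, hψ.tendsto_atTop.eventually hg⟩
  obtain ⟨φ, hφ, h⟩ := hext S
  choose! g hgS using h
  obtain ⟨n, hn⟩ := eventually_atTop.1 ((Filter.eventually_all_finset S).2 hgS)
  refine no_close_iterates hc hd hv (n := φ n + 1) (n' := φ (n + 1) + 1)
    (by have := hφ (Nat.lt_add_one n); omega) ?_
  intro z
  have : z ∈ ⋃ x ∈ S, K x := by rw [hS]; trivial
  simp only [Set.mem_iUnion] at this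
  obtain ⟨i, hi, hzi⟩ := this
  refine ⟨g i z, ?_, ?_⟩
  · simpa [itComp_const] using hn n le_rfl i hi z hzi
  · simpa [itComp_const] using hn (n + 1) (Nat.le_succ n) i hi z hzi

end

section
/-! ### The transfer operator on the sphere and atoms -/

lemma push_mono {P Q : ℂ[X]} (hc : IsCoprime P Q) (hd : 1 ≤ max P.natDegree Q.natDegree)
    {f g : Sphere → ℝ} {b : Sphere} (h : ∀ z, ratEval P Q z = b → f z ≤ g z) :
    push P Q f b ≤ push P Q g b :=
  Multiset.sum_map_le_sum_map _ _ fun z hz => h z ((mem_fiber_iff hc hd b z).1 hz)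

lemma push_const {P Q : ℂ[X]} (hc : IsCoprime P Q) (hd : 1 ≤ max P.natDegree Q.natDegree)
    (c : ℝ) (b : Sphere) : push P Q (fun _ => c) b = (max P.natDegree Q.natDegree : ℕ) * c := by
  simp [push, card_fiber hc hd]

/-- Transfer operator on the sphere (unnormalised). -/
def Sop : (Sphere → ℝ) →ₗ[ℝ] (Sphere → ℝ) where
  toFun f := fun b => ∑ v : Fin N, push (p v) (q v) f b
  map_add' f g := by
    funext b
    simp [push, Finset.sum_add_distrib]
  map_smul' c f := by
    funext b
    simp [push, Finset.mul_sum, Multiset.sum_map_mul_left]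

lemma Sop_apply (f : Sphere → ℝ) (b : Sphere) :
    Sop p q f b = ∑ v : Fin N, push (p v) (q v) f b := rfl

def BackInv (A : Set Sphere) : Prop := ∀ v z, ratEval (p v) (q v) z ∈ A → z ∈ A

variable {p q}

lemma Sop_mono (hg : Good p q) {A : Set Sphere} (hA : BackInv p q A) {f g : Sphere → ℝ}
    (h : ∀ z ∈ A, f z ≤ g z) : ∀ b ∈ A, Sop p q f b ≤ Sop p q g b := by
  intro b hb
  rw [Sop_apply, Sop_apply]
  refine Finset.sum_le_sum fun v _ => push_mono (hg.2.1 v) (hg.2.2.1 v) fun z hz => h z ?_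
  exact hA v z (hz ▸ hb)

lemma Sop_pow_mono (hg : Good p q) {A : Set Sphere} (hA : BackInv p q A) {f g : Sphere → ℝ}
    (h : ∀ z ∈ A, f z ≤ g z) (k : ℕ) : ∀ b ∈ A, (Sop p q ^ k) f b ≤ (Sop p q ^ k) g b := by
  induction k with
  | zero => simpa using h
  | succ k ih =>
    intro b hb
    rw [pow_succ', Module.End.mul_apply, Module.End.mul_apply]
    exact Sop_mono hg hA ih b hb

lemma Sop_const (hg : Good p q) (c : ℝ) :
    Sop p q (fun _ => c) = fun _ => (Dtot p q : ℝ) * c := by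
  funext b
  rw [Sop_apply]
  simp only [push_const (hg.2.1 _) (hg.2.2.1 _)]
  rw [← Finset.sum_mul]
  simp [Dtot, degR]

lemma Sop_pow_const (hg : Good p q) (c : ℝ) (k : ℕ) :
    (Sop p q ^ k) (fun _ => c) = fun _ => (Dtot p q : ℝ) ^ k * c := by
  induction k with
  | zero => simp
  | succ k ih =>
    rw [pow_succ', Module.End.mul_apply, ih, Sop_const hg, pow_succ']
    funext _; ring

lemma Sop_continuous (hg : Good p q) {f : Sphere → ℝ} (hf : Continuous f) :
    Continuous (Sop p q f) := by
  change Continuous fun b => ∑ v : Fin N, push (p v) (q v) f b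
  exact continuous_finsetSum _ fun v _ => push_continuous (hg.2.1 v) (hg.2.2.1 v) hf

lemma Sop_pow_continuous (hg : Good p q) {f : Sphere → ℝ} (hf : Continuous f) (k : ℕ) :
    Continuous ((Sop p q ^ k) f) := by
  induction k with
  | zero => simpa
  | succ k ih => rw [pow_succ', Module.End.mul_apply]; exact Sop_continuous hg ih

lemma backInv_univ : BackInv p q Set.univ := fun _ _ _ => trivial

variable (p q) in
def JS : Set Sphere := Prod.snd '' juliaSet p q

lemma JS_compact : IsCompact (JS p q) :=
  (isClosed_juliaSet p q).isCompact.image continuous_snd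

lemma backInv_JS (hg : Good p q) : BackInv p q (JS p q) := by
  rintro v z ⟨⟨w, z'⟩, hw, rfl⟩
  exact ⟨(consW v w, z), julia_back hg hw, rfl⟩

def ind (y : Sphere) : Sphere → ℝ := fun z => if z = y then 1 else 0

def mlt (P Q : ℂ[X]) (y : Sphere) : ℕ := (fiber P Q (ratEval P Q y)).count y

lemma push_ind {P Q : ℂ[X]} (hc : IsCoprime P Q) (hd : 1 ≤ max P.natDegree Q.natDegree)
    (y : Sphere) : push P Q (ind y) = fun b => (mlt P Q y : ℝ) * ind (ratEval P Q y) b := by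
  funext b
  have h1 : push P Q (ind y) b = ((fiber P Q b).count y : ℝ) := by
    unfold push ind
    generalize fiber P Q b = m
    induction m using Multiset.induction with
    | empty => simp
    | cons a m ih =>
      rw [Multiset.map_cons, Multiset.sum_cons, ih, Multiset.count_cons]
      by_cases h : a = y
      · simp [h, add_comm]
      · simp [h, Ne.symm h]
  rw [h1]
  by_cases h : b = ratEval P Q y
  · subst h; simp [ind, mlt]
  · have : y ∉ fiber P Q b := fun hy => h ((mem_fiber_iff hc hd b y).1 hy).symm
    simp [ind, h, Multiset.count_eq_zero_of_notMem this]

lemma mlt_le {P Q : ℂ[X]} (hc : IsCoprime P Q) (hd : 1 ≤ max P.natDegree Q.natDegree)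
    (y : Sphere) : mlt P Q y ≤ max P.natDegree Q.natDegree := by
  rw [← card_fiber hc hd (ratEval P Q y)]; exact Multiset.count_le_card _ _

lemma Sop_ind (hg : Good p q) (y : Sphere) : Sop p q (ind y) =
    ∑ v : Fin N, (mlt (p v) (q v) y : ℝ) • ind (ratEval (p v) (q v) y) := by
  funext b
  rw [Sop_apply]
  simp [push_ind (hg.2.1 _) (hg.2.2.1 _)]

lemma atom_succ (hg : Good p q) (k : ℕ) (y b : Sphere) : (Sop p q ^ (k + 1)) (ind y) b =
    ∑ v : Fin N, (mlt (p v) (q v) y : ℝ) * (Sop p q ^ k) (ind (ratEval (p v) (q v) y)) b := by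
  rw [pow_succ, Module.End.mul_apply, Sop_ind hg]
  simp

lemma atom_nonneg (hg : Good p q) (k : ℕ) (y b : Sphere) : 0 ≤ (Sop p q ^ k) (ind y) b := by
  have := Sop_pow_mono hg backInv_univ (f := fun _ => 0) (g := ind y)
    (fun z _ => by unfold ind; split_ifs <;> norm_num) k b trivial
  rw [Sop_pow_const hg] at this
  simpa using this

lemma atom_zero (hg : Good p q) (k : ℕ) {y b : Sphere} (hb : b ∈ JS p q) (hy : y ∉ JS p q) :
    (Sop p q ^ k) (ind y) b = 0 := by
  refine le_antisymm ?_ (atom_nonneg hg k y b)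
  have := Sop_pow_mono hg (backInv_JS hg) (f := ind y) (g := fun _ => 0)
    (fun z hz => by
      have : z ≠ y := fun h => hy (h ▸ hz)
      simp [ind, this]) k b hb
  rw [Sop_pow_const hg] at this
  simpa using this

/-- good points: not in `J` or not critical for `v`. -/
def GoodPt (p q : Fin N → ℂ[X]) (v : Fin N) (y : Sphere) : Prop := y ∉ JS p q ∨ mlt (p v) (q v) y ≤ 1

lemma Dtot_pos (hg : Good p q) : 1 ≤ Dtot p q := by
  obtain ⟨v, hv⟩ := hg.2.2.2
  calc 1 ≤ degR p q v := by omega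
    _ ≤ _ := Finset.single_le_sum (f := degR p q) (fun _ _ => Nat.zero_le _) (Finset.mem_univ v)

lemma N_lt_Dtot (hg : Good p q) : N + 1 ≤ Dtot p q := by
  obtain ⟨v, hv⟩ := hg.2.2.2
  have : ∑ _i : Fin N, 1 < ∑ i, degR p q i :=
    Finset.sum_lt_sum (fun i _ => hg.2.2.1 i) ⟨v, Finset.mem_univ v, by omega⟩
  simpa [Dtot] using this

lemma weighted_bound (hg : Good p q) {v : Fin N} (m : Fin N → ℝ) (x : Fin N → ℝ) {X δ : ℝ}
    (hm0 : ∀ i, 0 ≤ m i) (hm : ∀ i, m i ≤ degR p q i) (hx : ∀ i, x i ≤ X) (hX : 0 ≤ X)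
    (hv : m v * x v ≤ degR p q v * X - δ) : ∑ i, m i * x i ≤ Dtot p q * X - δ := by
  have h1 : ∀ i ∈ Finset.univ.erase v, m i * x i ≤ degR p q i * X := fun i _ =>
    (mul_le_mul_of_nonneg_left (hx i) (hm0 i)).trans (mul_le_mul_of_nonneg_right (hm i) hX)
  have h2 := Finset.sum_le_sum h1
  rw [← Finset.add_sum_erase _ _ (Finset.mem_univ v)]
  have h3 : (Dtot p q : ℝ) * X = degR p q v * X + ∑ i ∈ Finset.univ.erase v, degR p q i * X := by
    rw [Finset.add_sum_erase _ (fun i => (degR p q i : ℝ) * X) (Finset.mem_univ v), ← Finset.sum_mul]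
    simp [Dtot]
  linarith

lemma atom_bound (hg : Good p q) {k : ℕ} {b : Sphere} {β : ℝ} (hb : b ∈ JS p q) (hβ : 0 ≤ β)
    (h : ∀ y, (Sop p q ^ k) (ind y) b ≤ β) (j : ℕ) (y : Sphere) :
    (Sop p q ^ (k + j)) (ind y) b ≤ (Dtot p q : ℝ) ^ j * β := by
  induction j generalizing y with
  | zero => simpa using h y
  | succ j ih =>
    rw [← add_assoc, atom_succ hg]
    obtain ⟨v, hv⟩ := hg.2.2.2
    have := weighted_bound hg (v := v) (fun i => (mlt (p i) (q i) y : ℝ))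
      (fun i => (Sop p q ^ (k + j)) (ind (ratEval (p i) (q i) y)) b)
      (X := (Dtot p q : ℝ) ^ j * β) (δ := 0) (fun i => by positivity)
      (fun i => by exact_mod_cast mlt_le (hg.2.1 i) (hg.2.2.1 i) y) (fun i => ih _) (by positivity)
      (by
        rw [sub_zero]
        exact (mul_le_mul_of_nonneg_left (ih _) (by positivity)).trans
          (mul_le_mul_of_nonneg_right (by exact_mod_cast mlt_le (hg.2.1 v) (hg.2.2.1 v) y)
            (by positivity)))
    calc _ ≤ _ := this
      _ = _ := by rw [pow_succ]; ring

lemma atom_loss (hg : Good p q) {v : Fin N} (hv : 2 ≤ degR p q v) {k : ℕ} {b : Sphere} {β : ℝ}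
    (hb : b ∈ JS p q) (hβ : 0 ≤ β)
    (h : ∀ y, (Sop p q ^ k) (ind y) b ≤ β) (j : ℕ) (y : Sphere)
    (hy : ∃ i ≤ j, GoodPt p q v ((ratEval (p v) (q v))^[i] y)) :
    (Sop p q ^ (k + (j + 1))) (ind y) b ≤ ((Dtot p q : ℝ) ^ (j + 1) - 1) * β := by
  have hD : (1 : ℝ) ≤ Dtot p q := by exact_mod_cast Dtot_pos hg
  have first : ∀ y j, GoodPt p q v y →
      (Sop p q ^ (k + (j + 1))) (ind y) b ≤ ((Dtot p q : ℝ) ^ (j + 1) - 1) * β := by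
    intro y j hgd
    have hDj : (1 : ℝ) ≤ (Dtot p q : ℝ) ^ j := one_le_pow₀ hD
    rcases hgd with hJ | hm
    · rw [atom_zero hg _ hb hJ]
      have : (1 : ℝ) ≤ (Dtot p q : ℝ) ^ (j + 1) := one_le_pow₀ hD
      exact mul_nonneg (by linarith) hβ
    · rw [← add_assoc, atom_succ hg]
      have hX : 0 ≤ (Dtot p q : ℝ) ^ j * β := by positivity
      have := weighted_bound hg (v := v) (fun i => (mlt (p i) (q i) y : ℝ))
        (fun i => (Sop p q ^ (k + j)) (ind (ratEval (p i) (q i) y)) b)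
        (X := (Dtot p q : ℝ) ^ j * β) (δ := β) (fun i => by positivity)
        (fun i => by exact_mod_cast mlt_le (hg.2.1 i) (hg.2.2.1 i) y)
        (fun i => atom_bound hg hb hβ h j _) (by positivity)
        (by
          have h1 : (mlt (p v) (q v) y : ℝ) ≤ 1 := by exact_mod_cast hm
          have h2 : (2 : ℝ) ≤ degR p q v := by exact_mod_cast hv
          have h3 := mul_le_mul h1 (atom_bound hg hb hβ h j (ratEval (p v) (q v) y))
            (atom_nonneg hg _ _ _) zero_le_one
          have h4 : β ≤ (Dtot p q : ℝ) ^ j * β := le_mul_of_one_le_left hβ hDj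
          have h5 := mul_le_mul_of_nonneg_right h2 hX
          linarith)
      calc _ ≤ _ := this
        _ = _ := by rw [pow_succ]; ring
  induction j generalizing y with
  | zero =>
    obtain ⟨i, hi, hgd⟩ := hy
    obtain rfl : i = 0 := by omega
    exact first y 0 hgd
  | succ j ih =>
    obtain ⟨i, hi, hgd⟩ := hy
    rcases i with _ | i
    · exact first y (j + 1) hgd
    · have hstep := ih (ratEval (p v) (q v) y) ⟨i, by omega, by
        rwa [Function.iterate_succ_apply] at hgd⟩
      have hDj : (1 : ℝ) ≤ (Dtot p q : ℝ) ^ (j + 1) := one_le_pow₀ hD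
      have hX : 0 ≤ (Dtot p q : ℝ) ^ (j + 1) * β := by positivity
      rw [← add_assoc, atom_succ hg]
      have := weighted_bound hg (v := v) (fun i => (mlt (p i) (q i) y : ℝ))
        (fun i => (Sop p q ^ (k + (j + 1))) (ind (ratEval (p i) (q i) y)) b)
        (X := (Dtot p q : ℝ) ^ (j + 1) * β) (δ := β) (fun i => by positivity)
        (fun i => by exact_mod_cast mlt_le (hg.2.1 i) (hg.2.2.1 i) y)
        (fun i => atom_bound hg hb hβ h (j + 1) _) (by positivity)
        (by
          have h1 : (mlt (p v) (q v) y : ℝ) ≤ degR p q v := by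
            exact_mod_cast mlt_le (hg.2.1 v) (hg.2.2.1 v) y
          have h2 : (2 : ℝ) ≤ degR p q v := by exact_mod_cast hv
          have h3 := mul_le_mul h1 hstep (atom_nonneg hg _ _ _) (by positivity)
          have h5 := mul_le_mul_of_nonneg_right h2 hβ
          linarith)
      calc _ ≤ _ := this
        _ = _ := by rw [pow_succ _ (j + 1)]; ring

lemma consW_mem_iter (hg : Good p q) (v : Fin N) (w : ℕ → Fin N) (z : Sphere) (m : ℕ)
    (h : (w, (ratEval (p v) (q v))^[m] z) ∈ juliaSet p q) :
    ((consW v)^[m] w, z) ∈ juliaSet p q := by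
  induction m generalizing z with
  | zero => simpa using h
  | succ m ih =>
    rw [Function.iterate_succ_apply']
    refine julia_back hg ?_
    exact ih _ (by rwa [← Function.iterate_succ_apply])

lemma consW_iter_apply (v : Fin N) (w : ℕ → Fin N) (m i : ℕ) (hi : i < m) :
    (consW v)^[m] w i = v := by
  induction m generalizing i with
  | zero => omega
  | succ m ih =>
    rw [Function.iterate_succ_apply', consW]
    split_ifs with h
    · rfl
    · exact ih _ (by omega)

lemma const_mem_julia (hg : Good p q) (v : Fin N) (z : Sphere) {m : ℕ} (hm : 1 ≤ m)
    (hz : (ratEval (p v) (q v))^[m] z = z) (hJ : z ∈ JS p q) :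
    ((fun _ => v : ℕ → Fin N), z) ∈ juliaSet p q := by
  obtain ⟨⟨w, z'⟩, hw, rfl⟩ := hJ
  have hper : ∀ n, (ratEval (p v) (q v))^[m * n] z' = z' := by
    intro n
    rw [Function.iterate_mul]
    exact Function.iterate_fixed hz n
  have h1 : ∀ n, ((consW v)^[m * n] w, z') ∈ juliaSet p q := fun n =>
    consW_mem_iter hg v w z' _ (by rw [hper]; exact hw)
  refine (isClosed_juliaSet p q).mem_of_tendsto (f := fun n => ((consW v)^[m * n] w, z'))
    (b := atTop) ?_ (Eventually.of_forall h1)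
  refine Tendsto.prodMk_nhds ?_ tendsto_const_nhds
  rw [tendsto_pi_nhds]
  intro i
  refine tendsto_const_nhds.congr' ?_
  filter_upwards [eventually_gt_atTop i] with n hn
  rw [consW_iter_apply]
  nlinarith

lemma Tmap_const_iter (v : Fin N) (z : Sphere) (m : ℕ) :
    (Tmap p q)^[m] ((fun _ => v : ℕ → Fin N), z) = ((fun _ => v), (ratEval (p v) (q v))^[m] z) := by
  induction m with
  | zero => rfl
  | succ m ih => rw [Function.iterate_succ_apply', ih, Function.iterate_succ_apply']; rfl

lemma exists_goodPt (hg : Good p q) (hA : NoSuperAttract p q) (v : Fin N) :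
    ∃ M : ℕ, ∀ y, ∃ i ≤ M, GoodPt p q v ((ratEval (p v) (q v))^[i] y) := by
  have hfin := crit_finite (hg.2.1 v) (hg.2.2.1 v)
  refine ⟨hfin.toFinset.card, fun y => ?_⟩
  by_contra hcon
  push Not at hcon
  set M := hfin.toFinset.card
  have hcr : ∀ i ≤ M, (ratEval (p v) (q v))^[i] y ∈ JS p q ∧
      2 ≤ mlt (p v) (q v) ((ratEval (p v) (q v))^[i] y) := by
    intro i hi
    have := hcon i hi
    unfold GoodPt at this
    push Not at this
    exact ⟨this.1, this.2⟩
  obtain ⟨i, hi, j, hj, hij, heq⟩ := Finset.exists_ne_map_eq_of_card_lt_of_maps_to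
    (s := Finset.range (M + 1)) (t := hfin.toFinset) (by simp [M])
    (f := fun i => (ratEval (p v) (q v))^[i] y)
    (fun i hi => by
      have := (hcr i (by simpa [Nat.lt_succ_iff] using hi)).2
      simpa [mlt] using this)
  have key : ∀ i j, i ≤ M → i < j →
      (ratEval (p v) (q v))^[i] y = (ratEval (p v) (q v))^[j] y → False := by
    intro i j hi hij heq
    obtain ⟨m, rfl⟩ := Nat.exists_eq_add_of_lt hij
    obtain ⟨hJ, h2⟩ := hcr i hi
    set z := (ratEval (p v) (q v))^[i] y
    have hz : (ratEval (p v) (q v))^[m + 1] z = z := by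
      rw [← Function.iterate_add_apply]
      rw [heq]; congr 1; omega
    have hmem := const_mem_julia hg v z (by omega) hz hJ
    have := hA _ hmem (m + 1) (by omega) (by rw [Tmap_const_iter, hz]) 0 (by omega)
    apply this
    simpa [critSet, mlt] using h2
  simp only [Finset.mem_range] at hi hj
  rcases lt_or_gt_of_ne hij with h | h
  · exact key i j (by omega) h heq
  · exact key j i (by omega) h heq.symm

/-- Uniform decay of atoms. -/
lemma atom_decay (hg : Good p q) (hA : NoSuperAttract p q) {ε : ℝ} (hε : 0 < ε) :
    ∃ k : ℕ, ∀ b ∈ JS p q, ∀ y, (Sop p q ^ k) (ind y) b ≤ ε * (Dtot p q : ℝ) ^ k := by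
  obtain ⟨v, hv⟩ := hg.2.2.2
  obtain ⟨M, hM⟩ := exists_goodPt hg hA v
  have hD : (1 : ℝ) ≤ Dtot p q := by exact_mod_cast Dtot_pos hg
  have hDM : (1 : ℝ) ≤ (Dtot p q : ℝ) ^ (M + 1) := one_le_pow₀ hD
  set θ : ℝ := 1 - ((Dtot p q : ℝ) ^ (M + 1))⁻¹ with hθ
  have hinv : ((Dtot p q : ℝ) ^ (M + 1))⁻¹ ≤ 1 := inv_le_one_of_one_le₀ hDM
  have hθ0 : 0 ≤ θ := by linarith
  have hθ1 : θ < 1 := by have : 0 < ((Dtot p q : ℝ) ^ (M + 1))⁻¹ := by positivity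
                         linarith
  have main : ∀ i : ℕ, ∀ b ∈ JS p q, ∀ y, (Sop p q ^ (i * (M + 1))) (ind y) b ≤
      θ ^ i * (Dtot p q : ℝ) ^ (i * (M + 1)) := by
    intro i
    induction i with
    | zero =>
      intro b _ y
      simp only [zero_mul, pow_zero, Module.End.one_apply, one_mul]
      unfold ind; split_ifs <;> norm_num
    | succ i ih =>
      intro b hb y
      have := atom_loss hg hv hb (by positivity) (ih b hb) M y (hM y)
      rw [Nat.succ_mul]
      refine this.trans (le_of_eq ?_)
      have : (Dtot p q : ℝ) ^ (M + 1) - 1 = θ * (Dtot p q : ℝ) ^ (M + 1) := by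
        rw [hθ]; field_simp
      rw [this, pow_add, pow_succ θ]; ring
  obtain ⟨i, hi⟩ := exists_pow_lt_of_lt_one hε hθ1
  refine ⟨i * (M + 1), fun b hb y => (main i b hb y).trans ?_⟩
  gcongr

end

section
/-! ### The chordal metric and clusters -/

def kap (x y : Sphere) : ℝ := ‖wedge (nlf x) (nlf y)‖

abbrev US : Type := Metric.sphere (0 : ℂ × ℂ) 1

def prS (u : US) : Sphere := pr u.1

lemma US_ne_zero (u : US) : u.1 ≠ 0 := by
  intro h
  have := u.2
  simp [h] at this

lemma continuous_prS : Continuous prS := by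
  rw [continuous_iff_continuousAt]
  intro u
  exact (pr_continuousAt (US_ne_zero u)).comp continuousAt_subtype_val

lemma surjective_prS : Function.Surjective prS := fun z =>
  ⟨⟨nlf z, by simp [norm_nlf]⟩, pr_nlf z⟩

lemma isQuotientMap_prS : IsQuotientMap prS :=
  (continuous_prS.isClosedMap).isQuotientMap continuous_prS surjective_prS

lemma kap_pr {u v : ℂ × ℂ} (hu : u ≠ 0) (hv : v ≠ 0) :
    kap (pr u) (pr v) = ‖wedge u v‖ / (‖u‖ * ‖v‖) := by
  obtain ⟨c, hc, e⟩ := exists_smul_lf hu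
  obtain ⟨c', hc', e'⟩ := exists_smul_lf hv
  have h1 := norm_ne_zero_iff.2 (lf_ne_zero (pr u))
  have h2 := norm_ne_zero_iff.2 (lf_ne_zero (pr v))
  have h3 := norm_ne_zero_iff.2 hc
  have h4 := norm_ne_zero_iff.2 hc'
  conv_rhs => rw [e, e']
  simp only [kap, nlf, wedge_smul_left, wedge_smul_right, norm_mul, norm_smul, Complex.norm_real,
    norm_inv, norm_norm]
  field_simp

lemma kap_lf (x y : Sphere) : kap x y = ‖wedge (lf x) (lf y)‖ / (‖lf x‖ * ‖lf y‖) := by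
  rw [← kap_pr (lf_ne_zero x) (lf_ne_zero y), pr_lf, pr_lf]

lemma continuous_kap : Continuous fun x : Sphere × Sphere => kap x.1 x.2 := by
  have hq : IsQuotientMap (Prod.map prS prS) :=
    ((continuous_prS.prodMap continuous_prS).isClosedMap).isQuotientMap
      (continuous_prS.prodMap continuous_prS) (surjective_prS.prodMap surjective_prS)
  rw [hq.continuous_iff]
  have : ((fun x : Sphere × Sphere => kap x.1 x.2) ∘ Prod.map prS prS) =
      fun x : US × US => ‖wedge x.1.1 x.2.1‖ := by
    funext ⟨u, v⟩
    simp only [Function.comp, Prod.map, prS]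
    rw [kap_pr (US_ne_zero u) (US_ne_zero v)]
    have h1 : ‖u.1‖ = 1 := by simp
    have h2 : ‖v.1‖ = 1 := by simp
    rw [h1, h2]; simp
  rw [this]
  unfold wedge
  fun_prop

lemma continuous_kap_right (y : Sphere) : Continuous fun z => kap y z := by
  have h : Continuous fun z : Sphere => (y, z) := by fun_prop
  have := Continuous.comp (g := fun x : Sphere × Sphere => kap x.1 x.2) continuous_kap h
  simpa only [Function.comp_def] using this

lemma kap_nonneg (x y : Sphere) : 0 ≤ kap x y := norm_nonneg _

lemma kap_eq_zero {x y : Sphere} : kap x y = 0 ↔ x = y := by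
  rw [kap, norm_eq_zero, wedge_eq_zero_iff (nlf_ne_zero x) (nlf_ne_zero y), pr_nlf, pr_nlf]

lemma kap_self (x : Sphere) : kap x x = 0 := kap_eq_zero.2 rfl

lemma kap_comm (x y : Sphere) : kap x y = kap y x := by
  rw [kap, kap, ← norm_neg]; congr 1; unfold wedge; ring

lemma kap_le_two (x y : Sphere) : kap x y ≤ 2 := by
  have := norm_wedge_le (nlf x) (nlf y)
  rw [norm_nlf, norm_nlf] at this
  simpa [kap] using this

lemma kap_triangle (x y z : Sphere) : kap x z ≤ kap x y + kap y z := by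
  have e : wedge (nlf x) (nlf z) • nlf y =
      wedge (nlf y) (nlf z) • nlf x + wedge (nlf x) (nlf y) • nlf z := by
    refine Prod.ext ?_ ?_ <;> simp [wedge] <;> ring
  have h := norm_add_le (wedge (nlf y) (nlf z) • nlf x) (wedge (nlf x) (nlf y) • nlf z)
  rw [← e, norm_smul, norm_smul, norm_smul, norm_nlf, norm_nlf, norm_nlf] at h
  unfold kap; linarith

lemma continuous_ratEval {P Q : ℂ[X]} (hc : IsCoprime P Q)
    (hd : 1 ≤ max P.natDegree Q.natDegree) : Continuous (ratEval P Q) := by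
  rw [isQuotientMap_prS.continuous_iff, continuous_iff_continuousAt]
  intro u
  have : ratEval P Q ∘ prS = fun u : US => pr (Fl P Q u.1) := by
    funext u
    simp only [Function.comp, prS]
    rw [pr_Fl hc hd (US_ne_zero u)]
  rw [this]
  exact ContinuousAt.comp (g := pr) (f := fun u : US => Fl P Q u.1)
    (pr_continuousAt (Fl_ne_zero hc hd (US_ne_zero u)))
    ((Fl_continuous P Q).comp continuous_subtype_val).continuousAt

variable {p q}

lemma Sop_pow_tendsto {f : ℕ → Sphere → ℝ} {g : Sphere → ℝ}
    (h : ∀ z, Tendsto (fun n => f n z) atTop (𝓝 (g z))) (k : ℕ) (b : Sphere) :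
    Tendsto (fun n => (Sop p q ^ k) (f n) b) atTop (𝓝 ((Sop p q ^ k) g b)) := by
  induction k generalizing b with
  | zero => simpa using h b
  | succ k ih =>
    simp only [pow_succ', Module.End.mul_apply, Sop_apply, push]
    exact tendsto_finsetSum _ fun v _ => tendsto_multiset_sum _ fun z _ => ih z

lemma cluster (hg : Good p q) (hA : NoSuperAttract p q) {ε : ℝ} (hε : 0 < ε) :
    ∃ k : ℕ, ∃ δ : ℝ, 0 < δ ∧ ∀ b ∈ JS p q, ∀ y,
      (Sop p q ^ k) (fun ζ => if kap y ζ < δ then 1 else 0) b ≤ ε * (Dtot p q : ℝ) ^ k := by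
  obtain ⟨k, hk⟩ := atom_decay hg hA (half_pos hε)
  have hD : (0 : ℝ) < (Dtot p q : ℝ) ^ k := by
    have : (0 : ℝ) < Dtot p q := by exact_mod_cast Dtot_pos hg
    positivity
  refine ⟨k, ?_⟩
  have hcomp : IsCompact (JS p q ×ˢ (Set.univ : Set Sphere)) := JS_compact.prod isCompact_univ
  have main : ∃ δ : ℝ, 0 < δ ∧ ∀ x ∈ JS p q ×ˢ (Set.univ : Set Sphere),
      (Sop p q ^ k) (fun ζ => if kap x.2 ζ < δ then 1 else 0) x.1 ≤ ε * (Dtot p q : ℝ) ^ k := by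
    refine hcomp.induction_on (p := fun s => ∃ δ : ℝ, 0 < δ ∧ ∀ x ∈ s,
      (Sop p q ^ k) (fun ζ => if kap x.2 ζ < δ then 1 else 0) x.1 ≤ ε * (Dtot p q : ℝ) ^ k)
      ⟨1, one_pos, by simp⟩ ?_ ?_ ?_
    · rintro s t hst ⟨δ, hδ, h⟩
      exact ⟨δ, hδ, fun x hx => h x (hst hx)⟩
    · rintro s t ⟨δ, hδ, h⟩ ⟨δ', hδ', h'⟩
      have mono : ∀ {a c : ℝ} (x : Sphere × Sphere), a ≤ c →
          (Sop p q ^ k) (fun ζ => if kap x.2 ζ < a then 1 else 0) x.1 ≤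
          (Sop p q ^ k) (fun ζ => if kap x.2 ζ < c then 1 else 0) x.1 := by
        intro a c x hac
        refine Sop_pow_mono hg backInv_univ (fun z _ => ?_) k _ trivial
        split_ifs <;> first | linarith | norm_num
      refine ⟨min δ δ', lt_min hδ hδ', ?_⟩
      rintro x (hx | hx)
      · exact (mono x (min_le_left _ _)).trans (h x hx)
      · exact (mono x (min_le_right _ _)).trans (h' x hx)
    · rintro ⟨b0, y0⟩ ⟨hb0, -⟩
      let β : ℕ → Sphere → ℝ := fun n ζ => max 0 (min 1 (2 - n * kap y0 ζ))
      have hβc : ∀ n, Continuous (β n) := by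
        intro n
        have := continuous_kap_right y0
        fun_prop
      have hβl : ∀ z, Tendsto (fun n => β n z) atTop (𝓝 (ind y0 z)) := by
        intro z
        refine tendsto_const_nhds.congr' ?_
        by_cases hz : z = y0
        · subst hz
          filter_upwards with n
          simp [β, ind, kap_self]
        · have hpos : 0 < kap y0 z := lt_of_le_of_ne (kap_nonneg _ _)
            (fun h => hz (kap_eq_zero.1 h.symm).symm)
          obtain ⟨n0, hn0⟩ := exists_nat_gt (2 / kap y0 z)
          filter_upwards [eventually_ge_atTop n0] with n hn
          have : (2 : ℝ) ≤ n * kap y0 z := by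
            rw [div_lt_iff₀ hpos] at hn0
            have : (n0 : ℝ) ≤ n := by exact_mod_cast hn
            nlinarith
          simp only [ind, hz, if_false, β]
          rw [max_eq_left]
          exact (min_le_right _ _).trans (by linarith)
      have h1 := Sop_pow_tendsto (p := p) (q := q) hβl k b0
      have h2 : (Sop p q ^ k) (ind y0) b0 < ε * (Dtot p q : ℝ) ^ k := by
        refine (hk b0 hb0 y0).trans_lt ?_
        nlinarith
      obtain ⟨n, hn, hn1⟩ := ((h1.eventually (gt_mem_nhds h2)).and (eventually_ge_atTop 1)).exists
      have hn0 : (0 : ℝ) < n := by exact_mod_cast hn1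
      have hV := (Sop_pow_continuous hg (hβc n) k).continuousAt.eventually (gt_mem_nhds hn)
      have hY : ∀ᶠ y in 𝓝 y0, kap y0 y < 1 / (2 * n) := by
        have hc := continuous_kap_right y0
        have := hc.continuousAt (x := y0)
        exact this.eventually (gt_mem_nhds (by simp only [kap_self]; positivity))
      refine ⟨{x | (Sop p q ^ k) (β n) x.1 < ε * (Dtot p q : ℝ) ^ k ∧ kap y0 x.2 < 1 / (2 * n)},
        mem_nhdsWithin_of_mem_nhds ?_, 1 / (2 * n), by positivity, ?_⟩
      · rw [nhds_prod_eq]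
        exact hV.prod_mk hY
      · rintro ⟨b, y⟩ ⟨hb, hy⟩
        refine le_trans ?_ hb.le
        refine Sop_pow_mono hg backInv_univ (fun z _ => ?_) k _ trivial
        split_ifs with hz
        · have : kap y0 z ≤ 1 / n := by
            have := kap_triangle y0 y z
            have e : 1 / (2 * (n : ℝ)) + 1 / (2 * n) = 1 / n := by field_simp; norm_num
            simp only at hy hz
            linarith
          have : n * kap y0 z ≤ 1 := by
            rw [le_div_iff₀ hn0] at this; linarith
          exact le_max_of_le_right (le_min le_rfl (by linarith))
        · exact le_max_left _ _
  obtain ⟨δ, hδ, h⟩ := main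
  exact ⟨δ, hδ, fun b hb y => h (b, y) ⟨hb, trivial⟩⟩

end

section
/-! ### The potential kernel -/

def ee (x y : Sphere) : ℝ := Real.log 2 - Real.log (kap x y)

lemma ee_nonneg (x y : Sphere) : 0 ≤ ee x y := by
  unfold ee
  by_cases h : kap x y = 0
  · simp [h, Real.log_nonneg]
  · have : 0 < kap x y := lt_of_le_of_ne (kap_nonneg _ _) (Ne.symm h)
    have := Real.log_le_log this (kap_le_two x y)
    linarith

lemma log_multiset_prod {α : Type*} (m : Multiset α) (f : α → ℂ) (h : ∀ a ∈ m, f a ≠ 0) :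
    Real.log ‖(m.map f).prod‖ = (m.map fun a => Real.log ‖f a‖).sum := by
  induction m using Multiset.induction with
  | empty => simp
  | cons a m ih =>
    have h1 : ‖f a‖ ≠ 0 := norm_ne_zero_iff.2 (h a (Multiset.mem_cons_self a m))
    have h2 : ‖(m.map f).prod‖ ≠ 0 := by
      refine norm_ne_zero_iff.2 (Multiset.prod_ne_zero fun h0 => ?_)
      obtain ⟨b, hb, hb0⟩ := Multiset.mem_map.1 h0
      exact h b (Multiset.mem_cons_of_mem hb) hb0
    rw [Multiset.map_cons, Multiset.prod_cons, norm_mul, Real.log_mul h1 h2, Multiset.map_cons,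
      Multiset.sum_cons, ih fun b hb => h b (Multiset.mem_cons_of_mem hb)]

lemma sum_map_neg_aux {α : Type*} (m : Multiset α) (f : α → ℝ) :
    (m.map fun a => -f a).sum = -(m.map f).sum := by
  induction m using Multiset.induction with
  | empty => simp
  | cons a m ih => simp [ih]; ring

lemma two_values {P Q : ℂ[X]} (hc : IsCoprime P Q) (hd : 1 ≤ max P.natDegree Q.natDegree) :
    ∃ x0 x1, ratEval P Q x0 ≠ ratEval P Q x1 := by
  have : ∀ b : Sphere, ∃ x, ratEval P Q x = b := by
    intro b
    have : 0 < (fiber P Q b).card := by rw [card_fiber hc hd]; omega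
    obtain ⟨x, hx⟩ := Multiset.card_pos_iff_exists_mem.1 this
    exact ⟨x, (mem_fiber_iff hc hd b x).1 hx⟩
  obtain ⟨x0, h0⟩ := this OnePoint.infty
  obtain ⟨x1, h1⟩ := this ((0 : ℂ) : Sphere)
  exact ⟨x0, x1, by rw [h0, h1]; exact OnePoint.infty_ne_coe 0⟩

lemma one_step {P Q : ℂ[X]} (hc : IsCoprime P Q) (hd : 1 ≤ max P.natDegree Q.natDegree) :
    ∃ C : ℝ, ∃ γ τ : Sphere → ℝ, 0 ≤ C ∧ (∀ b, -C ≤ γ b) ∧ (∀ x, -C ≤ τ x) ∧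
      ∀ x b, ratEval P Q x ≠ b → push P Q (ee x) b = ee (ratEval P Q x) b + γ b + τ x := by
  choose c hc0 hcF using wedge_Fl hc hd
  set d := max P.natDegree Q.natDegree
  let τ : Sphere → ℝ := fun x => - Real.log ‖Fl P Q (nlf x)‖
  let γ : Sphere → ℝ := fun b => (d : ℝ) * Real.log 2 - Real.log 2 - Real.log ‖lf b‖ + Real.log ‖c b‖ +
    ((fiber P Q b).map fun ζ => Real.log ‖lf ζ‖).sum
  have hid : ∀ x b, ratEval P Q x ≠ b →
      push P Q (ee x) b = ee (ratEval P Q x) b + γ b + τ x := by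
    intro x b hxb
    have hmem : ∀ ζ ∈ fiber P Q b, wedge (nlf x) (lf ζ) ≠ 0 := by
      intro ζ hζ h0
      rw [wedge_eq_zero_iff (nlf_ne_zero x) (lf_ne_zero ζ), pr_nlf, pr_lf] at h0
      subst h0
      exact hxb ((mem_fiber_iff hc hd b x).1 hζ)
    have hk : ∀ ζ ∈ fiber P Q b, ee x ζ =
        (Real.log 2 + Real.log ‖lf ζ‖) + - Real.log ‖wedge (nlf x) (lf ζ)‖ := by
      intro ζ hζ
      have : kap x ζ = ‖wedge (nlf x) (lf ζ)‖ / ‖lf ζ‖ := by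
        have := kap_pr (nlf_ne_zero x) (lf_ne_zero ζ)
        rwa [pr_nlf, pr_lf, norm_nlf, one_mul] at this
      rw [ee, this, Real.log_div (norm_ne_zero_iff.2 (hmem ζ hζ))
        (norm_ne_zero_iff.2 (lf_ne_zero ζ))]
      ring
    have hF0 := Fl_ne_zero hc hd (nlf_ne_zero x)
    have hkap : kap (ratEval P Q x) b =
        ‖wedge (Fl P Q (nlf x)) (lf b)‖ / (‖Fl P Q (nlf x)‖ * ‖lf b‖) := by
      rw [← kap_pr hF0 (lf_ne_zero b), pr_lf, pr_Fl hc hd (nlf_ne_zero x), pr_nlf]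
    have hprod : ((fiber P Q b).map fun ζ => wedge (nlf x) (lf ζ)).prod ≠ 0 := by
      refine Multiset.prod_ne_zero fun h0 => ?_
      obtain ⟨ζ, hζ, hζ0⟩ := Multiset.mem_map.1 h0
      exact hmem ζ hζ hζ0
    have hnF := norm_ne_zero_iff.2 hF0
    have hnb := norm_ne_zero_iff.2 (lf_ne_zero b)
    rw [hcF b, norm_mul] at hkap
    have hlog : Real.log (kap (ratEval P Q x) b) = Real.log ‖c b‖ +
        ((fiber P Q b).map fun ζ => Real.log ‖wedge (nlf x) (lf ζ)‖).sum -
        (Real.log ‖Fl P Q (nlf x)‖ + Real.log ‖lf b‖) := by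
      rw [hkap, Real.log_div (mul_ne_zero (norm_ne_zero_iff.2 (hc0 b)) (norm_ne_zero_iff.2 hprod))
        (mul_ne_zero hnF hnb), Real.log_mul (norm_ne_zero_iff.2 (hc0 b)) (norm_ne_zero_iff.2 hprod),
        Real.log_mul hnF hnb, log_multiset_prod _ _ hmem]
    have hpush : push P Q (ee x) b = d * Real.log 2 +
        ((fiber P Q b).map fun ζ => Real.log ‖lf ζ‖).sum -
        ((fiber P Q b).map fun ζ => Real.log ‖wedge (nlf x) (lf ζ)‖).sum := by
      rw [push, Multiset.map_congr rfl hk, Multiset.sum_map_add, Multiset.sum_map_add,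
        sum_map_neg_aux]
      simp [card_fiber hc hd, d]
      ring
    rw [hpush, ee, hlog]
    simp only [γ, τ]
    ring
  -- bounds
  have hcomp : IsCompact (Metric.sphere (0 : ℂ × ℂ) 1) := isCompact_sphere _ _
  obtain ⟨M, hM⟩ := hcomp.exists_bound_of_continuousOn
    (f := fun u => Real.log ‖Fl P Q u‖) (by
      refine ContinuousOn.log (Fl_continuous P Q).norm.continuousOn ?_
      intro u hu
      refine norm_ne_zero_iff.2 (Fl_ne_zero hc hd ?_)
      rintro rfl
      simp at hu)
  have hτ : ∀ x, |τ x| ≤ M := by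
    intro x
    have := hM (nlf x) (by simp [norm_nlf])
    simpa [τ] using this
  have hM0 : 0 ≤ M := (abs_nonneg _).trans (hτ OnePoint.infty)
  obtain ⟨x0, x1, hx⟩ := two_values hc hd
  set η := kap (ratEval P Q x0) (ratEval P Q x1) / 2 with hη
  have hηpos : 0 < η := half_pos (lt_of_le_of_ne (kap_nonneg _ _) (fun h => hx (kap_eq_zero.1 h.symm)))
  have hγ : ∀ b, -(|Real.log 2 - Real.log η| + M) ≤ γ b := by
    intro b
    have hex : ∃ x, η ≤ kap (ratEval P Q x) b := by
      by_contra hcon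
      push Not at hcon
      have h0 := hcon x0
      have h1 := hcon x1
      have := kap_triangle (ratEval P Q x0) b (ratEval P Q x1)
      rw [kap_comm b] at this
      linarith
    obtain ⟨x, hx⟩ := hex
    have hxb : ratEval P Q x ≠ b := by
      intro h
      rw [h, kap_self] at hx
      linarith
    have h1 := hid x b hxb
    have h2 : 0 ≤ push P Q (ee x) b := by
      refine Multiset.sum_nonneg fun y hy => ?_
      obtain ⟨ζ, -, rfl⟩ := Multiset.mem_map.1 hy
      exact ee_nonneg x ζ
    have h3 : ee (ratEval P Q x) b ≤ Real.log 2 - Real.log η := by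
      have := Real.log_le_log hηpos hx
      unfold ee; linarith
    have h4 := (abs_le.1 (hτ x)).2
    have h5 := le_abs_self (Real.log 2 - Real.log η)
    linarith
  refine ⟨|Real.log 2 - Real.log η| + M, γ, τ, by positivity, hγ, fun x => ?_, hid⟩
  have := (abs_le.1 (hτ x)).1
  have := abs_nonneg (Real.log 2 - Real.log η)
  linarith

inductive FO (p q : Fin N → ℂ[X]) (x : Sphere) : Sphere → Prop
  | refl : FO p q x x
  | step (v : Fin N) (y : Sphere) : FO p q x y → FO p q x (ratEval (p v) (q v) y)

def Kop : (Sphere → ℝ) →ₗ[ℝ] (Sphere → ℝ) where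
  toFun g := fun x => ∑ v : Fin N, g (ratEval (p v) (q v) x)
  map_add' f g := by funext b; simp [Finset.sum_add_distrib]
  map_smul' c f := by funext b; simp [Finset.mul_sum]

lemma Kop_apply (g : Sphere → ℝ) (x : Sphere) :
    Kop p q g x = ∑ v : Fin N, g (ratEval (p v) (q v) x) := rfl

variable {p q}

lemma FO_trans {x y z : Sphere} (h1 : FO p q x y) (h2 : FO p q y z) : FO p q x z := by
  induction h2 with
  | refl => exact h1
  | step v y _ ih => exact FO.step v y ih

lemma Kop_pow_mono {f g : Sphere → ℝ} (m : ℕ) : ∀ x, (∀ y, FO p q x y → f y ≤ g y) →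
    (Kop p q ^ m) f x ≤ (Kop p q ^ m) g x := by
  induction m with
  | zero => intro x h; simpa using h x FO.refl
  | succ m ih =>
    intro x h
    rw [pow_succ', Module.End.mul_apply, Module.End.mul_apply, Kop_apply, Kop_apply]
    exact Finset.sum_le_sum fun v _ => ih _ fun y hy => h y (FO_trans (FO.step v x FO.refl) hy)

lemma Kop_pow_congr {f g : Sphere → ℝ} (m : ℕ) (x) (h : ∀ y, FO p q x y → f y = g y) :
    (Kop p q ^ m) f x = (Kop p q ^ m) g x :=
  le_antisymm (Kop_pow_mono m x fun y hy => (h y hy).le) (Kop_pow_mono m x fun y hy => (h y hy).ge)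

lemma Kop_pow_const (c : ℝ) (m : ℕ) : (Kop p q ^ m) (fun _ => c) = fun _ => (N : ℝ) ^ m * c := by
  induction m with
  | zero => simp
  | succ m ih =>
    rw [pow_succ', Module.End.mul_apply, ih]
    funext x
    rw [Kop_apply]
    simp [pow_succ']; ring

lemma Sop_congr_back (hg : Good p q) {f g : Sphere → ℝ} {b : Sphere}
    (h : ∀ v z, ratEval (p v) (q v) z = b → f z = g z) : Sop p q f b = Sop p q g b := by
  rw [Sop_apply, Sop_apply]
  refine Finset.sum_congr rfl fun v _ => ?_
  unfold push
  rw [Multiset.map_congr rfl]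
  intro z hz
  exact h v z ((mem_fiber_iff (hg.2.1 v) (hg.2.2.1 v) b z).1 hz)

/-- Σ over the fibre commutes with `Kop`. -/
lemma Sop_Kop_comm (F : Sphere → Sphere → ℝ) (m : ℕ) (x b : Sphere) :
    Sop p q (fun ζ => (Kop p q ^ m) (fun y => F y ζ) x) b =
      (Kop p q ^ m) (fun y => Sop p q (F y) b) x := by
  induction m generalizing x with
  | zero => simp
  | succ m ih =>
    simp only [pow_succ', Module.End.mul_apply, Kop_apply]
    have : (fun ζ => ∑ v, (Kop p q ^ m) (fun y => F y ζ) (ratEval (p v) (q v) x)) =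
        ∑ v, fun ζ => (Kop p q ^ m) (fun y => F y ζ) (ratEval (p v) (q v) x) := by
      funext ζ; simp
    rw [this, map_sum, Finset.sum_apply]
    exact Finset.sum_congr rfl fun v _ => ih _

end

section
/-! ### Potential estimates -/

variable {p q}

lemma FO_countable (hg : Good p q) (b : Sphere) : {x | FO p q x b}.Countable := by
  let B : ℕ → Set Sphere := fun n => Nat.rec {b} (fun _ S => ⋃ v : Fin N, ⋃ y ∈ S,
    {z | ratEval (p v) (q v) z = y}) n
  have hB : ∀ n, (B n).Countable := by
    intro n
    induction n with
    | zero => exact Set.countable_singleton b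
    | succ n ih =>
      refine Set.countable_iUnion fun v => ih.biUnion fun y _ => ?_
      refine Set.Finite.countable (((fiber (p v) (q v) y).toFinset.finite_toSet).subset ?_)
      intro z hz
      simpa using (mem_fiber_iff (hg.2.1 v) (hg.2.2.1 v) y z).2 hz
  refine (Set.countable_iUnion hB).mono ?_
  intro x hx
  have key : ∀ y, FO p q x y → (∃ n, y ∈ B n) → ∃ n, x ∈ B n := by
    intro y hy
    induction hy with
    | refl => exact id
    | step v y _ ih =>
      rintro ⟨n, hn⟩
      refine ih ⟨n + 1, ?_⟩
      exact Set.mem_iUnion.2 ⟨v, Set.mem_biUnion hn rfl⟩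
  obtain ⟨n, hn⟩ := key b hx ⟨0, rfl⟩
  exact Set.mem_iUnion.2 ⟨n, hn⟩

/-- the constants of the one-step identity, uniformly in the letter -/
lemma one_step_all (hg : Good p q) : ∃ C : ℝ, ∃ γ τ : Fin N → Sphere → ℝ, 0 ≤ C ∧
    (∀ v b, -C ≤ γ v b) ∧ (∀ v x, -C ≤ τ v x) ∧
    ∀ v x b, ratEval (p v) (q v) x ≠ b →
      push (p v) (q v) (ee x) b = ee (ratEval (p v) (q v) x) b + γ v b + τ v x := by
  choose C γ τ h0 h1 h2 h3 using fun v => one_step (hg.2.1 v) (hg.2.2.1 v)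
  have hle : ∀ v, C v ≤ ∑ i, C i := fun v => Finset.single_le_sum (fun i _ => h0 i) (Finset.mem_univ v)
  exact ⟨∑ i, C i, γ, τ, Finset.sum_nonneg fun i _ => h0 i,
    fun v b => (neg_le_neg (hle v)).trans (h1 v b), fun v x => (neg_le_neg (hle v)).trans (h2 v x), h3⟩

lemma ident (hg : Good p q) : ∃ C : ℝ, 0 ≤ C ∧ ∀ m : ℕ, ∃ γ τ : Sphere → ℝ,
    (∀ b, -(C * ((Dtot p q : ℝ) ^ m - (N : ℝ) ^ m)) ≤ γ b) ∧
    (∀ b, -(C * ((Dtot p q : ℝ) ^ m - (N : ℝ) ^ m)) ≤ τ b) ∧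
    ∀ x b, ¬ FO p q x b →
      (Sop p q ^ m) (ee x) b = (Kop p q ^ m) (fun y => ee y b) x + γ b + τ x := by
  obtain ⟨C, γ', τ', hC, hγ', hτ', hid⟩ := one_step_all hg
  have hND : (N : ℝ) + 1 ≤ Dtot p q := by exact_mod_cast N_lt_Dtot hg
  have hN0 : (0 : ℝ) ≤ N := Nat.cast_nonneg N
  refine ⟨C * N, by positivity, fun m => ?_⟩
  induction m with
  | zero => exact ⟨0, 0, by simp, by simp, fun x b _ => by simp⟩
  | succ m ih =>
    obtain ⟨γ, τ, hγ, hτ, h⟩ := ih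
    have hNm : (0 : ℝ) ≤ (N : ℝ) ^ m := by positivity
    have harith : -(C * N * ((Dtot p q : ℝ) ^ (m + 1) - (N : ℝ) ^ (m + 1))) ≤
        (Dtot p q : ℝ) * -(C * N * ((Dtot p q : ℝ) ^ m - (N : ℝ) ^ m)) +
          (N : ℝ) ^ m * (N * -C) := by
      have : 0 ≤ C * N * (N : ℝ) ^ m * ((Dtot p q : ℝ) - N - 1) :=
        mul_nonneg (by positivity) (by linarith)
      rw [pow_succ, pow_succ]; nlinarith
    refine ⟨fun b => Sop p q γ b + (N : ℝ) ^ m * ∑ v, γ' v b,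
      fun x => (Dtot p q : ℝ) * τ x + (Kop p q ^ m) (fun y => ∑ v, τ' v y) x, ?_, ?_, ?_⟩
    · intro b
      have h1 := Sop_mono hg backInv_univ (f := fun _ => -(C * N * ((Dtot p q : ℝ) ^ m - (N : ℝ) ^ m)))
        (g := γ) (fun z _ => hγ z) b trivial
      rw [Sop_const hg] at h1
      have h2 : (N : ℝ) * -C ≤ ∑ v, γ' v b := by
        have := Finset.sum_le_sum fun v (_ : v ∈ Finset.univ) => hγ' v b
        simpa using this
      have h3 := mul_le_mul_of_nonneg_left h2 hNm
      linarith
    · intro x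
      have h1 := mul_le_mul_of_nonneg_left (hτ x) (by linarith : (0 : ℝ) ≤ Dtot p q)
      have h2 : ∀ y, (N : ℝ) * -C ≤ ∑ v, τ' v y := by
        intro y
        have := Finset.sum_le_sum fun v (_ : v ∈ Finset.univ) => hτ' v y
        simpa using this
      have h3 := Kop_pow_mono (p := p) (q := q) (f := fun _ => (N : ℝ) * -C) m x fun y _ => h2 y
      rw [Kop_pow_const] at h3
      linarith
    · intro x b hxb
      rw [pow_succ', Module.End.mul_apply, Sop_congr_back hg (g := fun ζ =>
        (Kop p q ^ m) (fun y => ee y ζ) x + γ ζ + τ x)]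
      · have e1 : (fun ζ => (Kop p q ^ m) (fun y => ee y ζ) x + γ ζ + τ x) =
          (fun ζ => (Kop p q ^ m) (fun y => ee y ζ) x) + γ + fun _ => τ x := rfl
        rw [e1, map_add, map_add, Sop_const hg, Pi.add_apply, Pi.add_apply, Sop_Kop_comm]
        have e2 : (Kop p q ^ m) (fun y => Sop p q (ee y) b) x =
            (Kop p q ^ m) ((Kop p q (fun y => ee y b)) + (fun _ => ∑ v, γ' v b) +
              fun y => ∑ v, τ' v y) x := by
          refine Kop_pow_congr m x fun y hy => ?_
          rw [Sop_apply]
          simp only [Pi.add_apply, Kop_apply]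
          rw [← Finset.sum_add_distrib, ← Finset.sum_add_distrib]
          refine Finset.sum_congr rfl fun v _ => hid v y b ?_
          intro hh
          exact hxb (hh ▸ FO.step v y hy)
        rw [e2, map_add, map_add, Pi.add_apply, Pi.add_apply, Kop_pow_const, pow_succ,
          Module.End.mul_apply]
        ring
      · intro v z hz
        refine h x z fun hxz => hxb (hz ▸ FO.step v z hxz)

/-! ### Quality of a curve -/

def QT (ν : Measure ℝ) (T : ℝ → Sphere) (s : ℝ) : Prop :=
  Continuous T ∧ 0 < s ∧ (∀ B : Set Sphere, B.Countable → ν (T ⁻¹' B) = 0) ∧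
    ∀ ζ, Integrable (fun θ => ee (T θ) ζ ^ 2) ν ∧ ∫ θ, ee (T θ) ζ ^ 2 ∂ν ≤ s ^ 2

lemma measurable_ee {T : ℝ → Sphere} (hT : Continuous T) (ζ : Sphere) :
    Measurable fun θ => ee (T θ) ζ := by
  have h : Continuous fun θ => kap ζ (T θ) := (continuous_kap_right ζ).comp hT
  have : (fun θ => ee (T θ) ζ) = fun θ => Real.log 2 - Real.log (kap ζ (T θ)) := by
    funext θ; rw [ee, kap_comm]
  rw [this]
  exact measurable_const.sub (Real.measurable_log.comp h.measurable)

lemma QT.integrable {ν : Measure ℝ} [IsProbabilityMeasure ν] {T : ℝ → Sphere} {s : ℝ}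
    (h : QT ν T s) (ζ : Sphere) : Integrable (fun θ => ee (T θ) ζ) ν := by
  refine Integrable.mono' ((integrable_const (1 : ℝ)).add (h.2.2.2 ζ).1)
    (measurable_ee h.1 ζ).aestronglyMeasurable (ae_of_all _ fun θ => ?_)
  have := ee_nonneg (T θ) ζ
  rw [Real.norm_of_nonneg this]
  simp only [Pi.add_apply]
  nlinarith [sq_nonneg (ee (T θ) ζ - 1)]

lemma int_push {ν : Measure ℝ} {P Q : ℂ[X]} {F : ℝ → Sphere → ℝ}
    (hF : ∀ ζ, Integrable (fun θ => F θ ζ) ν) (b : Sphere) :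
    Integrable (fun θ => push P Q (F θ) b) ν ∧
      ∫ θ, push P Q (F θ) b ∂ν = push P Q (fun ζ => ∫ θ, F θ ζ ∂ν) b := by
  unfold push
  induction fiber P Q b using Multiset.induction with
  | empty => simp
  | cons a m ih =>
    simp only [Multiset.map_cons, Multiset.sum_cons]
    exact ⟨(hF a).add ih.1, by rw [integral_add (hF a) ih.1, ih.2]⟩

lemma int_Sop {ν : Measure ℝ} {F : ℝ → Sphere → ℝ}
    (hF : ∀ ζ, Integrable (fun θ => F θ ζ) ν) (b : Sphere) :
    Integrable (fun θ => Sop p q (F θ) b) ν ∧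
      ∫ θ, Sop p q (F θ) b ∂ν = Sop p q (fun ζ => ∫ θ, F θ ζ ∂ν) b := by
  simp only [Sop_apply]
  refine ⟨integrable_finsetSum _ fun v _ => (int_push hF b).1, ?_⟩
  rw [integral_finsetSum _ fun v _ => (int_push hF b).1]
  exact Finset.sum_congr rfl fun v _ => (int_push hF b).2

lemma int_Sop_pow {ν : Measure ℝ} {F : ℝ → Sphere → ℝ}
    (hF : ∀ ζ, Integrable (fun θ => F θ ζ) ν) (k : ℕ) : ∀ b : Sphere,
    Integrable (fun θ => (Sop p q ^ k) (F θ) b) ν ∧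
      ∫ θ, (Sop p q ^ k) (F θ) b ∂ν = (Sop p q ^ k) (fun ζ => ∫ θ, F θ ζ ∂ν) b := by
  induction k with
  | zero => intro b; simpa using hF b
  | succ k ih =>
    intro b
    simp only [pow_succ', Module.End.mul_apply]
    have := int_Sop (p := p) (q := q) (F := fun θ => (Sop p q ^ k) (F θ)) (fun ζ => (ih ζ).1) b
    refine ⟨this.1, this.2.trans ?_⟩
    have e : (fun ζ => ∫ θ, (Sop p q ^ k) (F θ) ζ ∂ν) = (Sop p q ^ k) fun ζ => ∫ θ, F θ ζ ∂ν :=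
      funext fun ζ => (ih ζ).2
    rw [e]

lemma sq_sum_le {α : Type*} (m : Multiset α) (x : α → ℝ) {s C : ℝ} (hs : 0 < s) (hC : 0 ≤ C) :
    ((m.map x).sum + C) ^ 2 ≤ (m.card * s + C) * (s⁻¹ * (m.map fun a => x a ^ 2).sum + C) := by
  induction m using Multiset.induction with
  | empty => simp; nlinarith
  | cons a m ih =>
    simp only [Multiset.map_cons, Multiset.sum_cons, Multiset.card_cons]
    set S := (m.map x).sum
    set S2 := (m.map fun a => x a ^ 2).sum
    have hS2 : 0 ≤ S2 := Multiset.sum_nonneg fun y hy => by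
      obtain ⟨a, -, rfl⟩ := Multiset.mem_map.1 hy; positivity
    push_cast
    set n : ℝ := (m.card : ℝ)
    have hn : 0 ≤ n := Nat.cast_nonneg _
    set A := n * s + C
    set B := s⁻¹ * S2 + C
    have hA : 0 ≤ A := by positivity
    have hB : 0 ≤ B := by positivity
    have e1 : (n + 1) * s + C = A + s := by simp only [A]; ring
    have e2 : s⁻¹ * (x a ^ 2 + S2) + C = B + s⁻¹ * x a ^ 2 := by simp only [B]; ring
    rw [e1, e2]
    have e3 : (A + s) * (B + s⁻¹ * x a ^ 2) = A * B + s * B + A * s⁻¹ * x a ^ 2 + x a ^ 2 := by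
      field_simp
      ring
    rw [e3]
    set X := S + C
    have e4 : x a + S + C = x a + X := add_assoc _ _ _
    rw [e4]
    have hX : 2 * x a * X ≤ s * B + A * s⁻¹ * x a ^ 2 := by
      have h1 : (2 * x a * X) ^ 2 ≤ (s * B + A * s⁻¹ * x a ^ 2) ^ 2 := by
        have h2 : (2 * x a * X) ^ 2 ≤ 4 * (x a) ^ 2 * (A * B) := by nlinarith [sq_nonneg (x a)]
        have h3 : 4 * (x a) ^ 2 * (A * B) = 4 * (s * B) * (A * s⁻¹ * x a ^ 2) := by
          field_simp
        nlinarith [sq_nonneg (s * B - A * s⁻¹ * x a ^ 2)]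
      exact (le_abs_self _).trans (abs_le_of_sq_le_sq h1 (by positivity))
    nlinarith

end

section
variable {p q}

lemma push_ee_le (hg : Good p q) : ∃ C : ℝ, 0 ≤ C ∧ ∀ v x b, ratEval (p v) (q v) x ≠ b →
    ee (ratEval (p v) (q v) x) b ≤ push (p v) (q v) (ee x) b + C := by
  obtain ⟨C, γ, τ, hC, h1, h2, h3⟩ := one_step_all hg
  refine ⟨2 * C, by positivity, fun v x b hx => ?_⟩
  have := h3 v x b hx
  have := h1 v b
  have := h2 v x
  linarith

lemma ratEval_surj {P Q : ℂ[X]} (hc : IsCoprime P Q) (hd : 1 ≤ max P.natDegree Q.natDegree)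
    (b : Sphere) : {z | ratEval P Q z = b}.Countable := by
  refine Set.Finite.countable (((fiber P Q b).toFinset.finite_toSet).subset ?_)
  intro z hz
  simpa using (mem_fiber_iff hc hd b z).2 hz

lemma QT_push (hg : Good p q) {C : ℝ} (hC : 0 ≤ C) (hpush : ∀ v x b, ratEval (p v) (q v) x ≠ b →
    ee (ratEval (p v) (q v) x) b ≤ push (p v) (q v) (ee x) b + C)
    {ν : Measure ℝ} [IsProbabilityMeasure ν] {T : ℝ → Sphere} {s : ℝ} (h : QT ν T s) (v : Fin N) :
    QT ν (fun θ => ratEval (p v) (q v) (T θ)) (degR p q v * s + C) := by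
  obtain ⟨hT, hs, hnull, hint⟩ := h
  have hcont : Continuous fun θ => ratEval (p v) (q v) (T θ) :=
    (continuous_ratEval (hg.2.1 v) (hg.2.2.1 v)).comp hT
  have hdeg : (1 : ℝ) ≤ degR p q v := by exact_mod_cast hg.2.2.1 v
  have hA : 0 < degR p q v * s + C := by positivity
  refine ⟨hcont, hA, ?_, ?_⟩
  · intro B hB
    refine le_antisymm ((measure_mono ?_).trans (hnull (⋃ b ∈ B, {z | ratEval (p v) (q v) z = b})
      (hB.biUnion fun b _ => ratEval_surj (hg.2.1 v) (hg.2.2.1 v) b)).le) zero_le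
    intro θ hθ
    exact Set.mem_biUnion (x := ratEval (p v) (q v) (T θ)) hθ rfl
  · intro ζ
    have hp := int_push (P := p v) (Q := q v) (F := fun θ ζ => ee (T θ) ζ ^ 2) (ν := ν)
      (fun ζ => (hint ζ).1) ζ
    have hbint : Integrable (fun θ => (degR p q v * s + C) *
        (s⁻¹ * push (p v) (q v) (fun ζ => ee (T θ) ζ ^ 2) ζ + C)) ν :=
      ((hp.1.const_mul _).add (integrable_const _)).const_mul _
    have hae : ∀ᵐ θ ∂ν, ee (ratEval (p v) (q v) (T θ)) ζ ^ 2 ≤ (degR p q v * s + C) *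
        (s⁻¹ * push (p v) (q v) (fun ζ => ee (T θ) ζ ^ 2) ζ + C) := by
      have h0 := hnull _ (ratEval_surj (hg.2.1 v) (hg.2.2.1 v) ζ)
      filter_upwards [measure_eq_zero_iff_ae_notMem.1 h0] with θ hθ
      have h1 := hpush v (T θ) ζ hθ
      have h2 := sq_sum_le (fiber (p v) (q v) ζ) (ee (T θ)) hs hC
      rw [card_fiber (hg.2.1 v) (hg.2.2.1 v)] at h2
      exact (pow_le_pow_left₀ (ee_nonneg _ _) h1 2).trans h2
    have hi : Integrable (fun θ => ee (ratEval (p v) (q v) (T θ)) ζ ^ 2) ν := by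
      refine Integrable.mono' hbint ((measurable_ee hcont ζ).pow_const 2).aestronglyMeasurable ?_
      filter_upwards [hae] with θ hθ
      rwa [Real.norm_of_nonneg (sq_nonneg _)]
    refine ⟨hi, (integral_mono_ae hi hbint hae).trans ?_⟩
    rw [integral_const_mul, integral_add (hp.1.const_mul _) (integrable_const _),
      integral_const_mul, hp.2, sq]
    refine mul_le_mul_of_nonneg_left ?_ hA.le
    simp only [integral_const, probReal_univ, smul_eq_mul, one_mul]
    have h1 : push (p v) (q v) (fun ζ => ∫ θ, ee (T θ) ζ ^ 2 ∂ν) ζ ≤ degR p q v * s ^ 2 := by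
      have := push_mono (hg.2.1 v) (hg.2.2.1 v) (f := fun ζ => ∫ θ, ee (T θ) ζ ^ 2 ∂ν)
        (g := fun _ => s ^ 2) (b := ζ) fun z _ => (hint z).2
      rwa [push_const (hg.2.1 v) (hg.2.2.1 v)] at this
    have h2 := mul_le_mul_of_nonneg_left h1 (inv_nonneg.2 hs.le)
    have h3 : s⁻¹ * (degR p q v * s ^ 2) = degR p q v * s := by field_simp
    linarith

def gk (p q : Fin N → ℂ[X]) (k : ℕ) (δ : ℝ) (b y : Sphere) : ℝ :=
  (Sop p q ^ k) (fun ζ => if kap y ζ < δ then ee y ζ else 0) b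

lemma gk_int (hg : Good p q) {ρ : ℝ} (hρ : 0 < ρ) {k : ℕ} {δ : ℝ} {b : Sphere}
    (hk : ∀ y, (Sop p q ^ k) (fun ζ => if kap y ζ < δ then 1 else 0) b ≤ ρ ^ 2 * (Dtot p q : ℝ) ^ k)
    {ν : Measure ℝ} [IsProbabilityMeasure ν] {T : ℝ → Sphere} {s : ℝ} (h : QT ν T s) :
    Integrable (fun θ => gk p q k δ b (T θ)) ν ∧
      ∫ θ, gk p q k δ b (T θ) ∂ν ≤ (Dtot p q : ℝ) ^ k * (2 * ρ * s) := by
  have hs := h.2.1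
  have hint : ∀ ζ, Integrable (fun θ => if kap (T θ) ζ < δ then ee (T θ) ζ else 0) ν := by
    intro ζ
    have hm : MeasurableSet {θ | kap (T θ) ζ < δ} := by
      have : Continuous fun θ => kap ζ (T θ) := (continuous_kap_right ζ).comp h.1
      simp only [kap_comm _ ζ]
      exact (isOpen_lt this continuous_const).measurableSet
    exact (h.integrable ζ).indicator hm
  have h1 := int_Sop_pow (p := p) (q := q) (F := fun θ ζ => if kap (T θ) ζ < δ then ee (T θ) ζ else 0)
    hint k b
  have h2 := int_Sop_pow (p := p) (q := q) (F := fun θ ζ => ee (T θ) ζ ^ 2)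
    (fun ζ => (h.2.2.2 ζ).1) k b
  refine ⟨h1.1, ?_⟩
  have hpt : ∀ θ, gk p q k δ b (T θ) ≤ (s / ρ) * (ρ ^ 2 * (Dtot p q : ℝ) ^ k) +
      (ρ / s) * (Sop p q ^ k) (fun ζ => ee (T θ) ζ ^ 2) b := by
    intro θ
    have := Sop_pow_mono hg backInv_univ (f := fun ζ => if kap (T θ) ζ < δ then ee (T θ) ζ else 0)
      (g := (s / ρ) • (fun ζ => if kap (T θ) ζ < δ then 1 else 0) + (ρ / s) • fun ζ => ee (T θ) ζ ^ 2)
      (fun z _ => by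
        simp only [Pi.add_apply, Pi.smul_apply, smul_eq_mul]
        split_ifs
        · set e := ee (T θ) z
          have h3 : (s / ρ) * 1 + (ρ / s) * e ^ 2 - e =
              (s / ρ) * ((1 - (ρ / s) * e / 2) ^ 2 + 3 / 4 * ((ρ / s) * e) ^ 2) := by
            field_simp; ring
          have : 0 ≤ (s / ρ) * ((1 - (ρ / s) * e / 2) ^ 2 + 3 / 4 * ((ρ / s) * e) ^ 2) := by positivity
          linarith
        · have : 0 ≤ (ρ / s) * ee (T θ) z ^ 2 := by positivity
          simpa using this) k b trivial
    rw [map_add, map_smul, map_smul] at this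
    simp only [Pi.add_apply, Pi.smul_apply, smul_eq_mul] at this
    have h4 := mul_le_mul_of_nonneg_left (hk (T θ)) (by positivity : 0 ≤ s / ρ)
    unfold gk
    linarith
  refine (integral_mono h1.1 ((integrable_const _).add (h2.1.const_mul (ρ / s))) hpt).trans ?_
  rw [integral_add' (integrable_const _) (h2.1.const_mul _), integral_const_mul (ρ / s), h2.2]
  simp only [integral_const, probReal_univ, smul_eq_mul, one_mul]
  have h5 := Sop_pow_mono hg backInv_univ (f := fun ζ => ∫ θ, ee (T θ) ζ ^ 2 ∂ν)
    (g := fun _ => s ^ 2) (fun z _ => (h.2.2.2 z).2) k b trivial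
  rw [Sop_pow_const hg] at h5
  have h6 := mul_le_mul_of_nonneg_left h5 (by positivity : 0 ≤ ρ / s)
  have h7 : (s / ρ) * (ρ ^ 2 * (Dtot p q : ℝ) ^ k) + (ρ / s) * ((Dtot p q : ℝ) ^ k * s ^ 2) =
      (Dtot p q : ℝ) ^ k * (2 * ρ * s) := by field_simp; ring
  linarith

lemma Kop_gk_int (hg : Good p q) {C : ℝ} (hC : 0 ≤ C)
    (hpush : ∀ v x b, ratEval (p v) (q v) x ≠ b →
      ee (ratEval (p v) (q v) x) b ≤ push (p v) (q v) (ee x) b + C) {ν : Measure ℝ}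
    [IsProbabilityMeasure ν] {g : Sphere → ℝ} {A : ℝ} (hA : 0 ≤ A)
    (hgint : ∀ T s, QT ν T s → Integrable (fun θ => g (T θ)) ν ∧ ∫ θ, g (T θ) ∂ν ≤ A * s) (m : ℕ) :
    ∀ T s, QT ν T s → Integrable (fun θ => (Kop p q ^ m) g (T θ)) ν ∧
      ∫ θ, (Kop p q ^ m) g (T θ) ∂ν ≤ (Dtot p q : ℝ) ^ m * A * (s + N * C) := by
  have hND : (N : ℝ) + 1 ≤ Dtot p q := by exact_mod_cast N_lt_Dtot hg
  have hN0 : (0 : ℝ) ≤ N := Nat.cast_nonneg N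
  induction m with
  | zero =>
    intro T s h
    have := hgint T s h
    have h2 : 0 ≤ A * (N * C) := by positivity
    exact ⟨by simpa using this.1, by simp only [pow_zero, Module.End.one_apply]; linarith [this.2]⟩
  | succ m ih =>
    intro T s h
    have hv := fun v => ih _ _ (QT_push hg hC hpush h v)
    simp only [pow_succ', Module.End.mul_apply, Kop_apply]
    refine ⟨integrable_finsetSum _ fun v _ => (hv v).1, ?_⟩
    rw [integral_finsetSum _ fun v _ => (hv v).1]
    refine (Finset.sum_le_sum fun v _ => (hv v).2).trans ?_
    rw [← Finset.mul_sum]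
    have e : ∑ v, (degR p q v * s + C + N * C) = Dtot p q * s + N * (C + N * C) := by
      simp only [Finset.sum_add_distrib, ← Finset.sum_mul, Dtot, Nat.cast_sum]
      simp
      ring
    rw [e]
    have h3 : Dtot p q * s + N * (C + N * C) ≤ Dtot p q * (s + N * C) := by
      have : 0 ≤ N * C * (Dtot p q - (N + 1)) := mul_nonneg (by positivity) (by linarith)
      linarith
    have := mul_le_mul_of_nonneg_left h3 (by positivity : 0 ≤ (Dtot p q : ℝ) ^ m * A)
    linarith

lemma Kop_ee_int (hg : Good p q) {ν : Measure ℝ}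
    [IsProbabilityMeasure ν] {T : ℝ → Sphere} {s : ℝ} (h : QT ν T s) (m : ℕ) (b : Sphere) :
    Integrable (fun θ => (Kop p q ^ m) (fun y => ee y b) (T θ)) ν := by
  obtain ⟨C, hC, hpush⟩ := push_ee_le hg
  induction m generalizing T s with
  | zero => simpa using h.integrable b
  | succ m ih =>
    simp only [pow_succ', Module.End.mul_apply, Kop_apply]
    exact integrable_finsetSum _ fun v _ => ih (QT_push hg hC hpush h v)

lemma potential_small (hg : Good p q) (hA : NoSuperAttract p q) {ν : Measure ℝ}
    [IsProbabilityMeasure ν] {T : ℝ → Sphere} {s : ℝ} (h : QT ν T s) {η : ℝ} (hη : 0 < η) :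
    ∃ m0, ∀ m ≥ m0, ∀ b ∈ JS p q,
      ∫ θ, (Kop p q ^ m) (fun y => ee y b) (T θ) ∂ν ≤ η * (Dtot p q : ℝ) ^ m := by
  obtain ⟨C, hC, hpush⟩ := push_ee_le hg
  obtain ⟨C1, hC1, hid⟩ := ident hg
  have hND : (N : ℝ) + 1 ≤ Dtot p q := by exact_mod_cast N_lt_Dtot hg
  have hN0 : (0 : ℝ) ≤ N := Nat.cast_nonneg N
  have hD0 : (0 : ℝ) < Dtot p q := by linarith
  have hs := h.2.1
  have hX : 0 < s + N * C := by positivity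
  set ρ := η / (4 * (s + N * C)) with hρ
  have hρ0 : 0 < ρ := by positivity
  obtain ⟨k, δ, hδ, hk⟩ := cluster hg hA (pow_pos hρ0 2)
  obtain ⟨γ, τ, hγ, hτ, hident⟩ := hid k
  set L := max (Real.log 2 - Real.log δ) 0 + 2 * C1 with hL
  have hL0 : 0 ≤ L := by positivity
  have hlim : Tendsto (fun m : ℕ => ((N : ℝ) / Dtot p q) ^ m * L) atTop (𝓝 0) := by
    have := tendsto_pow_atTop_nhds_zero_of_lt_one (r := (N : ℝ) / Dtot p q) (by positivity)
      (by rw [div_lt_one hD0]; linarith)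
    simpa using this.mul_const L
  obtain ⟨m1, hm1⟩ := eventually_atTop.1 (hlim.eventually (gt_mem_nhds (half_pos hη)))
  refine ⟨m1 + k, fun m' hm' b hb => ?_⟩
  obtain ⟨m, rfl⟩ : ∃ m, m' = m + k := ⟨m' - k, by omega⟩
  have hm : m1 ≤ m := by omega
  -- pointwise bound on `Kop^k`
  have hpt : ∀ y, ¬ FO p q y b → (Kop p q ^ k) (fun y => ee y b) y ≤
      (Dtot p q : ℝ) ^ k * L + gk p q k δ b y := by
    intro y hy
    have h1 := hident y b hy
    have h2 := hγ b
    have h3 := hτ y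
    have h4 := Sop_pow_mono hg backInv_univ (f := ee y)
      (g := (fun _ => max (Real.log 2 - Real.log δ) 0) + fun ζ => if kap y ζ < δ then ee y ζ else 0)
      (fun z _ => by
        simp only [Pi.add_apply]
        split_ifs with hz
        · have := le_max_right (Real.log 2 - Real.log δ) 0
          linarith
        · have h5 := Real.log_le_log hδ (not_lt.1 hz)
          have := le_max_left (Real.log 2 - Real.log δ) 0
          unfold ee
          linarith) k b trivial
    rw [map_add, Sop_pow_const hg] at h4
    simp only [Pi.add_apply] at h4
    have h6 : 0 ≤ C1 * (N : ℝ) ^ k := by positivity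
    unfold gk
    rw [hL]
    nlinarith
  have hgint := Kop_gk_int hg hC hpush (ν := ν) (g := gk p q k δ b)
    (A := (Dtot p q : ℝ) ^ k * (2 * ρ)) (by positivity)
    (fun T s h => by
      have := gk_int hg hρ0 (hk b hb) h
      exact ⟨this.1, this.2.trans (le_of_eq (by ring))⟩) m T s h
  have hnull := h.2.2.1 _ (FO_countable hg b)
  have hae : ∀ᵐ θ ∂ν, (Kop p q ^ (m + k)) (fun y => ee y b) (T θ) ≤
      (N : ℝ) ^ m * ((Dtot p q : ℝ) ^ k * L) + (Kop p q ^ m) (gk p q k δ b) (T θ) := by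
    filter_upwards [measure_eq_zero_iff_ae_notMem.1 hnull] with θ hθ
    rw [pow_add, Module.End.mul_apply]
    refine (Kop_pow_mono (g := (fun _ => (Dtot p q : ℝ) ^ k * L) + gk p q k δ b) m (T θ) ?_).trans ?_
    · intro y hy
      exact hpt y fun hyb => hθ (FO_trans hy hyb)
    · rw [map_add, Kop_pow_const]
      exact le_rfl
  refine (integral_mono_ae (Kop_ee_int hg h (m + k) b)
    ((integrable_const _).add hgint.1) hae).trans ?_
  rw [integral_add' (integrable_const _) hgint.1]
  simp only [integral_const, probReal_univ, smul_eq_mul, one_mul]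
  have h8 := hm1 m hm
  have h9 : (N : ℝ) ^ m * ((Dtot p q : ℝ) ^ k * L) =
      (Dtot p q : ℝ) ^ (m + k) * (((N : ℝ) / Dtot p q) ^ m * L) := by
    rw [div_pow, pow_add]; field_simp
  have h10 : (Dtot p q : ℝ) ^ m * ((Dtot p q : ℝ) ^ k * (2 * ρ)) * (s + N * C) =
      (Dtot p q : ℝ) ^ (m + k) * (η / 2) := by
    rw [hρ, pow_add]; field_simp; norm_num
  have h11 := hgint.2
  have h12 : (Dtot p q : ℝ) ^ (m + k) * (((N : ℝ) / Dtot p q) ^ m * L) ≤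
      (Dtot p q : ℝ) ^ (m + k) * (η / 2) := mul_le_mul_of_nonneg_left h8.le (by positivity)
  linarith

lemma Kop_ee_nonneg (m : ℕ) (b x : Sphere) : 0 ≤ (Kop p q ^ m) (fun y => ee y b) x := by
  have := Kop_pow_mono (p := p) (q := q) (f := fun _ => 0) (g := fun y => ee y b) m x
    fun y _ => ee_nonneg y b
  rw [Kop_pow_const] at this
  simpa using this

/-- Difference of potentials. -/
lemma osc_pot (hg : Good p q) (hA : NoSuperAttract p q) {ν : Measure ℝ}
    [IsProbabilityMeasure ν] {T1 T2 : ℝ → Sphere} {s1 s2 : ℝ} (h1 : QT ν T1 s1) (h2 : QT ν T2 s2)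
    {η : ℝ} (hη : 0 < η) :
    ∃ m0, ∀ m ≥ m0, ∀ b ∈ JS p q, ∀ b' ∈ JS p q,
      |(Sop p q ^ m) (fun ζ => (∫ θ, ee (T1 θ) ζ ∂ν) - ∫ θ, ee (T2 θ) ζ ∂ν) b -
        (Sop p q ^ m) (fun ζ => (∫ θ, ee (T1 θ) ζ ∂ν) - ∫ θ, ee (T2 θ) ζ ∂ν) b'| ≤
        η * (Dtot p q : ℝ) ^ m := by
  obtain ⟨C1, hC1, hid⟩ := ident hg
  obtain ⟨m1, hm1⟩ := potential_small hg hA h1 (half_pos hη)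
  obtain ⟨m2, hm2⟩ := potential_small hg hA h2 (half_pos hη)
  refine ⟨max m1 m2, fun m hm b hb b' hb' => ?_⟩
  obtain ⟨γ, τ, -, -, hident⟩ := hid m
  have key : ∀ T s, QT ν T s →
      (Sop p q ^ m) (fun ζ => ∫ θ, ee (T θ) ζ ∂ν) b - (Sop p q ^ m) (fun ζ => ∫ θ, ee (T θ) ζ ∂ν) b' =
      (∫ θ, (Kop p q ^ m) (fun y => ee y b) (T θ) ∂ν) -
        (∫ θ, (Kop p q ^ m) (fun y => ee y b') (T θ) ∂ν) + (γ b - γ b') := by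
    intro T s h
    have e1 := int_Sop_pow (p := p) (q := q) (F := fun θ ζ => ee (T θ) ζ) h.integrable m b
    have e2 := int_Sop_pow (p := p) (q := q) (F := fun θ ζ => ee (T θ) ζ) h.integrable m b'
    have i1 := Kop_ee_int hg h m b
    have i2 := Kop_ee_int hg h m b'
    rw [← e1.2, ← e2.2, ← integral_sub e1.1 e2.1, ← integral_sub i1 i2]
    have : γ b - γ b' = ∫ _, (γ b - γ b') ∂ν := by simp
    rw [this]
    refine Eq.trans ?_ (integral_add (i1.sub i2) (integrable_const (γ b - γ b')))
    refine integral_congr_ae ?_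
    filter_upwards [measure_eq_zero_iff_ae_notMem.1 (h.2.2.1 _ (FO_countable hg b)),
      measure_eq_zero_iff_ae_notMem.1 (h.2.2.1 _ (FO_countable hg b'))] with θ ha hb
    have a1 := hident (T θ) b ha
    have a2 := hident (T θ) b' hb
    linarith
  have e : (fun ζ => (∫ θ, ee (T1 θ) ζ ∂ν) - ∫ θ, ee (T2 θ) ζ ∂ν) =
      (fun ζ => ∫ θ, ee (T1 θ) ζ ∂ν) - fun ζ => ∫ θ, ee (T2 θ) ζ ∂ν := rfl
  rw [e, map_sub, Pi.sub_apply, Pi.sub_apply]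
  have k1 := key T1 s1 h1
  have k2 := key T2 s2 h2
  have a1 := hm1 m (le_of_max_le_left hm) b hb
  have a2 := hm1 m (le_of_max_le_left hm) b' hb'
  have a3 := hm2 m (le_of_max_le_right hm) b hb
  have a4 := hm2 m (le_of_max_le_right hm) b' hb'
  have n1 : 0 ≤ ∫ θ, (Kop p q ^ m) (fun y => ee y b) (T1 θ) ∂ν := integral_nonneg fun _ => Kop_ee_nonneg m b _
  have n2 : 0 ≤ ∫ θ, (Kop p q ^ m) (fun y => ee y b') (T1 θ) ∂ν := integral_nonneg fun _ => Kop_ee_nonneg m b' _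
  have n3 : 0 ≤ ∫ θ, (Kop p q ^ m) (fun y => ee y b) (T2 θ) ∂ν := integral_nonneg fun _ => Kop_ee_nonneg m b _
  have n4 : 0 ≤ ∫ θ, (Kop p q ^ m) (fun y => ee y b') (T2 θ) ∂ν := integral_nonneg fun _ => Kop_ee_nonneg m b' _
  rw [abs_le]
  constructor <;> linarith

end

section
/-! ### Circles -/

lemma logsin_half : IntervalIntegrable (fun θ => Real.log (Real.sin θ) ^ 2) volume 0 (Real.pi / 2) := by
  have hpi := Real.pi_pos
  have h1 : IntervalIntegrable (fun θ : ℝ => 16 * (2 / Real.pi) ^ (-(1/2) : ℝ) * θ ^ (-(1/2) : ℝ))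
      volume 0 (Real.pi / 2) :=
    (intervalIntegral.intervalIntegrable_rpow' (by norm_num)).const_mul _
  refine h1.mono_fun (by
    exact (Real.measurable_log.comp Real.measurable_sin).pow_const 2 |>.aestronglyMeasurable) ?_
  rw [Set.uIoc_of_le (by positivity)]
  refine (ae_restrict_iff' measurableSet_Ioc).2 (ae_of_all _ fun θ hθ => ?_)
  have hs : 2 / Real.pi * θ ≤ Real.sin θ := Real.mul_le_sin hθ.1.le hθ.2
  have hp : 0 < 2 / Real.pi * θ := by have := hθ.1; positivity
  have hs0 : 0 < Real.sin θ := lt_of_lt_of_le hp hs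
  have h2 := (Real.abs_log_mul_self_rpow_lt (Real.sin θ) (1 / 4) hs0 (Real.sin_le_one θ)
    (by norm_num)).le
  have hx : 0 < Real.sin θ ^ (1 / 4 : ℝ) := Real.rpow_pos_of_pos hs0 _
  rw [abs_mul, abs_of_pos hx] at h2
  have h3 : (|Real.log (Real.sin θ)| * Real.sin θ ^ (1 / 4 : ℝ)) ^ 2 ≤ 16 :=
    (pow_le_pow_left₀ (by positivity) h2 2).trans (by norm_num)
  rw [mul_pow, sq_abs, ← Real.rpow_natCast (Real.sin θ ^ (1 / 4 : ℝ)), ← Real.rpow_mul hs0.le] at h3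
  norm_num at h3
  have hy : 0 < Real.sin θ ^ (1 / 2 : ℝ) := Real.rpow_pos_of_pos hs0 _
  have h4 : Real.log (Real.sin θ) ^ 2 ≤ 16 * Real.sin θ ^ (-(1 / 2) : ℝ) := by
    rw [Real.rpow_neg hs0.le, ← div_eq_mul_inv, le_div_iff₀ hy]
    simpa using h3
  have h5 : Real.sin θ ^ (-(1 / 2) : ℝ) ≤ (2 / Real.pi * θ) ^ (-(1 / 2) : ℝ) :=
    Real.rpow_le_rpow_of_nonpos hp hs (by norm_num)
  rw [Real.mul_rpow (by positivity) hθ.1.le] at h5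
  beta_reduce
  rw [Real.norm_of_nonneg (sq_nonneg _)]
  refine le_trans ?_ (le_abs_self _)
  rw [mul_assoc]
  linarith

lemma logsin_periodic : Function.Periodic (fun θ => Real.log (Real.sin θ) ^ 2) Real.pi := by
  intro θ
  simp [Real.sin_add_pi]

lemma logsin_int (a b : ℝ) : IntervalIntegrable (fun θ => Real.log (Real.sin θ) ^ 2) volume a b := by
  refine logsin_periodic.intervalIntegrable₀ Real.pi_pos.ne' ?_ a b
  refine logsin_half.trans ?_
  have := logsin_half.comp_sub_left Real.pi
  simp only [Real.sin_pi_sub, sub_zero] at this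
  have h2 := this.symm
  convert h2 using 1
  ring

lemma logsin_shift (φ : ℝ) : ∫ θ in (0 : ℝ)..2 * Real.pi, Real.log (Real.sin (θ - φ)) ^ 2 =
    ∫ θ in (0 : ℝ)..2 * Real.pi, Real.log (Real.sin θ) ^ 2 := by
  rw [intervalIntegral.integral_comp_sub_right (fun θ => Real.log (Real.sin θ) ^ 2)]
  have hper : Function.Periodic (fun θ => Real.log (Real.sin θ) ^ 2) (2 * Real.pi) := by
    intro θ; simp
  have := hper.intervalIntegral_add_eq (0 - φ) 0
  rw [show 0 - φ + 2 * Real.pi = 2 * Real.pi - φ by ring, zero_add] at this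
  exact this

lemma wedge_coe (a b : ℂ) : wedge (lf (a : Sphere)) (lf (b : Sphere)) = a - b := by
  simp [wedge, lf_coe]

lemma norm_lf_coe (a : ℂ) : ‖lf (a : Sphere)‖ = max ‖a‖ 1 := by
  simp [lf_coe, Prod.norm_def]

lemma kap_coe (a b : ℂ) : kap (a : Sphere) (b : Sphere) = ‖a - b‖ / (max ‖a‖ 1 * max ‖b‖ 1) := by
  rw [kap_lf, wedge_coe, norm_lf_coe, norm_lf_coe]

lemma kap_coe_infty (a : ℂ) : kap (a : Sphere) OnePoint.infty = 1 / max ‖a‖ 1 := by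
  rw [kap_lf, norm_lf_coe]
  simp [wedge, lf_coe, lf_infty, Prod.norm_def]

def crc (a : ℂ) (r : ℝ) (θ : ℝ) : Sphere := ((circleMap a r θ : ℂ) : Sphere)

lemma norm_crc_sub (a : ℂ) {r : ℝ} (hr : 0 < r) (z : ℂ) : ∃ φ : ℝ, ∀ θ : ℝ,
    r * |Real.sin (θ - φ)| ≤ ‖circleMap a r θ - z‖ := by
  refine ⟨Complex.arg (z - a), fun θ => ?_⟩
  set φ := Complex.arg (z - a)
  have e1 : z - a = ‖z - a‖ * Complex.exp (φ * Complex.I) := (Complex.norm_mul_exp_arg_mul_I _).symm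
  have e2 : circleMap a r θ - z = Complex.exp (φ * Complex.I) *
      (r * Complex.exp ((θ - φ : ℝ) * Complex.I) - ‖z - a‖) := by
    have : circleMap a r θ - z = r * Complex.exp (θ * Complex.I) - (z - a) := by
      simp [circleMap]; ring
    rw [this, e1, mul_sub, mul_left_comm, ← Complex.exp_add]
    have : (φ : ℂ) * Complex.I + ((θ - φ : ℝ) : ℂ) * Complex.I = θ * Complex.I := by push_cast; ring
    rw [this]
    have h3 : ‖(‖z - a‖ : ℂ) * Complex.exp (φ * Complex.I)‖ = ‖z - a‖ := by
      simp [Complex.norm_exp_ofReal_mul_I]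
    rw [h3]; ring
  rw [e2, norm_mul, Complex.norm_exp_ofReal_mul_I, one_mul]
  refine le_trans ?_ (Complex.abs_im_le_norm _)
  rw [Complex.sub_im, Complex.ofReal_im, sub_zero, Complex.im_ofReal_mul,
    Complex.exp_ofReal_mul_I_im, abs_mul, abs_of_pos hr]

lemma kap_crc (a : ℂ) {r : ℝ} (hr : 0 < r) : ∃ c0 : ℝ, 0 < c0 ∧ ∀ ζ : Sphere, ∃ φ : ℝ, ∀ θ : ℝ,
    c0 * |Real.sin (θ - φ)| ≤ kap (crc a r θ) ζ := by
  set M := ‖a‖ + r + 1 with hM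
  have hM1 : 1 ≤ M := by have := norm_nonneg a; linarith
  have hz : ∀ θ, ‖circleMap a r θ‖ ≤ M - 1 := by
    intro θ
    have h1 := norm_add_le a (circleMap 0 r θ)
    rw [norm_circleMap_zero, abs_of_pos hr] at h1
    have h2 : circleMap a r θ = a + circleMap 0 r θ := by simp [circleMap]
    rw [h2]
    linarith
  have hz' : ∀ θ, max ‖circleMap a r θ‖ 1 ≤ M := fun θ => max_le ((hz θ).trans (by linarith)) hM1
  have hz0 : ∀ θ, 0 < max ‖circleMap a r θ‖ 1 := fun θ => lt_max_of_lt_right one_pos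
  refine ⟨min r 1 / (2 * M ^ 2), by positivity, fun ζ => ?_⟩
  have hsin : ∀ x, |Real.sin x| ≤ 1 := Real.abs_sin_le_one
  have hmin1 : min r 1 ≤ 1 := min_le_right _ _
  have hminr : min r 1 ≤ r := min_le_left _ _
  have hmin0 : 0 < min r 1 := lt_min hr one_pos
  have hM2 : M ≤ M ^ 2 := by nlinarith
  induction ζ using OnePoint.rec with
  | infty =>
    refine ⟨0, fun θ => ?_⟩
    rw [crc, kap_coe_infty, le_div_iff₀ (hz0 θ)]
    have h1 : min r 1 / (2 * M ^ 2) * M ≤ 1 := by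
      rw [div_mul_eq_mul_div, div_le_one (by positivity)]
      nlinarith
    calc min r 1 / (2 * M ^ 2) * |Real.sin (θ - 0)| * max ‖circleMap a r θ‖ 1
        ≤ min r 1 / (2 * M ^ 2) * 1 * M := by
          gcongr
          · exact hsin _
          · exact hz' θ
      _ ≤ 1 := by rw [mul_one]; exact h1
  | coe z =>
    obtain ⟨φ, hφ⟩ := norm_crc_sub a hr z
    refine ⟨φ, fun θ => ?_⟩
    have hzz : 0 < max ‖z‖ 1 := lt_max_of_lt_right one_pos
    rw [crc, kap_coe, le_div_iff₀ (mul_pos (hz0 θ) hzz)]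
    by_cases hbig : ‖z‖ ≤ 2 * M
    · have h1 : max ‖z‖ 1 ≤ 2 * M := max_le hbig (by linarith)
      calc min r 1 / (2 * M ^ 2) * |Real.sin (θ - φ)| * (max ‖circleMap a r θ‖ 1 * max ‖z‖ 1)
          ≤ r / (2 * M ^ 2) * |Real.sin (θ - φ)| * (M * (2 * M)) := by
            gcongr
            exact hz' θ
        _ = r * |Real.sin (θ - φ)| := by field_simp
        _ ≤ _ := hφ θ
    · push Not at hbig
      have h1 : max ‖z‖ 1 = ‖z‖ := max_eq_left (by linarith)
      have h2 : ‖z‖ / 2 ≤ ‖circleMap a r θ - z‖ := by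
        have := norm_sub_norm_le z (circleMap a r θ)
        rw [norm_sub_rev] at this
        have := hz θ
        linarith
      rw [h1]
      calc min r 1 / (2 * M ^ 2) * |Real.sin (θ - φ)| * (max ‖circleMap a r θ‖ 1 * ‖z‖)
          ≤ 1 / (2 * M ^ 2) * 1 * (M * ‖z‖) := by
            gcongr
            · exact hsin _
            · exact hz' θ
        _ = ‖z‖ / 2 * (1 / M) := by field_simp
        _ ≤ ‖z‖ / 2 * 1 := by
            gcongr
            rw [div_le_one (by linarith)]; exact hM1
        _ ≤ _ := by linarith

def nuC : Measure ℝ := ENNReal.ofReal (2 * Real.pi)⁻¹ • volume.restrict (Set.Ioc 0 (2 * Real.pi))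

instance : IsProbabilityMeasure nuC := by
  constructor
  simp only [nuC, Measure.smul_apply, Measure.restrict_apply_univ, Real.volume_Ioc, smul_eq_mul,
    sub_zero]
  rw [← ENNReal.ofReal_mul (by positivity), inv_mul_cancel₀ (by positivity), ENNReal.ofReal_one]

lemma integrable_nuC {f : ℝ → ℝ} : Integrable f nuC ↔ IntervalIntegrable f volume 0 (2 * Real.pi) := by
  rw [nuC, integrable_smul_measure, intervalIntegrable_iff_integrableOn_Ioc_of_le (by positivity)]
  · rfl
  · simp [Real.pi_pos]
  · simp

lemma integral_nuC {f : ℝ → ℝ} : ∫ θ, f θ ∂nuC = (2 * Real.pi)⁻¹ * ∫ θ in (0 : ℝ)..2 * Real.pi, f θ := by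
  rw [nuC, integral_smul_measure, intervalIntegral.integral_of_le (by positivity),
    ENNReal.toReal_ofReal (by positivity)]
  rfl

lemma nuC_countable {B : Set ℝ} (hB : B.Countable) : nuC B = 0 := by
  rw [nuC, Measure.smul_apply, hB.measure_zero, smul_zero]

lemma crc_null (a : ℂ) {r : ℝ} (hr : 0 < r) {B : Set Sphere} (hB : B.Countable) :
    (crc a r ⁻¹' B).Countable := by
  have : crc a r ⁻¹' B = circleMap a r ⁻¹' ((fun z : ℂ => (z : Sphere)) ⁻¹' B) := rfl
  rw [this]
  exact (hB.preimage OnePoint.coe_injective).preimage_circleMap a hr.ne'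

lemma sin_null (φ : ℝ) : {θ : ℝ | Real.sin (θ - φ) = 0}.Countable := by
  refine (Set.countable_range fun n : ℤ => n * Real.pi + φ).mono ?_
  intro θ hθ
  obtain ⟨n, hn⟩ := Real.sin_eq_zero_iff.1 hθ
  exact ⟨n, by simp only [hn]; ring⟩

lemma QT_crc (a : ℂ) {r : ℝ} (hr : 0 < r) : ∃ s, QT nuC (crc a r) s := by
  obtain ⟨c0, hc0, hk⟩ := kap_crc a hr
  have hcont : Continuous (crc a r) := OnePoint.continuous_coe.comp (continuous_circleMap a r)
  set K := Real.log 2 - Real.log c0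
  set I := ∫ θ in (0 : ℝ)..2 * Real.pi, Real.log (Real.sin θ) ^ 2
  have hI : 0 ≤ I := intervalIntegral.integral_nonneg (by positivity) fun _ _ => sq_nonneg _
  set S := 2 * K ^ 2 + (2 * Real.pi)⁻¹ * (2 * I)
  have hS : 0 ≤ S := by positivity
  refine ⟨Real.sqrt S + 1, hcont, by positivity, fun B hB => nuC_countable (crc_null a hr hB), fun ζ => ?_⟩
  obtain ⟨φ, hφ⟩ := hk ζ
  have hJ : Integrable (fun θ => 2 * Real.log (Real.sin (θ - φ)) ^ 2) nuC := by
    refine Integrable.const_mul ?_ _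
    rw [integrable_nuC]
    have := (logsin_int (0 - φ) (2 * Real.pi - φ)).comp_sub_right φ
    simpa using this
  have hint : Integrable (fun θ => 2 * K ^ 2 + 2 * Real.log (Real.sin (θ - φ)) ^ 2) nuC :=
    (integrable_const _).add hJ
  have hae : ∀ᵐ θ ∂nuC, ee (crc a r θ) ζ ^ 2 ≤ 2 * K ^ 2 + 2 * Real.log (Real.sin (θ - φ)) ^ 2 := by
    filter_upwards [measure_eq_zero_iff_ae_notMem.1 (nuC_countable (sin_null φ))] with θ hθ
    have hs : 0 < |Real.sin (θ - φ)| := abs_pos.2 hθ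
    have h1 : ee (crc a r θ) ζ ≤ K - Real.log (Real.sin (θ - φ)) := by
      have h2 := Real.log_le_log (mul_pos hc0 hs) (hφ θ)
      rw [Real.log_mul hc0.ne' hs.ne', Real.log_abs] at h2
      unfold ee
      simp only [K]
      linarith
    have h3 := pow_le_pow_left₀ (ee_nonneg _ _) h1 2
    nlinarith [sq_nonneg (K + Real.log (Real.sin (θ - φ)))]
  have hi : Integrable (fun θ => ee (crc a r θ) ζ ^ 2) nuC := by
    refine Integrable.mono' hint ((measurable_ee hcont ζ).pow_const 2).aestronglyMeasurable ?_
    filter_upwards [hae] with θ hθ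
    rwa [Real.norm_of_nonneg (sq_nonneg _)]
  refine ⟨hi, (integral_mono_ae hi hint hae).trans ?_⟩
  rw [integral_add (integrable_const _) hJ]
  simp only [integral_const, probReal_univ, smul_eq_mul, one_mul]
  rw [integral_nuC, intervalIntegral.integral_const_mul, logsin_shift]
  have : (Real.sqrt S + 1) ^ 2 = S + 2 * Real.sqrt S + 1 := by
    rw [add_sq, Real.sq_sqrt hS]; ring
  rw [this]
  have := Real.sqrt_nonneg S
  simp only [S, I] at *
  linarith

/-- The bump functions. -/
def bmp (r : ℝ) (t : ℝ) : ℝ :=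
  Real.log (2 * r) + Real.posLog ((2 * r)⁻¹ * t) - (Real.log r + Real.posLog (r⁻¹ * t))

def bump (a : ℂ) (r : ℝ) (ζ : Sphere) : ℝ := OnePoint.elim ζ 0 fun z => bmp r ‖a - z‖

lemma pot_crc (a : ℂ) {r : ℝ} (hr : 0 < r) : ∃ c : ℝ,
    (∫ θ, ee (crc a r θ) OnePoint.infty ∂nuC = c) ∧ ∀ z : ℂ, ∫ θ, ee (crc a r θ) (z : Sphere) ∂nuC =
      c + Real.log (max ‖z‖ 1) - (Real.log r + Real.posLog (r⁻¹ * ‖a - z‖)) := by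
  refine ⟨_, rfl, fun z => ?_⟩
  obtain ⟨s, hs⟩ := QT_crc a hr
  have hl : Integrable (fun θ => Real.log ‖circleMap a r θ - z‖) nuC :=
    integrable_nuC.2 (circleIntegrable_log_norm_sub_const (a := z) (c := a) r)
  have hav : ∫ θ, Real.log ‖circleMap a r θ - z‖ ∂nuC = Real.log r + Real.posLog (r⁻¹ * ‖a - z‖) := by
    rw [← circleAverage_log_norm_sub_const_eq_log_radius_add_posLog hr.ne', integral_nuC]
    rfl
  have hconst : Real.log (max ‖z‖ 1) = ∫ _, Real.log (max ‖z‖ 1) ∂nuC := by simp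
  rw [← hav]
  rw [hconst, ← integral_add (hs.integrable _) (integrable_const _)]
  refine Eq.trans ?_ (integral_sub ((hs.integrable OnePoint.infty).add
    (integrable_const (Real.log (max ‖z‖ 1)))) hl)
  refine integral_congr_ae ?_
  filter_upwards [measure_eq_zero_iff_ae_notMem.1 (nuC_countable
    (crc_null a hr (Set.countable_singleton (z : Sphere))))] with θ hθ
  have hne : circleMap a r θ - z ≠ 0 := by
    intro h0
    exact hθ (by simp [crc, sub_eq_zero.1 h0])
  have h1 : max ‖circleMap a r θ‖ 1 ≠ 0 := (lt_max_of_lt_right one_pos).ne'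
  have h2 : max ‖z‖ 1 ≠ 0 := (lt_max_of_lt_right one_pos).ne'
  simp only [Pi.add_apply, ee, crc]
  rw [kap_coe, kap_coe_infty, Real.log_div (norm_ne_zero_iff.2 hne) (mul_ne_zero h1 h2),
    Real.log_mul h1 h2, Real.log_div one_ne_zero h1, Real.log_one]
  ring

variable {p q}

lemma osc_bump (hg : Good p q) (hA : NoSuperAttract p q) (a : ℂ) {r : ℝ} (hr : 0 < r)
    {η : ℝ} (hη : 0 < η) :
    ∃ m0, ∀ m ≥ m0, ∀ b ∈ JS p q, ∀ b' ∈ JS p q,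
      |(Sop p q ^ m) (bump a r) b - (Sop p q ^ m) (bump a r) b'| ≤ η * (Dtot p q : ℝ) ^ m := by
  have hr2 : 0 < 2 * r := by positivity
  obtain ⟨s1, h1⟩ := QT_crc a hr
  obtain ⟨s2, h2⟩ := QT_crc a hr2
  obtain ⟨c1, i1, k1⟩ := pot_crc a hr
  obtain ⟨c2, i2, k2⟩ := pot_crc a hr2
  obtain ⟨m0, hm0⟩ := osc_pot hg hA h1 h2 hη
  refine ⟨m0, fun m hm b hb b' hb' => ?_⟩
  have := hm0 m hm b hb b' hb'
  have e : (fun ζ => (∫ θ, ee (crc a r θ) ζ ∂nuC) - ∫ θ, ee (crc a (2 * r) θ) ζ ∂nuC) =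
      bump a r + fun _ => c1 - c2 := by
    funext ζ
    simp only [Pi.add_apply]
    induction ζ using OnePoint.rec with
    | infty => rw [i1, i2]; simp [bump]
    | coe z => rw [k1, k2]; simp only [bump, bmp, OnePoint.elim_some]; ring
  rw [e, map_add, Sop_pow_const hg] at this
  simpa using this

end

section

lemma bmp_cont (r : ℝ) : Continuous (bmp r) := by
  unfold bmp
  have : Continuous Real.posLog := Real.continuous_posLog
  fun_prop

lemma bmp_eq_log {r t : ℝ} (hr : 0 < r) (h0 : 0 ≤ t) (h : t ≤ r) : bmp r t = Real.log 2 := by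
  have h1 : Real.posLog (r⁻¹ * t) = 0 := by
    rw [Real.posLog_eq_zero_iff, abs_of_nonneg (by positivity), inv_mul_le_iff₀ hr]; linarith
  have h2 : Real.posLog ((2 * r)⁻¹ * t) = 0 := by
    rw [Real.posLog_eq_zero_iff, abs_of_nonneg (by positivity), inv_mul_le_iff₀ (by positivity)]
    linarith
  rw [bmp, h1, h2, Real.log_mul two_ne_zero hr.ne']
  ring

lemma bmp_eq_zero {r t : ℝ} (hr : 0 < r) (h : 2 * r ≤ t) : bmp r t = 0 := by
  have ht : 0 < t := by linarith
  have h1 : Real.posLog (r⁻¹ * t) = Real.log (r⁻¹ * t) := by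
    apply Real.posLog_eq_log
    rw [abs_of_nonneg (by positivity), le_inv_mul_iff₀ hr]; linarith
  have h2 : Real.posLog ((2 * r)⁻¹ * t) = Real.log ((2 * r)⁻¹ * t) := by
    apply Real.posLog_eq_log
    rw [abs_of_nonneg (by positivity), le_inv_mul_iff₀ (by positivity)]; linarith
  rw [bmp, h1, h2, Real.log_mul (by positivity) ht.ne', Real.log_mul (by positivity) ht.ne',
    Real.log_inv, Real.log_inv]
  ring

lemma bmp_nonneg {r t : ℝ} (hr : 0 < r) (h0 : 0 ≤ t) : 0 ≤ bmp r t := by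
  rcases le_total t r with h | h
  · rw [bmp_eq_log hr h0 h]; positivity
  rcases le_total (2 * r) t with h' | h'
  · rw [bmp_eq_zero hr h']
  · have ht : 0 < t := by linarith
    have h1 : Real.posLog (r⁻¹ * t) = Real.log (r⁻¹ * t) := by
      apply Real.posLog_eq_log
      rw [abs_of_nonneg (by positivity), le_inv_mul_iff₀ hr]; linarith
    have h2 := Real.posLog_nonneg (x := (2 * r)⁻¹ * t)
    have h3 := Real.log_le_log ht h'
    rw [bmp, h1, Real.log_mul (by positivity) ht.ne', Real.log_inv]
    linarith

lemma bump_cont {r : ℝ} (hr : 0 < r) : Continuous fun x : ℂ × Sphere => bump x.1 r x.2 := by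
  rw [continuous_iff_continuousAt]
  rintro ⟨a, ζ⟩
  induction ζ using OnePoint.rec with
  | infty =>
    have hU : IsOpen (((↑) : ℂ → Sphere) '' Metric.closedBall a (1 + 2 * r))ᶜ :=
      OnePoint.isOpen_compl_image_coe.2 ⟨Metric.isClosed_closedBall, isCompact_closedBall _ _⟩
    have hm : Metric.ball a 1 ×ˢ (((↑) : ℂ → Sphere) '' Metric.closedBall a (1 + 2 * r))ᶜ ∈
        𝓝 (a, (OnePoint.infty : Sphere)) :=
      prod_mem_nhds (Metric.ball_mem_nhds a one_pos) (hU.mem_nhds (by simp))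
    have he : (fun x : ℂ × Sphere => bump x.1 r x.2) =ᶠ[𝓝 (a, (OnePoint.infty : Sphere))]
        fun _ => 0 := by
      filter_upwards [hm]
      rintro ⟨b, ζ⟩ ⟨hb, hζ⟩
      induction ζ using OnePoint.rec with
      | infty => rfl
      | coe z =>
        have hz : z ∉ Metric.closedBall a (1 + 2 * r) := fun h => hζ ⟨z, h, rfl⟩
        simp only [Metric.mem_ball, Metric.mem_closedBall, not_le] at hb hz
        refine bmp_eq_zero hr ?_
        have := dist_triangle_right z a b
        rw [← dist_eq_norm]
        rw [dist_comm b z]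
        rw [dist_comm] at hb
        linarith [dist_triangle z b a, dist_comm a b]
    exact (continuousAt_const (y := (0:ℝ))).congr he.symm
  | coe z =>
    have hO : IsOpenEmbedding (Prod.map (id : ℂ → ℂ) ((↑) : ℂ → Sphere)) :=
      IsOpenEmbedding.id.prodMap OnePoint.isOpenEmbedding_coe
    have := (hO.continuousAt_iff (g := fun x : ℂ × Sphere => bump x.1 r x.2) (x := (a, z)))
    refine this.1 ?_
    have hc : Continuous fun x : ℂ × ℂ => bmp r ‖x.1 - x.2‖ := by
      have := bmp_cont r
      fun_prop
    exact hc.continuousAt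

def bumpC {r : ℝ} (hr : 0 < r) (a : ℂ) : C(Sphere, ℝ) :=
  (ContinuousMap.curry ⟨_, bump_cont hr⟩) a

lemma bumpC_apply {r : ℝ} (hr : 0 < r) (a : ℂ) (ζ : Sphere) : bumpC hr a ζ = bump a r ζ := rfl

lemma bumpC_cont {r : ℝ} (hr : 0 < r) : Continuous (bumpC hr) :=
  (ContinuousMap.curry ⟨_, bump_cont hr⟩).continuous

lemma Sop_pow_abs {p q : Fin N → ℂ[X]} (hg : Good p q) {f g : Sphere → ℝ} {ε : ℝ} (h : ∀ z, |f z - g z| ≤ ε) (m : ℕ) (b : Sphere) :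
    |(Sop p q ^ m) f b - (Sop p q ^ m) g b| ≤ (Dtot p q : ℝ) ^ m * ε := by
  have e : (Sop p q ^ m) f b - (Sop p q ^ m) g b = (Sop p q ^ m) (f - g) b := by
    rw [map_sub]; rfl
  rw [e, abs_le]
  have h1 := Sop_pow_mono hg backInv_univ (f := f - g) (g := fun _ => ε)
    (fun z _ => (abs_le.1 (h z)).2) m b trivial
  have h2 := Sop_pow_mono hg backInv_univ (g := f - g) (f := fun _ => -ε)
    (fun z _ => (abs_le.1 (h z)).1) m b trivial
  rw [Sop_pow_const hg] at h1 h2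
  constructor <;> linarith

/-- functions whose oscillation decays -/
def OscW (p q : Fin N → ℂ[X]) : Submodule ℝ C(Sphere, ℝ) where
  carrier := {F | ∀ η : ℝ, 0 < η → ∃ m0, ∀ m ≥ m0, ∀ b ∈ JS p q, ∀ b' ∈ JS p q,
    |(Sop p q ^ m) F b - (Sop p q ^ m) F b'| ≤ η * (Dtot p q : ℝ) ^ m}
  zero_mem' := by
    intro η hη
    refine ⟨0, fun m _ b _ b' _ => ?_⟩
    have : ((0 : C(Sphere, ℝ)) : Sphere → ℝ) = 0 := rfl
    rw [this, map_zero]; simp; positivity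
  add_mem' := by
    intro F F' h h' η hη
    obtain ⟨m1, h1⟩ := h (η / 2) (by positivity)
    obtain ⟨m2, h2⟩ := h' (η / 2) (by positivity)
    refine ⟨max m1 m2, fun m hm b hb b' hb' => ?_⟩
    have i1 := h1 m (le_of_max_le_left hm) b hb b' hb'
    have i2 := h2 m (le_of_max_le_right hm) b hb b' hb'
    rw [ContinuousMap.coe_add, map_add]
    simp only [Pi.add_apply]
    rw [abs_le] at *
    constructor <;> linarith
  smul_mem' := by
    intro c F h η hη
    obtain ⟨m1, h1⟩ := h (η / (|c| + 1)) (by positivity)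
    refine ⟨m1, fun m hm b hb b' hb' => ?_⟩
    have i1 := h1 m hm b hb b' hb'
    rw [ContinuousMap.coe_smul, map_smul]
    simp only [Pi.smul_apply, smul_eq_mul]
    rw [← mul_sub, abs_mul]
    calc |c| * _ ≤ (|c| + 1) * (η / (|c| + 1) * (Dtot p q : ℝ) ^ m) :=
          mul_le_mul (by linarith) i1 (abs_nonneg _) (by positivity)
      _ = _ := by field_simp

variable {p q}

lemma OscW_closed (hg : Good p q) : IsClosed (OscW p q : Set C(Sphere, ℝ)) := by
  refine isClosed_of_closure_subset fun F hF => ?_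
  intro η hη
  rw [Metric.mem_closure_iff] at hF
  obtain ⟨F', hF', hd⟩ := hF (η / 3) (by positivity)
  obtain ⟨m0, h0⟩ := hF' (η / 3) (by positivity)
  refine ⟨m0, fun m hm b hb b' hb' => ?_⟩
  have hz : ∀ z, |F z - F' z| ≤ η / 3 := fun z => by
    rw [← Real.dist_eq]; exact (ContinuousMap.dist_apply_le_dist z).trans hd.le
  have i1 := Sop_pow_abs hg hz m b
  have i2 := Sop_pow_abs hg hz m b'
  have i3 := h0 m hm b hb b' hb'
  rw [abs_le] at *
  constructor <;> linarith

lemma OscW_const (hg : Good p q) (c : ℝ) : ContinuousMap.const Sphere c ∈ OscW p q := by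
  intro η hη
  refine ⟨0, fun m _ b _ b' _ => ?_⟩
  rw [show ((ContinuousMap.const Sphere c : C(Sphere, ℝ)) : Sphere → ℝ) = fun _ => c from rfl, Sop_pow_const hg]
  simp; positivity

lemma OscW_bump (hg : Good p q) (hA : NoSuperAttract p q) {r : ℝ} (hr : 0 < r) (a : ℂ) :
    bumpC hr a ∈ OscW p q := fun _ hη => osc_bump hg hA a hr hη

lemma OscW_top (hg : Good p q) (hA : NoSuperAttract p q) (F : C(Sphere, ℝ)) : F ∈ OscW p q := by
  rw [← SetLike.mem_coe, ← (OscW_closed hg).closure_eq, Metric.mem_closure_iff]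
  intro ε' hε'
  obtain ⟨ε, hε, hεε⟩ : ∃ ε : ℝ, 0 < ε ∧ 2 * ε < ε' := ⟨ε' / 4, by positivity, by linarith⟩
  set h : ℂ → ℝ := fun a => F a - F OnePoint.infty with hh
  have hcont : Continuous h := by
    have : Continuous fun a : ℂ => F (a : Sphere) := F.continuous.comp OnePoint.continuous_coe
    exact this.sub continuous_const
  have hlim : Tendsto h (cocompact ℂ) (𝓝 0) := by
    have h1 : Tendsto ((↑) : ℂ → Sphere) (cocompact ℂ) (𝓝 OnePoint.infty) := by
      rw [← coclosedCompact_eq_cocompact]; exact OnePoint.tendsto_coe_infty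
    have h2 := (F.continuous.tendsto OnePoint.infty).comp h1
    have h3 := h2.sub_const (F OnePoint.infty)
    rw [sub_self] at h3
    exact h3
  have huc := Continuous.uniformContinuous_of_tendsto_cocompact hcont hlim
  rw [Metric.uniformContinuous_iff] at huc
  obtain ⟨δ, hδ, hδ'⟩ := huc ε hε
  obtain ⟨r, hr, hrδ⟩ : ∃ r : ℝ, 0 < r ∧ 2 * r < δ := ⟨δ / 4, by positivity, by linarith⟩
  obtain ⟨R, hR, hR'⟩ : ∃ R : ℝ, 0 < R ∧ ∀ a, a ∉ Metric.closedBall (0:ℂ) R → |h a| ≤ ε := by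
    have := (Metric.tendsto_nhds.1 hlim ε hε)
    rw [← Metric.cobounded_eq_cocompact, ← comap_norm_atTop] at this
    obtain ⟨s, hs, hs'⟩ := this
    obtain ⟨R, hR⟩ := mem_atTop_sets.1 hs
    refine ⟨max R 1, by positivity, fun a ha => ?_⟩
    have : a ∈ norm ⁻¹' s := hR _ (by
      simp only [Metric.mem_closedBall, dist_zero_right, not_le] at ha
      exact (le_max_left _ _).trans ha.le)
    have := hs' this
    simp only [Set.mem_ofPred_eq, Real.dist_eq, sub_zero] at this
    exact this.le
  set K := Metric.closedBall (0:ℂ) R with hK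
  have hint : IntegrableOn (fun a => h a • bumpC hr a) K volume :=
    (hcont.smul (bumpC_cont hr)).continuousOn.integrableOn_compact (isCompact_closedBall _ _)
  set I : C(Sphere, ℝ) := ∫ a in K, h a • bumpC hr a with hI
  have hmem : I ∈ OscW p q := by
    have hav := Convex.set_average_mem (μ := volume) (t := K) (OscW p q).convex (OscW_closed hg)
      (Metric.measure_closedBall_pos volume _ hR).ne' measure_closedBall_lt_top.ne
      (ae_of_all _ fun a => (OscW p q).smul_mem (h a) (OscW_bump hg hA hr a)) hint
    rw [hI, ← measure_smul_setAverage _ measure_closedBall_lt_top.ne]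
    exact (OscW p q).smul_mem _ hav
  have hIapp : ∀ ζ, I ζ = ∫ a in K, h a * bump a r ζ := fun ζ => by
    rw [hI, ContinuousMap.integral_apply hint]; rfl
  have hbc : ∀ z : ℂ, Continuous fun a : ℂ => bmp r ‖a - z‖ := fun z => by
    have := bmp_cont r
    fun_prop
  have hcs : ∀ z : ℂ, HasCompactSupport fun a : ℂ => bmp r ‖a - z‖ := fun z => by
    refine HasCompactSupport.of_support_subset_isCompact (isCompact_closedBall z (2 * r)) fun a ha => ?_
    by_contra hcon
    simp only [Metric.mem_closedBall, not_le, dist_eq_norm] at hcon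
    exact ha (bmp_eq_zero hr hcon.le)
  have hbi : ∀ z : ℂ, Integrable (fun a : ℂ => bmp r ‖a - z‖) := fun z =>
    (hbc z).integrable_of_hasCompactSupport (hcs z)
  set C := ∫ a : ℂ, bmp r ‖a‖ with hC
  have hCz : ∀ z : ℂ, ∫ a : ℂ, bmp r ‖a - z‖ = C := fun z =>
    integral_sub_right_eq_self (fun a : ℂ => bmp r ‖a‖) z
  have hCpos : 0 < C := by
    have := (hbc 0).integral_pos_of_hasCompactSupport_nonneg_nonzero (μ := volume) (x := 0) (hcs 0)
      (fun a => bmp_nonneg hr (norm_nonneg _)) (by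
        rw [sub_zero, norm_zero, bmp_eq_log hr le_rfl hr.le]; positivity)
    rwa [hCz] at this
  have key : ∀ z : ℂ, |I z - C * h z| ≤ 2 * ε * C := fun z => by
    have hi1 : IntegrableOn (fun a => h a * bmp r ‖a - z‖) K volume :=
      (hcont.mul (hbc z)).continuousOn.integrableOn_compact (isCompact_closedBall _ _)
    have hi1' := hi1.integrable_indicator measurableSet_closedBall
    have e : I z - C * h z = ∫ a, (K.indicator (fun a => h a * bmp r ‖a - z‖) a - h z * bmp r ‖a - z‖) := by
      rw [integral_sub hi1' ((hbi z).const_mul _), integral_indicator measurableSet_closedBall,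
        integral_const_mul, hCz, hIapp, mul_comm C]
      rfl
    rw [e, ← hCz z, ← integral_const_mul]
    rw [← Real.norm_eq_abs]
    refine (norm_integral_le_of_norm_le ((hbi z).const_mul (2 * ε)) (ae_of_all _ fun a => ?_))
    rw [Real.norm_eq_abs]
    rcases le_or_gt (2 * r) ‖a - z‖ with h1 | h1
    · have h0 := bmp_eq_zero hr h1
      have : K.indicator (fun a => h a * bmp r ‖a - z‖) a = 0 := by
        rw [Set.indicator_apply]; split_ifs <;> simp [h0]
      rw [this, h0]; simp
    · have hd := hδ' (a := a) (b := z) (by rw [dist_eq_norm]; linarith)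
      rw [Real.dist_eq] at hd
      have hb := bmp_nonneg hr (norm_nonneg (a - z))
      by_cases ha : a ∈ K
      · rw [Set.indicator_of_mem ha, ← sub_mul, abs_mul, abs_of_nonneg hb]
        exact mul_le_mul_of_nonneg_right (by linarith) hb
      · rw [Set.indicator_of_notMem ha, zero_sub, abs_neg, abs_mul, abs_of_nonneg hb]
        refine mul_le_mul_of_nonneg_right ?_ hb
        have := hR' a ha
        rw [abs_le] at *
        rw [abs_lt] at hd
        constructor <;> linarith
  refine ⟨C⁻¹ • I + ContinuousMap.const Sphere (F OnePoint.infty),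
    (OscW p q).add_mem ((OscW p q).smul_mem _ hmem) (OscW_const hg _), ?_⟩
  refine lt_of_le_of_lt ((ContinuousMap.dist_le (by positivity : 0 ≤ 2 * ε)).2 fun ζ => ?_) hεε
  rw [dist_comm, Real.dist_eq]
  simp only [ContinuousMap.add_apply, ContinuousMap.smul_apply, ContinuousMap.const_apply, smul_eq_mul]
  induction ζ using OnePoint.rec with
  | infty =>
    have : I OnePoint.infty = 0 := by rw [hIapp]; simp [bump]
    rw [this]; simp; positivity
  | coe z =>
    have := key z
    have e : C⁻¹ * I z + F OnePoint.infty - F z = C⁻¹ * (I z - C * h z) := by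
      rw [hh]; field_simp; ring
    rw [e, abs_mul, abs_of_pos (inv_pos.2 hCpos), inv_mul_le_iff₀ hCpos]
    linarith

end

section

/-- Unnormalised averaging operator on the product space. -/
def GU : (SymX N → ℝ) →ₗ[ℝ] (SymX N → ℝ) where
  toFun h := fun x => ∑ v : Fin N, push (p v) (q v) (fun z => h (consW v x.1, z)) x.2
  map_add' f g := by
    funext b
    simp [push, Finset.sum_add_distrib]
  map_smul' c f := by
    funext b
    simp [push, Finset.mul_sum, Multiset.sum_map_mul_left]

lemma GU_apply (h : SymX N → ℝ) (x : SymX N) :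
    GU p q h x = ∑ v : Fin N, push (p v) (q v) (fun z => h (consW v x.1, z)) x.2 := rfl

lemma GU_eq (h : SymX N → ℝ) (x : SymX N) : ((preimT p q x).map h).sum = GU p q h x := by
  rw [preimT, GU_apply]
  have : ∀ s : Finset (Fin N), ((∑ v ∈ s, (fiber (p v) (q v) x.2).map fun z => (consW v x.1, z)).map h).sum =
      ∑ v ∈ s, push (p v) (q v) (fun z => h (consW v x.1, z)) x.2 := by
    intro s
    induction s using Finset.induction_on with
    | empty => simp
    | insert a s ha ih =>
      rw [Finset.sum_insert ha, Finset.sum_insert ha, Multiset.map_add, Multiset.sum_add, ih]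
      simp [push]
  exact this _

lemma GU_pow_eq (h : SymX N → ℝ) (m : ℕ) (x : SymX N) :
    ((preimTn p q m x).map h).sum = (GU p q ^ m) h x := by
  induction m generalizing x with
  | zero => simp [preimTn]
  | succ m ih =>
    rw [preimTn, Multiset.map_bind, Multiset.sum_bind, pow_succ', Module.End.mul_apply, ← GU_eq]
    simp only [ih]

variable {p q}

lemma GU_mono (hg : Good p q) {f g : SymX N → ℝ} (h : ∀ x ∈ juliaSet p q, f x ≤ g x) :
    ∀ x ∈ juliaSet p q, GU p q f x ≤ GU p q g x := by
  intro x hx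
  rw [GU_apply, GU_apply]
  refine Finset.sum_le_sum fun v _ => push_mono (hg.2.1 v) (hg.2.2.1 v) fun z hz => h _ ?_
  refine julia_back hg ?_
  rw [hz]; exact hx

lemma GU_pow_mono (hg : Good p q) {f g : SymX N → ℝ} (h : ∀ x ∈ juliaSet p q, f x ≤ g x) (m : ℕ) :
    ∀ x ∈ juliaSet p q, (GU p q ^ m) f x ≤ (GU p q ^ m) g x := by
  induction m with
  | zero => simpa using h
  | succ k ih =>
    rw [pow_succ']
    exact GU_mono hg ih

lemma GU_pow_snd (F : Sphere → ℝ) (m : ℕ) :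
    (GU p q ^ m) (fun x => F x.2) = fun x => (Sop p q ^ m) F x.2 := by
  induction m with
  | zero => simp
  | succ k ih =>
    rw [pow_succ', pow_succ', Module.End.mul_apply, ih]; rfl

lemma GU_pow_const (hg : Good p q) (c : ℝ) (m : ℕ) :
    (GU p q ^ m) (fun _ => c) = fun _ => (Dtot p q : ℝ) ^ m * c := by
  have := GU_pow_snd (p := p) (q := q) (fun _ => c) m
  rw [this, Sop_pow_const hg]

variable (p q) in
def OscJ (h : SymX N → ℝ) : Prop := ∀ η : ℝ, 0 < η → ∃ m0, ∀ m ≥ m0, ∀ x ∈ juliaSet p q,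
  ∀ x' ∈ juliaSet p q, |(GU p q ^ m) h x - (GU p q ^ m) h x'| ≤ η * (Dtot p q : ℝ) ^ m

lemma OscJ_snd (hg : Good p q) (hA : NoSuperAttract p q) (F : C(Sphere, ℝ)) :
    OscJ p q fun x => F x.2 := by
  intro η hη
  obtain ⟨m0, h0⟩ := OscW_top hg hA F η hη
  refine ⟨m0, fun m hm x hx x' hx' => ?_⟩
  rw [GU_pow_snd (p := p) (q := q) F m]
  exact h0 m hm _ ⟨x, hx, rfl⟩ _ ⟨x', hx', rfl⟩

lemma OscJ_of_GU (hg : Good p q) {h : SymX N → ℝ} (hh : OscJ p q (GU p q h)) : OscJ p q h := by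
  intro η hη
  have hD : (1 : ℝ) ≤ Dtot p q := by exact_mod_cast Dtot_pos hg
  obtain ⟨m0, h0⟩ := hh (η * Dtot p q) (by positivity)
  refine ⟨m0 + 1, fun m hm x hx x' hx' => ?_⟩
  obtain ⟨k, rfl⟩ : ∃ k, m = k + 1 := ⟨m - 1, by omega⟩
  have := h0 k (by omega) x hx x' hx'
  rw [pow_succ, Module.End.mul_apply, pow_succ]
  linarith

lemma GU_pow_abs (hg : Good p q) {f g : SymX N → ℝ} {ε : ℝ}
    (h : ∀ x ∈ juliaSet p q, |f x - g x| ≤ ε) (m : ℕ) {x : SymX N} (hx : x ∈ juliaSet p q) :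
    |(GU p q ^ m) f x - (GU p q ^ m) g x| ≤ (Dtot p q : ℝ) ^ m * ε := by
  have e : (GU p q ^ m) f x - (GU p q ^ m) g x = (GU p q ^ m) (f - g) x := by
    rw [map_sub]; rfl
  rw [e, abs_le]
  have h1 := GU_pow_mono hg (f := f - g) (g := fun _ => ε)
    (fun z hz => (abs_le.1 (h z hz)).2) m x hx
  have h2 := GU_pow_mono hg (g := f - g) (f := fun _ => -ε)
    (fun z hz => (abs_le.1 (h z hz)).1) m x hx
  rw [GU_pow_const hg] at h1 h2
  constructor <;> linarith

/-- `f` depends on the first `k` letters only. -/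
def Cyl (k : ℕ) (f : (ℕ → Fin N) → C(Sphere, ℝ)) : Prop :=
  ∀ w w' : ℕ → Fin N, (∀ i < k, w i = w' i) → f w = f w'

lemma OscJ_cyl (hg : Good p q) (hA : NoSuperAttract p q) (k : ℕ) :
    ∀ f : (ℕ → Fin N) → C(Sphere, ℝ), Cyl k f → OscJ p q fun x => f x.1 x.2 := by
  induction k with
  | zero =>
    intro f hf
    have w0 : ℕ → Fin N := fun _ => ⟨0, hg.1⟩
    have : (fun x : SymX N => f x.1 x.2) = fun x => f w0 x.2 := by
      funext x; rw [hf x.1 w0 (by simp)]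
    rw [this]
    exact OscJ_snd hg hA _
  | succ k ih =>
    intro f hf
    refine OscJ_of_GU hg ?_
    refine ih (fun w => ⟨fun z => ∑ v : Fin N, push (p v) (q v) (f (consW v w)) z,
      continuous_finsetSum _ fun v _ => push_continuous (hg.2.1 v) (hg.2.2.1 v) (f _).continuous⟩) ?_
    intro w w' hw
    ext z
    simp only [ContinuousMap.coe_mk]
    refine Finset.sum_congr rfl fun v _ => ?_
    rw [hf (consW v w) (consW v w')]
    intro i hi
    unfold consW
    split_ifs
    · rfl
    · exact hw _ (by omega)

variable (p q) in
def cylAlg : Subalgebra ℝ C(↥(juliaSet p q), ℝ) where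
  carrier := {g | ∃ k f, Cyl k f ∧ ∀ x, g x = f x.1.1 x.1.2}
  mul_mem' := by
    rintro a b ⟨k, f, hf, ha⟩ ⟨k', f', hf', hb⟩
    refine ⟨max k k', fun w => f w * f' w, fun w w' h => ?_, fun x => by simp [ha, hb]⟩
    simp only
    rw [hf w w' fun i hi => h i (lt_max_of_lt_left hi), hf' w w' fun i hi => h i (lt_max_of_lt_right hi)]
  add_mem' := by
    rintro a b ⟨k, f, hf, ha⟩ ⟨k', f', hf', hb⟩
    refine ⟨max k k', fun w => f w + f' w, fun w w' h => ?_, fun x => by simp [ha, hb]⟩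
    simp only
    rw [hf w w' fun i hi => h i (lt_max_of_lt_left hi), hf' w w' fun i hi => h i (lt_max_of_lt_right hi)]
  algebraMap_mem' c := ⟨0, fun _ => ContinuousMap.const _ c, fun _ _ _ => rfl, fun x => by simp⟩

lemma cylAlg_sep : (cylAlg p q).SeparatesPoints := by
  intro x y hxy
  by_cases hz : x.1.2 = y.1.2
  · have hw : x.1.1 ≠ y.1.1 := fun h => hxy (Subtype.ext (Prod.ext h hz))
    obtain ⟨n, hn⟩ := Function.ne_iff.1 hw
    have hcont : Continuous fun z : ↥(juliaSet p q) => if z.1.1 n = x.1.1 n then (1:ℝ) else 0 := by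
      have h1 : Continuous fun z : ↥(juliaSet p q) => z.1.1 n :=
        (continuous_apply n).comp (continuous_fst.comp continuous_subtype_val)
      exact (continuous_of_discreteTopology (f := fun i : Fin N => if i = x.1.1 n then (1:ℝ) else 0)).comp h1
    refine ⟨_, ⟨⟨_, hcont⟩, ⟨n + 1, fun w => ContinuousMap.const _ (if w n = x.1.1 n then 1 else 0), ?_, fun z => rfl⟩, rfl⟩, ?_⟩
    · intro w w' h
      simp only
      rw [h n (by omega)]
    · simp [hn.symm]
  · have hcont : Continuous fun z : Sphere => kap x.1.2 z := continuous_kap_right x.1.2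
    refine ⟨_, ⟨⟨_, (hcont.comp (continuous_snd.comp continuous_subtype_val))⟩, ⟨0, fun _ => ⟨_, hcont⟩, fun _ _ _ => rfl, fun z => rfl⟩, rfl⟩, ?_⟩
    simp only [ContinuousMap.coe_mk, Function.comp]
    rw [kap_self]
    intro h
    exact hz (kap_eq_zero.1 h.symm)

lemma OscJ_all (hg : Good p q) (hA : NoSuperAttract p q) (h : C(↥(juliaSet p q), ℝ)) :
    OscJ p q (jextend p q h) := by
  have : CompactSpace ↥(juliaSet p q) := isCompact_iff_compactSpace.1 (isClosed_juliaSet p q).isCompact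
  have htop := ContinuousMap.subalgebra_topologicalClosure_eq_top_of_separatesPoints _ (cylAlg_sep (p := p) (q := q))
  have hm : h ∈ (cylAlg p q).topologicalClosure := by rw [htop]; trivial
  have hm' : h ∈ closure (cylAlg p q : Set C(↥(juliaSet p q), ℝ)) := hm
  rw [Metric.mem_closure_iff] at hm'
  intro η hη
  obtain ⟨g, ⟨k, f, hf, hgf⟩, hd⟩ := hm' (η / 3) (by positivity)
  obtain ⟨m0, h0⟩ := OscJ_cyl hg hA k f hf (η / 3) (by positivity)
  refine ⟨m0, fun m hm b hb b' hb' => ?_⟩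
  have hz : ∀ x ∈ juliaSet p q, |jextend p q h x - f x.1 x.2| ≤ η / 3 := fun x hx => by
    have := (ContinuousMap.dist_apply_le_dist (f := h) (g := g) ⟨x, hx⟩).trans hd.le
    rw [Real.dist_eq, hgf] at this
    simpa [jextend, hx] using this
  have i1 := GU_pow_abs hg hz m hb
  have i2 := GU_pow_abs hg hz m hb'
  have i3 := h0 m hm b hb b' hb'
  rw [abs_le] at *
  constructor <;> linarith

end

section

lemma metrizable_sphere : TopologicalSpace.MetrizableSpace Sphere := by
  have h : Module.finrank ℝ ℂ + 1 = Fintype.card (Fin 3) := by simp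
  exact (onePointEquivSphereOfFinrankEq h).isEmbedding.metrizableSpace

lemma Gm_eq (h : SymX N → ℝ) (m : ℕ) (x : SymX N) :
    GmFun p q h m x = ((Dtot p q : ℝ) ^ m)⁻¹ * (GU p q ^ m) h x := by
  rw [GmFun, GU_pow_eq]

variable {p q}

lemma Gm_abs (hg : Good p q) {f g : SymX N → ℝ} {ε : ℝ}
    (h : ∀ x ∈ juliaSet p q, |f x - g x| ≤ ε) (m : ℕ) {x : SymX N} (hx : x ∈ juliaSet p q) :
    |GmFun p q f m x - GmFun p q g m x| ≤ ε := by
  have hD : (1 : ℝ) ≤ Dtot p q := by exact_mod_cast Dtot_pos hg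
  have hp : (0 : ℝ) < (Dtot p q : ℝ) ^ m := by positivity
  rw [Gm_eq, Gm_eq, ← mul_sub, abs_mul, abs_of_pos (inv_pos.2 hp), inv_mul_le_iff₀ hp]
  exact GU_pow_abs hg h m hx

lemma Gm_osc (hg : Good p q) (hA : NoSuperAttract p q) (h : C(↥(juliaSet p q), ℝ)) {η : ℝ} (hη : 0 < η) :
    ∃ m0, ∀ m ≥ m0, ∀ n ≥ m, ∀ x ∈ juliaSet p q, ∀ y ∈ juliaSet p q,
      |GmFun p q (jextend p q h) n x - GmFun p q (jextend p q h) m y| ≤ η := by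
  have hD : (1 : ℝ) ≤ Dtot p q := by exact_mod_cast Dtot_pos hg
  obtain ⟨m0, h0⟩ := OscJ_all hg hA h η hη
  refine ⟨m0, fun m hm n hn x hx y hy => ?_⟩
  obtain ⟨k, rfl⟩ := Nat.exists_eq_add_of_le hn
  have hp : (0 : ℝ) < (Dtot p q : ℝ) ^ m := by positivity
  have hk : (0 : ℝ) < (Dtot p q : ℝ) ^ k := by positivity
  have hz := GU_pow_abs hg (f := (GU p q ^ m) (jextend p q h))
    (g := fun _ => (GU p q ^ m) (jextend p q h) y) (fun z hz => h0 m hm z hz y hy) k hx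
  rw [GU_pow_const hg, ← Module.End.mul_apply, ← pow_add, add_comm k m] at hz
  rw [Gm_eq, Gm_eq]
  have e : ((Dtot p q : ℝ) ^ (m + k))⁻¹ * (GU p q ^ (m + k)) (jextend p q h) x -
      ((Dtot p q : ℝ) ^ m)⁻¹ * (GU p q ^ m) (jextend p q h) y =
      ((Dtot p q : ℝ) ^ (m + k))⁻¹ * ((GU p q ^ (m + k)) (jextend p q h) x -
        (Dtot p q : ℝ) ^ k * (GU p q ^ m) (jextend p q h) y) := by
    rw [pow_add]; field_simp
  have hmk : (0 : ℝ) < (Dtot p q : ℝ) ^ (m + k) := by positivity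
  rw [e, abs_mul, abs_of_pos (inv_pos.2 hmk), inv_mul_le_iff₀ hmk]
  refine hz.trans (le_of_eq ?_)
  rw [pow_add]; ring

lemma Gm_lim (hg : Good p q) (hA : NoSuperAttract p q) (h : C(↥(juliaSet p q), ℝ)) :
    ∃ l : ℝ, TendstoUniformly (fun (m : ℕ) (x : ↥(juliaSet p q)) =>
          GmFun p q (jextend p q ⇑h) m (x : SymX N)) (fun _ => l) atTop := by
  obtain ⟨x0, hx0⟩ := julia_nonempty hg
  have hC : CauchySeq fun m => GmFun p q (jextend p q ⇑h) m x0 := by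
    refine Metric.cauchySeq_iff'.2 fun ε hε => ?_
    obtain ⟨m0, h0⟩ := Gm_osc hg hA h (half_pos hε)
    refine ⟨m0, fun n hn => ?_⟩
    rw [Real.dist_eq]
    have := h0 m0 le_rfl n hn x0 hx0 x0 hx0
    linarith
  obtain ⟨l, hl⟩ := cauchySeq_tendsto_of_complete hC
  refine ⟨l, Metric.tendstoUniformly_iff.2 fun ε hε => ?_⟩
  obtain ⟨m0, h0⟩ := Gm_osc hg hA h (half_pos hε)
  filter_upwards [eventually_ge_atTop m0] with m hm x
  have : |l - GmFun p q (jextend p q ⇑h) m x| ≤ ε / 2 := by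
    refine le_of_tendsto (hl.sub_const _).abs ?_
    filter_upwards [eventually_ge_atTop m] with n hn
    exact h0 m hm n hn x0 hx0 x x.2
  rw [Real.dist_eq]; linarith

lemma jextend_mem (f : ↥(juliaSet p q) → ℝ) {x : SymX N} (hx : x ∈ juliaSet p q) :
    jextend p q f x = f ⟨x, hx⟩ := by simp [jextend, hx]

lemma rep_measure (hne : Nonempty ↥(juliaSet p q)) (L : C(↥(juliaSet p q), ℝ) → ℝ)
    (hadd : ∀ h h' : C(↥(juliaSet p q), ℝ), L (h + h') = L h + L h')
    (hsmul : ∀ (c : ℝ) (h : C(↥(juliaSet p q), ℝ)), L (c • h) = c * L h)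
    (hpos : ∀ h : C(↥(juliaSet p q), ℝ), (∀ x, 0 ≤ h x) → 0 ≤ L h)
    (h1 : L 1 = 1) :
    ∃! μ : Measure ↥(juliaSet p q), IsProbabilityMeasure μ ∧
        ∀ h : C(↥(juliaSet p q), ℝ), L h = ∫ x, h x ∂μ := by
  have : CompactSpace ↥(juliaSet p q) := isCompact_iff_compactSpace.1 (isClosed_juliaSet p q).isCompact
  have := metrizable_sphere
  letI := TopologicalSpace.metrizableSpaceMetric ↥(juliaSet p q)
  let Λ : CompactlySupportedContinuousMap ↥(juliaSet p q) ℝ →ₚ[ℝ] ℝ :=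
    PositiveLinearMap.mk₀
      { toFun := fun f => L f.toContinuousMap
        map_add' := fun f g => hadd _ _
        map_smul' := fun c f => hsmul _ _ }
      (fun f hf => hpos _ fun x => hf x)
  let cc : C(↥(juliaSet p q), ℝ) → CompactlySupportedContinuousMap ↥(juliaSet p q) ℝ :=
    fun f => ⟨f, HasCompactSupport.of_compactSpace _⟩
  have hrep : ∀ h : C(↥(juliaSet p q), ℝ), L h = ∫ x, h x ∂(RealRMK.rieszMeasure Λ) := fun h =>
    (RealRMK.integral_rieszMeasure Λ (cc h)).symm
  refine ⟨RealRMK.rieszMeasure Λ, ⟨?_, hrep⟩, ?_⟩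
  · have := hrep 1
    rw [h1] at this
    simp only [ContinuousMap.one_apply, integral_const, smul_eq_mul, mul_one, Measure.real] at this
    exact ⟨(ENNReal.toReal_eq_one_iff _).1 this.symm⟩
  · rintro ν ⟨hν, hν'⟩
    have hP : IsProbabilityMeasure (RealRMK.rieszMeasure Λ) := by
      have := hrep 1
      rw [h1] at this
      simp only [ContinuousMap.one_apply, integral_const, smul_eq_mul, mul_one, Measure.real] at this
      exact ⟨(ENNReal.toReal_eq_one_iff _).1 this.symm⟩
    refine ext_of_forall_integral_eq_of_IsFiniteMeasure fun f => ?_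
    exact (hν' f.toContinuousMap).symm.trans (hrep f.toContinuousMap)

lemma main_aux (hg : Good p q) (hA1 : NoSuperAttract p q) :
    ∃ L : C(↥(juliaSet p q), ℝ) → ℝ,
      (∀ h : C(↥(juliaSet p q), ℝ),
        TendstoUniformly (fun (m : ℕ) (x : ↥(juliaSet p q)) =>
          GmFun p q (jextend p q ⇑h) m (x : SymX N)) (fun _ => L h) atTop) ∧
      (∀ h h' : C(↥(juliaSet p q), ℝ), L (h + h') = L h + L h') ∧
      (∀ (c : ℝ) (h : C(↥(juliaSet p q), ℝ)), L (c • h) = c * L h) ∧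
      (∀ h : C(↥(juliaSet p q), ℝ), (∀ x, 0 ≤ h x) → 0 ≤ L h) ∧
      L 1 = 1 ∧
      (∀ h h' : C(↥(juliaSet p q), ℝ), |L h - L h'| ≤ supJ p q fun x => h x - h' x) ∧
      (∃! μ : Measure ↥(juliaSet p q), IsProbabilityMeasure μ ∧
        ∀ h : C(↥(juliaSet p q), ℝ), L h = ∫ x, h x ∂μ) := by
  have hcomp : CompactSpace ↥(juliaSet p q) :=
    isCompact_iff_compactSpace.1 (isClosed_juliaSet p q).isCompact
  choose L hL using fun h => Gm_lim hg hA1 h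
  obtain ⟨x0, hx0⟩ := julia_nonempty hg
  have hD : (1 : ℝ) ≤ Dtot p q := by exact_mod_cast Dtot_pos hg
  have hl : ∀ h : C(↥(juliaSet p q), ℝ), Tendsto (fun m => GmFun p q (jextend p q ⇑h) m x0) atTop (𝓝 (L h)) :=
    fun h => (hL h).tendsto_at ⟨x0, hx0⟩
  have hadd : ∀ h h' : C(↥(juliaSet p q), ℝ), L (h + h') = L h + L h' := fun h h' => by
    refine tendsto_nhds_unique (hl _) (((hl h).add (hl h')).congr fun m => ?_)
    have : jextend p q ⇑(h + h') = jextend p q h + jextend p q h' := by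
      funext x; simp only [jextend, Pi.add_apply]; split_ifs <;> simp
    rw [this, Gm_eq, Gm_eq, Gm_eq, map_add, Pi.add_apply, mul_add]
  have hsmul : ∀ (c : ℝ) (h : C(↥(juliaSet p q), ℝ)), L (c • h) = c * L h := fun c h => by
    refine tendsto_nhds_unique (hl _) (((hl h).const_mul c).congr fun m => ?_)
    have : jextend p q ⇑(c • h) = c • jextend p q h := by
      funext x; simp only [jextend, Pi.smul_apply]; split_ifs <;> simp
    rw [this, Gm_eq, Gm_eq, map_smul, Pi.smul_apply, smul_eq_mul]
    ring
  have hpos : ∀ h : C(↥(juliaSet p q), ℝ), (∀ x, 0 ≤ h x) → 0 ≤ L h := fun h hh => by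
    refine ge_of_tendsto' (hl h) fun m => ?_
    have := GU_pow_mono hg (f := fun _ => 0) (g := jextend p q h)
      (fun x hx => by rw [jextend_mem _ hx]; exact hh _) m x0 hx0
    rw [GU_pow_const hg, mul_zero] at this
    rw [Gm_eq]; exact mul_nonneg (by positivity) this
  have h1 : L 1 = 1 := by
    refine tendsto_nhds_unique (hl 1) (tendsto_const_nhds.congr fun m => ?_)
    have := Gm_abs hg (f := jextend p q (1 : C(↥(juliaSet p q), ℝ))) (g := fun _ => 1) (ε := 0)
      (fun x hx => by rw [jextend_mem _ hx]; simp) m hx0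
    have h2 := abs_nonpos_iff.1 this
    rw [sub_eq_zero.1 h2, Gm_eq, GU_pow_const hg, mul_one, inv_mul_cancel₀ (by positivity)]
  refine ⟨L, hL, hadd, hsmul, hpos, h1, fun h h' => ?_, rep_measure ⟨⟨x0, hx0⟩⟩ L hadd hsmul hpos h1⟩
  have hb : BddAbove (Set.range fun x => |h x - h' x|) :=
    (isCompact_range ((h.continuous.sub h'.continuous).abs)).bddAbove
  refine le_of_tendsto' ((hl h).sub (hl h')).abs fun m => Gm_abs hg (fun x hx => ?_) m hx0
  rw [jextend_mem _ hx, jextend_mem _ hx]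
  exact le_ciSup hb ⟨x, hx⟩

end

theorem averaging_operator_limit_functional
    (hg : Good p q) (hA1 : NoSuperAttract p q) :
    ∃ L : C(↥(juliaSet p q), ℝ) → ℝ,
      (∀ h : C(↥(juliaSet p q), ℝ),
        TendstoUniformly (fun (m : ℕ) (x : ↥(juliaSet p q)) =>
          GmFun p q (jextend p q ⇑h) m (x : SymX N)) (fun _ => L h) atTop) ∧
      (∀ h h' : C(↥(juliaSet p q), ℝ), L (h + h') = L h + L h') ∧
      (∀ (c : ℝ) (h : C(↥(juliaSet p q), ℝ)), L (c • h) = c * L h) ∧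
      (∀ h : C(↥(juliaSet p q), ℝ), (∀ x, 0 ≤ h x) → 0 ≤ L h) ∧
      L 1 = 1 ∧
      (∀ h h' : C(↥(juliaSet p q), ℝ), |L h - L h'| ≤ supJ p q fun x => h x - h' x) ∧
      (∃! μ : Measure ↥(juliaSet p q), IsProbabilityMeasure μ ∧
        ∀ h : C(↥(juliaSet p q), ℝ), L h = ∫ x, h x ∂μ) := by
  exact main_aux hg hA1

end SkewRational
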